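/- arXiv:1308.4437 — 2 statements merged into one kernel-verified Lean document; each statement's English description precedes it below -/
import Mathlib

section
/- Let k ≥ 2 be an integer and let n ∈ ℕ^ℕ be regular, with Φ^{-1}(n) = {α}. Then the set of non-trivial extreme points of DF(n) satisfies E(n) = FE(n) ∪ {α}; moreover, if E(n) is infinite then α is an accumulation point of E(n). -/
open Filter Topology
open scoped Classical

namespace BetaDF

/-- Digit sequences (elements of `Σ = {0,…,k−1}^ℕ` when all entries are `< k`). -/
abbrev Seq : Type := ℕ → ℕ

/-- Lexicographic (strict) order on digit sequences. -/
def seqLt (v w : Seq) : Prop := ∃ r, (∀ s, s < r → v s = w s) ∧ v r < w r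

/-- Lexicographic order on digit sequences. -/
def seqLe (v w : Seq) : Prop := seqLt v w ∨ v = w

/-- The shift map `σ`. -/
def shift (w : Seq) : Seq := fun r => w (r + 1)

/-- Membership in `Σ = {0,…,k−1}^ℕ`. -/
def InSigma (k : ℕ) (w : Seq) : Prop := ∀ r, w r < k

/-- A sequence is maximal if it is `≥` every element of its shift orbit. -/
def IsMaximal (w : Seq) : Prop := ∀ r, seqLe (shift^[r] w) w

/-- Number of occurrences of the digit `i` among the first `r` entries of `w`. -/
def digitCount (w : Seq) (i r : ℕ) : ℕ := ((Finset.range r).filter fun s => w s = i).card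

/-- The ambient Euclidean space `ℝ^k`. -/
abbrev E (k : ℕ) : Type := EuclideanSpace ℝ (Fin k)

/-- The `i`-th coordinate (with junk value `0` for `i ≥ k`). -/
def proj {k : ℕ} (α : E k) (i : ℕ) : ℝ := if h : i < k then α ⟨i, h⟩ else 0

/-- `w` has digit frequency vector `α`. -/
def HasDigitFreq (k : ℕ) (w : Seq) (α : E k) : Prop :=
  ∀ i, i < k →
    Tendsto (fun r => (digitCount w i r : ℝ) / (r : ℝ)) atTop (𝓝 (proj α i))

/-- The standard `(k−1)`-simplex `Δ`. -/
def simplex (k : ℕ) : Set (E k) := {α | (∀ i : Fin k, 0 ≤ α i) ∧ ∑ i, α i = 1}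

/-- The face `F = {α ∈ Δ : α_{k−1} = 0}`. -/
def faceF (k : ℕ) : Set (E k) := {α ∈ simplex k | proj α (k - 1) = 0}

/-- `Δ' = Δ ∖ F`. -/
def simplex' (k : ℕ) : Set (E k) := simplex k \ faceF k

/-- `J(α) = ⌊α₀/α_{k−1}⌋`. -/
noncomputable def Jfun {k : ℕ} (α : E k) : ℕ := ⌊proj α 0 / proj α (k - 1)⌋₊

/-- The map `K_n`. -/
noncomputable def Kmap {k : ℕ} (n : ℕ) (α : E k) : E k :=
  (WithLp.equiv 2 (Fin k → ℝ)).symm fun i =>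
    if (i : ℕ) + 2 < k then proj α ((i : ℕ) + 1) / (1 - proj α 0)
    else if (i : ℕ) + 2 = k then (proj α 0 - n * proj α (k - 1)) / (1 - proj α 0)
    else ((n + 1) * proj α (k - 1) - proj α 0) / (1 - proj α 0)

/-- The continued-fraction map `K : Δ' → Δ'`, `K(α) = K_{J(α)}(α)`. -/
noncomputable def Kstep {k : ℕ} (α : E k) : E k := Kmap (Jfun α) α

/-- The itinerary map `Φ(α)_r = J(K^r(α))`. -/
noncomputable def Phi {k : ℕ} (α : E k) : ℕ → ℕ := fun r => Jfun (Kstep^[r] α)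

/-- The projective embedding `K_n^{-1} : Δ → Δ`. -/
noncomputable def Kinv {k : ℕ} (n : ℕ) (α : E k) : E k :=
  (WithLp.equiv 2 (Fin k → ℝ)).symm fun i =>
    (if (i : ℕ) = 0 then (n + 1) * proj α (k - 2) + n * proj α (k - 1)
      else if (i : ℕ) + 1 = k then proj α (k - 2) + proj α (k - 1)
      else proj α ((i : ℕ) - 1)) /
      ((n + 1) * proj α (k - 2) + n * proj α (k - 1) + 1)

/-- `Υ_{n,r} = K_{n₀}^{-1} ∘ ⋯ ∘ K_{n_r}^{-1}`. -/
noncomputable def Ups {k : ℕ} (n : ℕ → ℕ) : ℕ → E k → E k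
  | 0 => Kinv (n 0)
  | r + 1 => fun α => Ups n r (Kinv (n (r + 1)) α)

/-- `A_{n,r} = Υ_{n,r}(Δ)`. -/
noncomputable def Anr (k : ℕ) (n : ℕ → ℕ) (r : ℕ) : Set (E k) := Ups n r '' simplex k

/-- `F_{n,r} = Υ_{n,r}(F)`. -/
noncomputable def Fnr (k : ℕ) (n : ℕ → ℕ) (r : ℕ) : Set (E k) := Ups n r '' faceF k

/-- Reverse-lexicographic strict order on `ℕ^ℕ`: `a < b` iff `a` exceeds `b`
at the first index where they differ. -/
def revLexLt (a b : ℕ → ℕ) : Prop := ∃ r, (∀ s, s < r → a s = b s) ∧ b r < a r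

/-- The word to which the substitution `Λ_n` sends the digit `i`. -/
def lamWord (k n i : ℕ) : List ℕ :=
  if i + 2 < k then [i + 1]
  else if i + 2 = k then (k - 1) :: List.replicate (n + 1) 0
  else (k - 1) :: List.replicate n 0

/-- The substitution `Λ_n : Σ → Σ`. -/
def lamSub (k n : ℕ) (w : Seq) : Seq := fun m =>
  (((List.range (m + 1)).map fun r => lamWord k n (w r)).flatten).getD m 0

/-- `Λ_{n,r} = Λ_{n₀} ∘ ⋯ ∘ Λ_{n_r}`. -/
def lamChain (k : ℕ) (n : ℕ → ℕ) : ℕ → Seq → Seq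
  | 0 => lamSub k (n 0)
  | r + 1 => fun w => lamChain k n r (lamSub k (n (r + 1)) w)

/-- `Λ_{n₀} ∘ ⋯ ∘ Λ_{n_{R−1}}` for a finite list of indices. -/
def lamList (k : ℕ) : List ℕ → Seq → Seq
  | [], w => w
  | a :: t, w => lamSub k a (lamList k t w)

/-- The constant sequence `(k−1)(k−1)(k−1)…`. -/
def topSeq (k : ℕ) : Seq := fun _ => k - 1

/-- The sequence `(k−1)000…`. -/
def baseSeq (k : ℕ) : Seq := fun m => if m = 0 then k - 1 else 0

/-- `S(n) = lim_{r→∞} Λ_{n,r}((k−1)(k−1)(k−1)…)` (limit in the product topology). -/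
noncomputable def Sseq (k : ℕ) (n : ℕ → ℕ) : Seq :=
  limUnder atTop fun r => lamChain k n r (topSeq k)

/-- The compactified itinerary space `N`: sequences with values in `ℕ∞` such that
all entries from the first `∞` onwards equal `∞`.  Elements with no `∞` entry
correspond to `ℕ^ℕ`; the others are the finite type elements `n₀…n_{R−1}∞`. -/
def NN : Type := {m : ℕ → ℕ∞ // ∀ r, m r = ⊤ → m (r + 1) = ⊤}

/-- Reverse-lexicographic strict order on `N` (`∞` counts as larger than every natural). -/
def nnLt (m n : NN) : Prop := ∃ r, (∀ s, s < r → m.1 s = n.1 s) ∧ n.1 r < m.1 r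

/-- Reverse-lexicographic order on `N`. -/
def nnLe (m n : NN) : Prop := nnLt m n ∨ m = n

/-- The element of `N` determined by an element of `ℕ^ℕ`. -/
def toNN (g : ℕ → ℕ) : NN := ⟨fun r => (g r : ℕ∞), fun r h => absurd h (by simp)⟩

/-- The itinerary `n₀ … n_{R−1} (n_R + 1) 0 0 0 …` (of rational type). -/
def ratSeq (f : ℕ → ℕ) (R : ℕ) : ℕ → ℕ := fun r =>
  if r < R then f r else if r = R then f R + 1 else 0

/-- The finite type element `n₀ … n_{R−1} n_R ∞` of `N`. -/
def finNN (f : ℕ → ℕ) (R : ℕ) : NN :=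
  ⟨fun r => if r ≤ R then (f r : ℕ∞) else ⊤, by
    intro r h
    show (if r + 1 ≤ R then ((f (r + 1) : ℕ∞)) else ⊤) = ⊤
    have h' : (if r ≤ R then ((f r : ℕ∞)) else ⊤) = ⊤ := h
    by_cases h1 : r ≤ R
    · rw [if_pos h1] at h'
      exact absurd h' (by simp)
    · rw [if_neg (by omega : ¬ r + 1 ≤ R)]⟩

/-- The extension of `S` to `N`. -/
noncomputable def SN (k : ℕ) (m : NN) : Seq :=
  if h : ∃ R, m.1 R = ⊤ then
    lamList k ((List.range (Nat.find h)).map fun r => (m.1 r).toNat) (baseSeq k)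
  else Sseq k fun r => (m.1 r).toNat

/-- The metric `d(m,n) = 2^{−X(m,n)}` on `N`, where
`X(m,n) = r + min(m₀+⋯+m_r, n₀+⋯+n_r)` and `r` is the first index where `m,n` differ. -/
noncomputable def dN (m n : NN) : ℝ :=
  if h : m = n then 0
  else
    have hex : ∃ r, m.1 r ≠ n.1 r := by
      by_contra hc
      push_neg at hc
      exact h (Subtype.ext (funext hc))
    (2 : ℝ) ^ (-(((Nat.find hex : ℕ) : ℤ) +
      ((min (∑ s ∈ Finset.range (Nat.find hex + 1), m.1 s)
            (∑ s ∈ Finset.range (Nat.find hex + 1), n.1 s)).toNat : ℤ)))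

/-- The symbolic β-shift `X(w)`. -/
def Xset (k : ℕ) (w : Seq) : Set Seq :=
  {v | InSigma k v ∧ ∀ r, seqLe (shift^[r] v) w}

/-- The digit frequency set `DF(w)` of the symbolic β-shift `X(w)`. -/
def DFw (k : ℕ) (w : Seq) : Set (E k) :=
  {α | α ∈ simplex k ∧ ∃ v ∈ Xset k w, HasDigitFreq k v α}

/-- `DF(n) = DF(S(n))` for `n ∈ ℕ^ℕ`. -/
noncomputable def DFn (k : ℕ) (n : ℕ → ℕ) : Set (E k) := DFw k (Sseq k n)

/-- `DF(n) = DF(S(n))` for `n ∈ N`. -/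
noncomputable def DFN (k : ℕ) (m : NN) : Set (E k) := DFw k (SN k m)

/-- The infimax map `I = S ∘ Φ` on `Δ'`, extended by `I(α) = (k−1)000…` on `F`. -/
noncomputable def Ifun (k : ℕ) (α : E k) : Seq :=
  if α ∈ simplex' k then Sseq k (Phi α) else baseSeq k

/-- The simplex `T_m = {α ∈ Δ : (m+1)α_{k−1} ≤ α₀}`. -/
def Tset (k m : ℕ) : Set (E k) :=
  {α ∈ simplex k | ((m : ℝ) + 1) * proj α (k - 1) ≤ proj α 0}

/-- The standard basis vector `e_i`. -/
noncomputable def evec (k i : ℕ) : E k :=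
  (WithLp.equiv 2 (Fin k → ℝ)).symm fun j => if (j : ℕ) = i then 1 else 0

/-- The rational extreme points
`FE(n) = {Υ_{n,s}(e_{k−2}) : n_{s+t} ≠ 0 for some 1 ≤ t ≤ k−2}`. -/
noncomputable def FEset (k : ℕ) (n : ℕ → ℕ) : Set (E k) :=
  {α | ∃ s, (∃ t, 1 ≤ t ∧ t ≤ k - 2 ∧ n (s + t) ≠ 0) ∧ α = Ups n s (evec k (k - 2))}

/-- The set `E(n)` of non-trivial extreme points of `DF(n)`:
extreme points other than `e₀,…,e_{k−2}`. -/
noncomputable def Eset (k : ℕ) (n : ℕ → ℕ) : Set (E k) :=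
  Set.extremePoints ℝ (DFn k n) \ {α | ∃ i, i ≤ k - 2 ∧ α = evec k i}

/-- The fiber `Φ^{-1}(n) ⊆ Δ'`. -/
noncomputable def PhiFiber (k : ℕ) (n : ℕ → ℕ) : Set (E k) :=
  {α ∈ simplex' k | Phi α = n}

/-- `f_β(x) = βx mod 1`. -/
noncomputable def fbeta (β x : ℝ) : ℝ := Int.fract (β * x)

/-- The digit sequence of the greedy β-expansion of `x`: `d_β(x)_r = ⌊β f_β^r(x)⌋`. -/
noncomputable def dbeta (β : ℝ) (x : ℝ) : Seq := fun r => ⌊β * (fbeta β)^[r] x⌋₊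

/-- The digit frequency set `DF(β)` of β-expansions of points of `[0,1]`. -/
noncomputable def DFbeta (k : ℕ) (β : ℝ) : Set (E k) :=
  {α | α ∈ simplex k ∧ ∃ x ∈ Set.Icc (0 : ℝ) 1, HasDigitFreq k (dbeta β x) α}

/-- The sequence `w_β`: if `d_β(1) = d₁…d_{r−1}d_r000…` with `d_r > 0` then `w_β`
is the infinite repetition of `d₁…d_{r−1}(d_r − 1)`; otherwise `w_β = d_β(1)`. -/
noncomputable def wbeta (β : ℝ) : Seq :=
  if h : ∃ r, dbeta β 1 r ≠ 0 ∧ ∀ s, r < s → dbeta β 1 s = 0 then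
    fun m =>
      if m % (Nat.find h + 1) = Nat.find h then dbeta β 1 (Nat.find h) - 1
      else dbeta β 1 (m % (Nat.find h + 1))
  else dbeta β 1

/-- `DF` extended to `[k−1,k]` by `DF(k−1) = F` and `DF(k) = Δ`. -/
noncomputable def DFext (k : ℕ) (β : ℝ) : Set (E k) :=
  if β ≤ (k : ℝ) - 1 then faceF k
  else if (k : ℝ) ≤ β then simplex k
  else DFbeta k β

/-- The mode-locking interval `I_{n₀…n_R}` determined by the word `f 0, …, f R`. -/
noncomputable def Iint (k : ℕ) (f : ℕ → ℕ) (R : ℕ) : Set ℝ :=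
  {β | (k : ℝ) - 1 < β ∧ β < k ∧
    seqLe (Sseq k (ratSeq f R)) (wbeta β) ∧ seqLe (wbeta β) (SN k (finNN f R))}

/-- The frequency vector of the first `s` digits of `w`. -/
noncomputable def freqVec (k : ℕ) (w : Seq) (s : ℕ) : E k :=
  (WithLp.equiv 2 (Fin k → ℝ)).symm fun i => (digitCount w (i : ℕ) s : ℝ) / (s : ℝ)



/-! ### Linear cones -/

/-- basis vector -/
def eb (i : ℕ) : ℕ → ℝ := fun j => if j = i then 1 else 0

def tot (p : ℕ) (y : ℕ → ℝ) : ℝ := ∑ i ∈ Finset.range (p + 2), y i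

def Orth (p : ℕ) : Set (ℕ → ℝ) := {y | (∀ i, 0 ≤ y i) ∧ ∀ i, p + 2 ≤ i → y i = 0}

def Bm (p n : ℕ) (y : ℕ → ℝ) : ℕ → ℝ := fun i =>
  if i < p then y (i + 1) else if i = p then y 0 - n * y (p + 1)
  else if i = p + 1 then (n + 1) * y (p + 1) - y 0 else 0

def Am (p n : ℕ) (y : ℕ → ℝ) : ℕ → ℝ := fun i =>
  if i = 0 then (n + 1) * y p + n * y (p + 1) else if i = p + 1 then y p + y (p + 1)
  else if i ≤ p then y (i - 1) else 0

def InT (p n : ℕ) (y : ℕ → ℝ) : Prop := (n + 1) * y (p + 1) ≤ y 0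

lemma Bm_Am {p n : ℕ} {y : ℕ → ℝ} (hy : ∀ i, p + 2 ≤ i → y i = 0) : Bm p n (Am p n y) = y := by
  funext i
  rcases lt_trichotomy i p with h | h | h
  · have h1 : i + 1 ≤ p := h
    have h2 : i ≠ p := by omega
    simp [Bm, Am, h, h1, h2]
  · subst h
    simp [Bm, Am]; ring
  · by_cases h1 : i = p + 1
    · subst h1; simp [Bm, Am]; ring
    · have h3 : ¬ i < p := by omega
      have h4 : ¬ i = p := by omega
      simp [Bm, h1, h3, h4]
      rw [hy i (by omega)]

lemma Am_Bm {p n : ℕ} {y : ℕ → ℝ} (hy : ∀ i, p + 2 ≤ i → y i = 0) : Am p n (Bm p n y) = y := by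
  funext i
  by_cases h0 : i = 0
  · subst h0; simp [Bm, Am]; ring
  by_cases h1 : i = p + 1
  · subst h1; simp [Bm, Am]; ring
  by_cases h2 : i ≤ p
  · have h3 : i - 1 < p := by omega
    have h4 : i - 1 + 1 = i := by omega
    simp [Bm, Am, h0, h1, h2, h3, h4]
  · simp [Am, h0, h1, h2]
    rw [hy i (by omega)]

lemma Bm_add (p n : ℕ) (y z : ℕ → ℝ) : Bm p n (y + z) = Bm p n y + Bm p n z := by
  funext i; simp only [Bm, Pi.add_apply]; split_ifs <;> ring

lemma Bm_smul (p n : ℕ) (c : ℝ) (y : ℕ → ℝ) : Bm p n (c • y) = c • Bm p n y := by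
  funext i; simp only [Bm, Pi.smul_apply, smul_eq_mul]; split_ifs <;> ring

lemma Am_add (p n : ℕ) (y z : ℕ → ℝ) : Am p n (y + z) = Am p n y + Am p n z := by
  funext i; simp only [Am, Pi.add_apply]; split_ifs <;> ring

lemma Am_smul (p n : ℕ) (c : ℝ) (y : ℕ → ℝ) : Am p n (c • y) = c • Am p n y := by
  funext i; simp only [Am, Pi.smul_apply, smul_eq_mul]; split_ifs <;> ring

lemma Orth_add {p : ℕ} {y z : ℕ → ℝ} (hy : y ∈ Orth p) (hz : z ∈ Orth p) : y + z ∈ Orth p :=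
  ⟨fun i => add_nonneg (hy.1 i) (hz.1 i), fun i hi => by simp [hy.2 i hi, hz.2 i hi]⟩

lemma Orth_smul {p : ℕ} {y : ℕ → ℝ} {c : ℝ} (hc : 0 ≤ c) (hy : y ∈ Orth p) : c • y ∈ Orth p :=
  ⟨fun i => mul_nonneg hc (hy.1 i), fun i hi => by simp [hy.2 i hi]⟩

lemma Am_Orth {p n : ℕ} {y : ℕ → ℝ} (hy : y ∈ Orth p) : Am p n y ∈ Orth p := by
  refine ⟨fun i => ?_, fun i hi => ?_⟩
  · have h1 := hy.1 p
    have h2 := hy.1 (p+1)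
    simp only [Am]
    split_ifs
    · positivity
    · positivity
    · exact hy.1 _
    · exact le_rfl
  · have h1 : ¬ i = 0 := by omega
    have h2 : ¬ i = p + 1 := by omega
    have h3 : ¬ i ≤ p := by omega
    simp [Am, h1, h2, h3]

def CC (p : ℕ) : ℕ → (ℕ → ℕ) → Set (ℕ → ℝ)
  | 0, _ => Orth p
  | r + 1, n => {y | y ∈ Orth p ∧ (InT p (n 0) y ∨ Bm p (n 0) y ∈ CC p r (shift n))}

def DD (p : ℕ) : ℕ → (ℕ → ℕ) → Set (ℕ → ℝ)
  | 0, _ => Orth p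
  | r + 1, n => {y | y ∈ Orth p ∧ Bm p (n 0) y ∈ DD p r (shift n)}

def Cinf (p : ℕ) (n : ℕ → ℕ) : Set (ℕ → ℝ) := {y | ∀ r, y ∈ CC p r n}

def VV (p : ℕ) : Set (ℕ → ℝ) := {y | (∀ i, i ≠ p + 1 → 0 ≤ y i) ∧ y (p + 1) ≤ 0 ∧ ∀ i, p + 2 ≤ i → y i = 0}

lemma CC_Orth {p r : ℕ} {n : ℕ → ℕ} {y : ℕ → ℝ} (h : y ∈ CC p r n) : y ∈ Orth p := by
  cases r with
  | zero => exact h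
  | succ r => exact h.1

lemma DD_Orth {p r : ℕ} {n : ℕ → ℕ} {y : ℕ → ℝ} (h : y ∈ DD p r n) : y ∈ Orth p := by
  cases r with
  | zero => exact h
  | succ r => exact h.1

lemma Bm_last (p n : ℕ) (y : ℕ → ℝ) : Bm p n y (p + 1) = (n + 1) * y (p + 1) - y 0 := by
  simp [Bm]

lemma Am_last (p n : ℕ) (y : ℕ → ℝ) : Am p n y (p + 1) = y p + y (p + 1) := by
  simp [Am]

/-- The image under `B` of an element of `T`, or of `V`, is in `V`. -/
lemma Bm_VV_of_T {p n : ℕ} {y : ℕ → ℝ} (hy : y ∈ Orth p) (hT : InT p n y) : Bm p n y ∈ VV p := by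
  refine ⟨fun i hi => ?_, ?_, fun i hi => ?_⟩
  · have h1 := hy.1 (p+1)
    have : (n + 1) * y (p + 1) ≤ y 0 := hT
    simp only [Bm]
    split_ifs
    · exact hy.1 _
    · nlinarith
    · exact le_rfl
  · rw [Bm_last]; have : (n + 1) * y (p + 1) ≤ y 0 := hT; linarith
  · simp only [Bm]
    rw [if_neg (by omega), if_neg (by omega), if_neg (by omega)]

lemma Bm_VV {p n : ℕ} {y : ℕ → ℝ} (hy : y ∈ VV p) : Bm p n y ∈ VV p := by
  have h0 := hy.1 0 (by omega)
  have hl := hy.2.1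
  have hn : (0:ℝ) ≤ n := by positivity
  refine ⟨fun i hi => ?_, ?_, fun i hi => ?_⟩
  · simp only [Bm]
    split_ifs
    · exact hy.1 _ (by omega)
    · nlinarith
    · exact le_rfl
  · rw [Bm_last]; nlinarith
  · simp only [Bm]
    rw [if_neg (by omega), if_neg (by omega), if_neg (by omega)]

lemma VV_InT {p n : ℕ} {y : ℕ → ℝ} (hy : y ∈ VV p) : InT p n y := by
  have h0 := hy.1 0 (by omega)
  have hl := hy.2.1
  have hn : (0:ℝ) ≤ n := by positivity
  unfold InT; nlinarith

lemma Orth_of_VV {p : ℕ} {z v : ℕ → ℝ} (hz : z ∈ Orth p) (hv : v ∈ VV p)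
    (h : 0 ≤ (z + v) (p + 1)) : z + v ∈ Orth p := by
  refine ⟨fun i => ?_, fun i hi => ?_⟩
  · by_cases hi : i = p + 1
    · rw [hi]; exact h
    · exact add_nonneg (hz.1 i) (hv.1 i hi)
  · simp [hz.2 i hi, hv.2.2 i hi]

lemma CC_absorb {p : ℕ} : ∀ (r : ℕ) (n : ℕ → ℕ) (z v : ℕ → ℝ), z ∈ CC p r n → v ∈ VV p →
    0 ≤ (z + v) (p + 1) → z + v ∈ CC p r n := by
  intro r
  induction r with
  | zero => intro n z v hz hv h; exact Orth_of_VV hz hv h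
  | succ r ih =>
    intro n z v hz hv h
    refine ⟨Orth_of_VV hz.1 hv h, ?_⟩
    by_cases hT : InT p (n 0) (z + v)
    · exact Or.inl hT
    right
    rcases hz.2 with h1 | h1
    · exfalso; apply hT
      have h2 : InT p (n 0) v := VV_InT hv
      simp only [InT, Pi.add_apply] at *
      linarith
    · rw [Bm_add]
      apply ih _ _ _ h1 (Bm_VV hv)
      rw [← Bm_add, Bm_last]
      simp only [InT, not_le] at hT
      linarith

lemma CC_add {p : ℕ} : ∀ (r : ℕ) (n : ℕ → ℕ) (y z : ℕ → ℝ), y ∈ CC p r n → z ∈ CC p r n →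
    y + z ∈ CC p r n := by
  intro r
  induction r with
  | zero => intro n y z hy hz; exact Orth_add hy hz
  | succ r ih =>
    have key : ∀ (n : ℕ → ℕ) (y z : ℕ → ℝ), y ∈ Orth p → InT p (n 0) y → z ∈ Orth p →
        Bm p (n 0) z ∈ CC p r (shift n) → (InT p (n 0) (z + y) ∨ Bm p (n 0) (z + y) ∈ CC p r (shift n)) := by
      intro n y z hy hT hz hB
      by_cases hT' : InT p (n 0) (z + y)
      · exact Or.inl hT'
      right
      rw [Bm_add]
      apply CC_absorb r _ _ _ hB (Bm_VV_of_T hy hT)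
      rw [← Bm_add, Bm_last]
      simp only [InT, not_le] at hT'
      linarith
    intro n y z hy hz
    refine ⟨Orth_add hy.1 hz.1, ?_⟩
    rcases hy.2 with h1 | h1 <;> rcases hz.2 with h2 | h2
    · left; simp only [InT, Pi.add_apply] at *; linarith
    · rw [add_comm]; exact key n y z hy.1 h1 hz.1 h2
    · exact key n z y hz.1 h2 hy.1 h1
    · right; rw [Bm_add]; exact ih _ _ _ h1 h2

lemma InT_smul {p n : ℕ} {y : ℕ → ℝ} {c : ℝ} (hc : 0 ≤ c) (h : InT p n y) : InT p n (c • y) := by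
  simp only [InT, Pi.smul_apply, smul_eq_mul] at *; nlinarith

lemma CC_smul {p : ℕ} {c : ℝ} (hc : 0 ≤ c) : ∀ (r : ℕ) (n : ℕ → ℕ) (y : ℕ → ℝ), y ∈ CC p r n →
    c • y ∈ CC p r n := by
  intro r
  induction r with
  | zero => intro n y hy; exact Orth_smul hc hy
  | succ r ih =>
    intro n y hy
    refine ⟨Orth_smul hc hy.1, ?_⟩
    rcases hy.2 with h1 | h1
    · exact Or.inl (InT_smul hc h1)
    · right; rw [Bm_smul]; exact ih _ _ h1

lemma DD_smul {p : ℕ} {c : ℝ} (hc : 0 ≤ c) : ∀ (r : ℕ) (n : ℕ → ℕ) (y : ℕ → ℝ), y ∈ DD p r n →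
    c • y ∈ DD p r n := by
  intro r
  induction r with
  | zero => intro n y hy; exact Orth_smul hc hy
  | succ r ih =>
    intro n y hy
    refine ⟨Orth_smul hc hy.1, ?_⟩
    rw [Bm_smul]; exact ih _ _ hy.2

lemma DD_anti {p : ℕ} : ∀ (r : ℕ) (n : ℕ → ℕ), DD p (r + 1) n ⊆ DD p r n := by
  intro r
  induction r with
  | zero => intro n y hy; exact hy.1
  | succ r ih => intro n y hy; exact ⟨hy.1, ih _ hy.2⟩

lemma continuous_Bm (p n : ℕ) : Continuous (Bm p n) := by
  apply continuous_pi
  intro i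
  simp only [Bm]
  split_ifs <;> fun_prop

lemma isClosed_Orth (p : ℕ) : IsClosed (Orth p) := by
  have : Orth p = (⋂ i, {y : ℕ → ℝ | 0 ≤ y i}) ∩ ⋂ i, ⋂ (_ : p + 2 ≤ i), {y : ℕ → ℝ | y i = 0} := by
    ext y; simp [Orth]
  rw [this]
  apply IsClosed.inter
  · exact isClosed_iInter fun i => isClosed_le continuous_const (continuous_apply i)
  · exact isClosed_iInter fun i => isClosed_iInter fun _ =>
      isClosed_eq (continuous_apply i) continuous_const

lemma isClosed_CC (p : ℕ) : ∀ (r : ℕ) (n : ℕ → ℕ), IsClosed (CC p r n) := by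
  intro r
  induction r with
  | zero => intro n; exact isClosed_Orth p
  | succ r ih =>
    intro n
    have : CC p (r+1) n = Orth p ∩ ({y | InT p (n 0) y} ∪ Bm p (n 0) ⁻¹' CC p r (shift n)) := by
      ext y; simp only [CC, Set.mem_setOf_eq, Set.mem_inter_iff, Set.mem_union, Set.mem_preimage]
    rw [this]
    apply (isClosed_Orth p).inter
    apply IsClosed.union
    · exact isClosed_le (by fun_prop) (by fun_prop)
    · exact (ih _).preimage (continuous_Bm p _)

lemma isClosed_DD (p : ℕ) : ∀ (r : ℕ) (n : ℕ → ℕ), IsClosed (DD p r n) := by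
  intro r
  induction r with
  | zero => intro n; exact isClosed_Orth p
  | succ r ih =>
    intro n
    have : DD p (r+1) n = Orth p ∩ (Bm p (n 0) ⁻¹' DD p r (shift n)) := by
      ext y; simp [DD]
    rw [this]
    exact (isClosed_Orth p).inter ((ih _).preimage (continuous_Bm p _))

lemma mem_Cinf {p : ℕ} {n : ℕ → ℕ} {y : ℕ → ℝ} :
    y ∈ Cinf p n ↔ y ∈ Orth p ∧ (InT p (n 0) y ∨ Bm p (n 0) y ∈ Cinf p (shift n)) := by
  constructor
  · intro h
    refine ⟨h 0, ?_⟩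
    by_cases hT : InT p (n 0) y
    · exact Or.inl hT
    · right; intro r
      exact ((h (r+1)).2).resolve_left hT
  · rintro ⟨h0, h⟩ r
    cases r with
    | zero => exact h0
    | succ r => exact ⟨h0, h.imp id fun h => h r⟩

lemma Cinf_add {p : ℕ} {n : ℕ → ℕ} {y z : ℕ → ℝ} (hy : y ∈ Cinf p n) (hz : z ∈ Cinf p n) :
    y + z ∈ Cinf p n := fun r => CC_add r n y z (hy r) (hz r)

lemma Cinf_smul {p : ℕ} {n : ℕ → ℕ} {y : ℕ → ℝ} {c : ℝ} (hc : 0 ≤ c) (hy : y ∈ Cinf p n) :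
    c • y ∈ Cinf p n := fun r => CC_smul hc r n y (hy r)

lemma Cinf_Orth {p : ℕ} {n : ℕ → ℕ} {y : ℕ → ℝ} (hy : y ∈ Cinf p n) : y ∈ Orth p := hy 0

lemma CC_Am {p r : ℕ} {n : ℕ → ℕ} {y : ℕ → ℝ} (hy : y ∈ CC p r (shift n)) :
    Am p (n 0) y ∈ CC p (r + 1) n :=
  ⟨Am_Orth (CC_Orth hy), Or.inr (by rw [Bm_Am (CC_Orth hy).2]; exact hy)⟩

lemma Cinf_Am {p : ℕ} {n : ℕ → ℕ} {y : ℕ → ℝ} (hy : y ∈ Cinf p (shift n)) :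
    Am p (n 0) y ∈ Cinf p n :=
  mem_Cinf.2 ⟨Am_Orth (Cinf_Orth hy), Or.inr (by rw [Bm_Am (Cinf_Orth hy).2]; exact hy)⟩

lemma DD_Am {p r : ℕ} {n : ℕ → ℕ} {y : ℕ → ℝ} (hy : y ∈ DD p r (shift n)) :
    Am p (n 0) y ∈ DD p (r + 1) n :=
  ⟨Am_Orth (DD_Orth hy), (by rw [Bm_Am (DD_Orth hy).2]; exact hy)⟩

lemma tot_add (p : ℕ) (y z : ℕ → ℝ) : tot p (y + z) = tot p y + tot p z := by
  simp [tot, Finset.sum_add_distrib]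

lemma tot_smul (p : ℕ) (c : ℝ) (y : ℕ → ℝ) : tot p (c • y) = c * tot p y := by
  simp [tot, Finset.mul_sum]

lemma tot_Am (p n : ℕ) (y : ℕ → ℝ) :
    tot p (Am p n y) = (n + 1) * y p + n * y (p + 1) + tot p y := by
  have h1 : tot p (Am p n y) = (∑ i ∈ Finset.range p, y i) + Am p n y 0 + (y p + y (p+1)) := by
    unfold tot
    rw [Finset.sum_range_succ, Finset.sum_range_succ', Am_last]
    congr 2
    apply Finset.sum_congr rfl
    intro i hi
    have h1 : i + 1 ≤ p := Finset.mem_range.1 hi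
    have h2 : i ≠ p := by omega
    simp [Am, h1, h2]
  rw [h1]
  unfold tot
  rw [Finset.sum_range_succ _ (p+1), Finset.sum_range_succ _ p]
  simp [Am]; ring

lemma tot_Bm (p n : ℕ) (y : ℕ → ℝ) (hy : ∀ i, p + 2 ≤ i → y i = 0) :
    tot p (Bm p n y) = tot p y - y 0 := by
  have := tot_Am p n (Bm p n y)
  rw [Am_Bm hy] at this
  rw [this]; simp [Bm]; ring

lemma tot_nonneg {p : ℕ} {y : ℕ → ℝ} (hy : y ∈ Orth p) : 0 ≤ tot p y :=
  Finset.sum_nonneg fun i _ => hy.1 i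

lemma eq_zero_of_tot {p : ℕ} {y : ℕ → ℝ} (hy : y ∈ Orth p) (h : tot p y = 0) : y = 0 := by
  funext i
  by_cases hi : i < p + 2
  · exact (Finset.sum_eq_zero_iff_of_nonneg fun i _ => hy.1 i).1 h i (Finset.mem_range.2 hi)
  · exact hy.2 i (by omega)

lemma le_tot {p : ℕ} {y : ℕ → ℝ} (hy : y ∈ Orth p) (i : ℕ) : y i ≤ tot p y := by
  by_cases hi : i < p + 2
  · exact Finset.single_le_sum (f := y) (fun i _ => hy.1 i) (Finset.mem_range.2 hi)
  · rw [hy.2 i (by omega)]; exact tot_nonneg hy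

lemma eb_Orth {p i : ℕ} (hi : i < p + 2) : eb i ∈ Orth p := by
  refine ⟨fun j => ?_, fun j hj => ?_⟩
  · simp only [eb]; split_ifs <;> norm_num
  · simp only [eb]; rw [if_neg (by omega)]

lemma tot_eb {p i : ℕ} (hi : i < p + 2) : tot p (eb i) = 1 := by
  simp [tot, eb, hi]

lemma Am_eb {p n i : ℕ} (hi : i < p) : Am p n (eb i) = eb (i + 1) := by
  funext j
  by_cases h0 : j = 0
  · subst h0
    have h1 : p ≠ i := by omega
    have h2 : p + 1 ≠ i := by omega
    simp [Am, eb, h1, h2]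
  by_cases h1 : j = p + 1
  · subst h1
    have h1 : p ≠ i := by omega
    have h2 : p + 1 ≠ i := by omega
    simp [Am, eb, h1, h2]
  by_cases h2 : j ≤ p
  · have : j - 1 = i ↔ j = i + 1 := by omega
    simp [Am, eb, h0, h1, h2, this]
  · have : ¬ j = i + 1 := by omega
    simp [Am, eb, h0, h1, h2, this]

lemma Am_eb_p {p n : ℕ} : Am p n (eb p) = ((n : ℝ) + 1) • eb 0 + eb (p + 1) := by
  funext j
  by_cases h0 : j = 0
  · subst h0
    simp [Am, eb]
  by_cases h1 : j = p + 1
  · subst h1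
    simp [Am, eb]
  by_cases h2 : j ≤ p
  · have : ¬ j - 1 = p := by omega
    simp [Am, eb, h0, h1, h2, this]
  · simp [Am, eb, h0, h1, h2]

lemma Am_eb_last {p n : ℕ} : Am p n (eb (p + 1)) = (n : ℝ) • eb 0 + eb (p + 1) := by
  funext j
  by_cases h0 : j = 0
  · subst h0
    simp [Am, eb]
  by_cases h1 : j = p + 1
  · subst h1
    simp [Am, eb]
  by_cases h2 : j ≤ p
  · have : ¬ j - 1 = p + 1 := by omega
    simp [Am, eb, h0, h1, h2, this]
  · simp [Am, eb, h0, h1, h2]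

/-- `A_{n_0} ⋯ A_{n_r}` -/
def UA (p : ℕ) : ℕ → (ℕ → ℕ) → (ℕ → ℝ) → (ℕ → ℝ)
  | 0, n, y => Am p (n 0) y
  | r + 1, n, y => Am p (n 0) (UA p r (shift n) y)

lemma UA_Orth {p : ℕ} : ∀ (r : ℕ) (n : ℕ → ℕ) {y : ℕ → ℝ}, y ∈ Orth p → UA p r n y ∈ Orth p := by
  intro r
  induction r with
  | zero => intro n y hy; exact Am_Orth hy
  | succ r ih => intro n y hy; exact Am_Orth (ih _ hy)

lemma UA_DD {p : ℕ} : ∀ (r : ℕ) (n : ℕ → ℕ) {y : ℕ → ℝ}, y ∈ Orth p → UA p r n y ∈ DD p (r + 1) n := by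
  intro r
  induction r with
  | zero => intro n y hy; exact DD_Am (r := 0) hy
  | succ r ih => intro n y hy; exact DD_Am (ih _ hy)

lemma UA_smul (p : ℕ) (c : ℝ) : ∀ (r : ℕ) (n : ℕ → ℕ) (y : ℕ → ℝ),
    UA p r n (c • y) = c • UA p r n y := by
  intro r
  induction r with
  | zero => intro n y; exact Am_smul _ _ _ _
  | succ r ih => intro n y; simp only [UA, ih, Am_smul]

/-! ### Extreme rays -/

def CExt (p : ℕ) (n : ℕ → ℕ) (y : ℕ → ℝ) : Prop :=
  y ∈ Cinf p n ∧ ∀ a b, a ∈ Cinf p n → b ∈ Cinf p n → a + b = y → ∃ c : ℝ, a = c • y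

lemma CExt_desc {p : ℕ} {n : ℕ → ℕ} {y : ℕ → ℝ} (hy : y ∈ Cinf p (shift n))
    (h : CExt p n (Am p (n 0) y)) : CExt p (shift n) y := by
  refine ⟨hy, fun a b ha hb hab => ?_⟩
  obtain ⟨c, hc⟩ := h.2 (Am p (n 0) a) (Am p (n 0) b) (Cinf_Am ha) (Cinf_Am hb)
    (by rw [← Am_add, hab])
  refine ⟨c, ?_⟩
  have := congrArg (Bm p (n 0)) hc
  rwa [Bm_smul, Bm_Am (Cinf_Orth ha).2, Bm_Am (Cinf_Orth hy).2] at this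

lemma CExt_lift {p : ℕ} {n : ℕ → ℕ} {y : ℕ → ℝ} (hl : 0 < y (p + 1))
    (h : CExt p (shift n) y) : CExt p n (Am p (n 0) y) := by
  refine ⟨Cinf_Am h.1, ?_⟩
  have hyO := Cinf_Orth h.1
  have key : ∀ a, a ∈ Cinf p n → ∃ t0 : ℝ, 0 ≤ t0 ∧ ∀ t ≥ t0,
      Bm p (n 0) a + t • y ∈ Cinf p (shift n) := by
    intro a ha
    refine ⟨(|Bm p (n 0) a (p+1)| + 1) / y (p+1), by positivity, fun t ht => ?_⟩
    have ht0 : 0 ≤ t := le_trans (by positivity) ht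
    have h1 : |Bm p (n 0) a (p+1)| + 1 ≤ t * y (p + 1) := by
      rw [ge_iff_le, div_le_iff₀ hl] at ht; exact ht
    have hs : a + t • Am p (n 0) y ∈ Cinf p n := Cinf_add ha (Cinf_smul ht0 (Cinf_Am h.1))
    have hB : Bm p (n 0) (a + t • Am p (n 0) y) = Bm p (n 0) a + t • y := by
      rw [Bm_add, Bm_smul, Bm_Am hyO.2]
    rcases (mem_Cinf.1 hs).2 with hT | hT
    · exfalso
      have h2 : Bm p (n 0) (a + t • Am p (n 0) y) (p+1) ≤ 0 := by
        rw [Bm_last]; unfold InT at hT; linarith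
      rw [hB] at h2
      simp only [Pi.add_apply, Pi.smul_apply, smul_eq_mul] at h2
      have := neg_abs_le (Bm p (n 0) a (p+1))
      linarith
    · rwa [hB] at hT
  intro a b ha hb hab
  obtain ⟨t1, h10, h1⟩ := key a ha
  obtain ⟨t2, h20, h2⟩ := key b hb
  set t := max t1 t2 with ht
  have e1 := h1 t (le_max_left _ _)
  have e2 := h2 t (le_max_right _ _)
  have ht0 : 0 ≤ t := le_trans h10 (le_max_left _ _)
  have hpos : 0 < 1 + 2 * t := by positivity
  have hsum : (Bm p (n 0) a + t • y) + (Bm p (n 0) b + t • y) = (1 + 2 * t) • y := by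
    have : Bm p (n 0) a + Bm p (n 0) b = y := by rw [← Bm_add, hab, Bm_Am hyO.2]
    calc _ = (Bm p (n 0) a + Bm p (n 0) b) + (2 * t) • y := by
            rw [two_mul, add_smul]; abel
      _ = _ := by rw [this, add_smul, one_smul]
  obtain ⟨c, hc⟩ := h.2 ((1 + 2*t)⁻¹ • (Bm p (n 0) a + t • y)) ((1 + 2*t)⁻¹ • (Bm p (n 0) b + t • y))
    (Cinf_smul (by positivity) e1) (Cinf_smul (by positivity) e2)
    (by rw [← smul_add, hsum, smul_smul, inv_mul_cancel₀ hpos.ne', one_smul])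
  refine ⟨(1 + 2 * t) * c - t, ?_⟩
  have h3 : Bm p (n 0) a = ((1 + 2 * t) * c - t) • y := by
    have : Bm p (n 0) a + t • y = (1 + 2*t) • (c • y) := by
      rw [← hc, smul_smul, mul_inv_cancel₀ hpos.ne', one_smul]
    rw [sub_smul, mul_smul, ← this]; abel
  have := congrArg (Am p (n 0)) h3
  rwa [Am_Bm (Cinf_Orth ha).2, Am_smul] at this

lemma zeros_of_mem {p : ℕ} : ∀ (j : ℕ) (m : ℕ → ℕ) (u v : ℝ), j ≤ p → 0 < v →
    u • eb j + v • eb (p + 1) ∈ Cinf p m → ∀ i < j, m i = 0 := by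
  intro j
  induction j with
  | zero => intro m u v _ _ _ i hi; omega
  | succ j ih =>
    intro m u v hj hv h
    rcases (mem_Cinf.1 h).2 with hT | hT
    · exfalso
      simp [InT, eb] at hT
      have h1 : ¬ p = j := by omega
      rw [if_neg h1] at hT
      have : 0 < ((m 0 : ℝ) + 1) * v := by positivity
      linarith
    · have h0 := (Cinf_Orth hT).1 p
      have hp : ¬ p + 1 = j + 1 := by omega
      have hm : m 0 = 0 := by
        simp [Bm, eb] at h0
        by_contra hne
        have h1 : ¬ p = j := by omega
        rw [if_neg h1] at h0
        have : (0:ℝ) < m 0 := by positivity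
        have := mul_pos this hv
        linarith
      have hB : Bm p (m 0) (u • eb (j+1) + v • eb (p+1)) = u • eb j + v • eb (p + 1) := by
        have e1 : Am p (m 0) (u • eb j + v • eb (p + 1)) = u • eb (j+1) + v • eb (p+1) := by
          rw [Am_add, Am_smul, Am_smul, Am_eb (by omega), Am_eb_last, hm]; simp
        rw [← e1, Bm_Am]
        intro i hi
        simp [eb, show i ≠ j by omega, show i ≠ p + 1 by omega]
      rw [hB] at hT
      have := ih (shift m) u v (by omega) hv hT
      intro i hi
      cases i with
      | zero => exact hm
      | succ i => exact this i (by omega)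

lemma mem_of_zeros {p : ℕ} : ∀ (j : ℕ) (m : ℕ → ℕ), j ≤ p → (∀ i < j, m i = 0) →
    ∃ v : ℝ, 0 < v ∧ eb j + v • eb (p + 1) ∈ Cinf p m := by
  intro j
  induction j with
  | zero =>
    intro m _ _
    refine ⟨1 / (m 0 + 1), by positivity, mem_Cinf.2 ⟨?_, Or.inl ?_⟩⟩
    · exact Orth_add (eb_Orth (by omega)) (Orth_smul (by positivity) (eb_Orth (by omega)))
    · simp [InT, eb]
      rw [mul_inv_cancel₀ (by positivity)]
  | succ j ih =>
    intro m hj h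
    obtain ⟨v, hv, hm⟩ := ih (shift m) (by omega) (fun i hi => h (i+1) (by omega))
    refine ⟨v, hv, ?_⟩
    have := Cinf_Am (n := m) hm
    rw [Am_add, Am_smul, Am_eb (by omega), Am_eb_last, h 0 (by omega)] at this
    simpa using this

lemma UA_last_pos {p : ℕ} : ∀ (s : ℕ) (n : ℕ → ℕ), 0 < UA p s n (eb p) (p + 1) := by
  intro s
  induction s with
  | zero => intro n; simp [UA, Am, eb]
  | succ s ih =>
    intro n
    simp only [UA]
    rw [Am_last]
    have := (UA_Orth (p := p) s (shift n) (eb_Orth (by omega : p < p + 2))).1 p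
    linarith [ih (shift n)]

def FEc (p : ℕ) (n : ℕ → ℕ) (s : ℕ) : Prop := ∃ t, 1 ≤ t ∧ t ≤ p ∧ n (s + t) ≠ 0

lemma eb_Cinf {p : ℕ} (n : ℕ → ℕ) {i : ℕ} (hi : i ≤ p) : eb i ∈ Cinf p n := by
  refine mem_Cinf.2 ⟨eb_Orth (by omega), Or.inl ?_⟩
  simp only [InT, eb]
  rw [if_neg (by omega)]
  split_ifs <;> norm_num

lemma shift_apply (n : ℕ → ℕ) (r : ℕ) : shift n r = n (r + 1) := rfl

/-- The points of `FE` are extreme. -/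
lemma CExt_UA {p : ℕ} : ∀ (s : ℕ) (n : ℕ → ℕ), FEc p n s → CExt p n (UA p s n (eb p)) := by
  intro s
  induction s with
  | zero =>
    rintro n ⟨t, ht1, ht2, hn⟩
    refine ⟨Cinf_Am (eb_Cinf _ le_rfl), ?_⟩
    have key : ∀ a b, a ∈ Cinf p n → b ∈ Cinf p n → a + b = Am p (n 0) (eb p) →
        ∃ u v : ℝ, Bm p (n 0) a = u • eb p + v • eb (p + 1) ∧ v ≤ 0 := by
      intro a b ha hb hab
      have haO := Cinf_Orth ha
      have hbO := Cinf_Orth hb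
      have hz : ∀ i, 1 ≤ i → i ≤ p → a i = 0 := by
        intro i h1 h2
        have := congrFun hab i
        rw [Am_eb_p] at this
        simp [eb, show i ≠ 0 by omega, show i ≠ p + 1 by omega] at this
        linarith [haO.1 i, hbO.1 i]
      have hform : Bm p (n 0) a = (a 0 - n 0 * a (p+1)) • eb p +
          ((n 0 + 1) * a (p+1) - a 0) • eb (p + 1) := by
        funext i
        rcases lt_trichotomy i p with h | h | h
        · simp [Bm, eb, h, show i ≠ p by omega, show i ≠ p + 1 by omega]
          exact hz _ (by omega) (by omega)
        · subst h; simp [Bm, eb]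
        · by_cases h1 : i = p + 1
          · subst h1; simp [Bm, eb]
          · simp [Bm, eb, h1, show ¬ i < p by omega, show i ≠ p by omega]
      refine ⟨_, _, hform, ?_⟩
      by_contra hv
      push Not at hv
      have hC : Bm p (n 0) a ∈ Cinf p (shift n) := by
        refine ((mem_Cinf.1 ha).2).resolve_left ?_
        unfold InT; linarith
      rw [hform] at hC
      have := zeros_of_mem p (shift n) _ _ le_rfl hv hC (t - 1) (by omega)
      apply hn
      rw [shift_apply] at this
      rwa [show t - 1 + 1 = 0 + t by omega] at this
    intro a b ha hb hab
    obtain ⟨u, v, h1, hv⟩ := key a b ha hb hab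
    obtain ⟨u', v', h1', hv'⟩ := key b a hb ha (by rw [add_comm]; exact hab)
    have hsum : Bm p (n 0) a + Bm p (n 0) b = eb p := by
      rw [← Bm_add, hab]; exact Bm_Am (eb_Orth (by omega)).2
    have h2 := congrFun hsum (p + 1)
    rw [h1, h1'] at h2
    simp [eb] at h2
    have hv0 : v = 0 := by linarith
    refine ⟨u, ?_⟩
    rw [hv0, zero_smul, add_zero] at h1
    have := congrArg (Am p (n 0)) h1
    rwa [Am_Bm (Cinf_Orth ha).2, Am_smul] at this
  | succ s ih =>
    rintro n ⟨t, ht1, ht2, hn⟩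
    apply CExt_lift (UA_last_pos s _)
    apply ih
    exact ⟨t, ht1, ht2, by rw [shift_apply]; convert hn using 2; omega⟩

lemma UA_Cinf {p : ℕ} : ∀ (s : ℕ) (n : ℕ → ℕ), UA p s n (eb p) ∈ Cinf p n := by
  intro s
  induction s with
  | zero => intro n; exact Cinf_Am (eb_Cinf _ le_rfl)
  | succ s ih => intro n; exact Cinf_Am (ih _)

lemma CExt_smul {p : ℕ} {n : ℕ → ℕ} {y : ℕ → ℝ} {c : ℝ} (hc : 0 < c) (h : CExt p n (c • y)) :
    CExt p n y := by
  refine ⟨?_, fun a b ha hb hab => ?_⟩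
  · have := Cinf_smul (inv_nonneg.2 hc.le) h.1
    rwa [smul_smul, inv_mul_cancel₀ hc.ne', one_smul] at this
  · obtain ⟨d, hd⟩ := h.2 (c • a) (c • b) (Cinf_smul hc.le ha) (Cinf_smul hc.le hb)
      (by rw [← smul_add, hab])
    refine ⟨d, ?_⟩
    have := congrArg (fun z => c⁻¹ • z) hd
    simpa [smul_smul, inv_mul_cancel₀ hc.ne', mul_comm d c, ← mul_assoc] using this

/-- Necessity of the `FE` condition. -/
lemma FEc_of_CExt {p : ℕ} : ∀ (s : ℕ) (n : ℕ → ℕ), CExt p n (UA p s n (eb p)) → FEc p n s := by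
  intro s
  induction s with
  | zero =>
    intro n h
    by_contra hF
    unfold FEc at hF
    push Not at hF
    obtain ⟨v, hv, hm⟩ := mem_of_zeros p (shift n) le_rfl (fun i hi => by
      have := hF (i + 1) (by omega) (by omega)
      rw [shift_apply]; rwa [zero_add] at this)
    simp only [UA] at h
    -- choose ε = min v 1
    set ε := min v 1 with hε
    have hε0 : 0 < ε := lt_min hv one_pos
    have hm' : eb p + ε • eb (p + 1) ∈ Cinf p (shift n) := by
      have h1 := Cinf_add (Cinf_smul (c := ε / v) (by positivity) hm)
        (Cinf_smul (c := 1 - ε / v) (by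
          have : ε / v ≤ 1 := by rw [div_le_one hv]; exact min_le_left _ _
          linarith) (eb_Cinf (shift n) (le_refl p)))
      have : (ε / v) • (eb p + v • eb (p+1)) + (1 - ε / v) • eb p = eb p + ε • eb (p + 1) := by
        rw [smul_add, smul_smul, div_mul_cancel₀ _ hv.ne', sub_smul, one_smul]; abel
      rwa [this] at h1
    have hb : Am p (n 0) (eb p) - ε • Am p (n 0) (eb (p+1)) ∈ Cinf p n := by
      have hε1 : ε ≤ 1 := min_le_right _ _
      have hform : Am p (n 0) (eb p) - ε • Am p (n 0) (eb (p+1)) =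
          ((n 0 : ℝ) + 1 - ε * n 0) • eb 0 + (1 - ε) • eb (p + 1) := by
        rw [Am_eb_p, Am_eb_last, smul_add, smul_smul, sub_smul, sub_smul, one_smul]; abel
      rw [hform]
      have hn : (0:ℝ) ≤ n 0 := by positivity
      refine mem_Cinf.2 ⟨Orth_add (Orth_smul (by nlinarith) (eb_Orth (by omega)))
        (Orth_smul (by linarith) (eb_Orth (by omega))), Or.inl ?_⟩
      simp [InT, eb]
      nlinarith
    obtain ⟨c, hc⟩ := h.2 ((1/2 : ℝ) • Am p (n 0) (eb p + ε • eb (p + 1)))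
      ((1/2 : ℝ) • (Am p (n 0) (eb p) - ε • Am p (n 0) (eb (p+1))))
      (Cinf_smul (by norm_num) (Cinf_Am hm')) (Cinf_smul (by norm_num) hb)
      (by
        rw [← smul_add, Am_add, Am_smul]
        have : Am p (n 0) (eb p) + ε • Am p (n 0) (eb (p + 1)) +
          (Am p (n 0) (eb p) - ε • Am p (n 0) (eb (p + 1))) = (2:ℝ) • Am p (n 0) (eb p) := by
          rw [two_smul]; abel
        rw [this, smul_smul]; norm_num)
    rw [← Am_smul, ← Am_smul] at hc
    have := congrArg (Bm p (n 0)) hc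
    rw [Bm_Am (Orth_smul (by norm_num) (Cinf_Orth hm')).2, Bm_Am] at this
    · have := congrFun this (p + 1)
      simp [eb] at this
      linarith
    · intro i hi
      simp [eb, show i ≠ p by omega]
  | succ s ih =>
    intro n h
    obtain ⟨t, h1, h2, h3⟩ := ih (shift n) (CExt_desc (UA_Cinf s _) h)
    exact ⟨t, h1, h2, by rw [shift_apply] at h3; convert h3 using 2; omega⟩

lemma CExt_T {p : ℕ} {n : ℕ → ℕ} {y : ℕ → ℝ} (hy0 : y ≠ 0) (hT : InT p (n 0) y) (h : CExt p n y) :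
    ∃ c : ℝ, 0 < c ∧ ((∃ i ≤ p, y = c • eb i) ∨ y = c • UA p 0 n (eb p)) := by
  have hO := Cinf_Orth h.1
  have hTT : ((n 0 : ℝ) + 1) * y (p + 1) ≤ y 0 := hT
  -- general extraction
  have ext : ∀ (z : ℕ → ℝ) (d : ℝ), 0 < d → z ∈ Cinf p n → y - d • z ∈ Cinf p n → z ≠ 0 →
      ∃ c : ℝ, 0 < c ∧ y = c • z := by
    intro z d hd hz hr hz0
    obtain ⟨c, hc⟩ := h.2 (d • z) (y - d • z) (Cinf_smul hd.le hz) hr (by abel)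
    have hc0 : c ≠ 0 := by
      rintro rfl
      rw [zero_smul] at hc
      exact hz0 ((smul_eq_zero.1 hc).resolve_left hd.ne')
    have hy : y = (d / c) • z := by
      rw [div_eq_inv_mul, mul_smul, hc, smul_smul, inv_mul_cancel₀ hc0, one_smul]
    have htot := tot_nonneg hO
    have htz : 0 < tot p z := lt_of_le_of_ne (tot_nonneg (Cinf_Orth hz))
      fun h => hz0 (eq_zero_of_tot (Cinf_Orth hz) h.symm)
    have hne : d / c ≠ 0 := div_ne_zero hd.ne' hc0
    refine ⟨d / c, lt_of_le_of_ne ?_ hne.symm, hy⟩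
    by_contra hneg
    push Not at hneg
    rw [hy, tot_smul] at htot
    nlinarith
  by_cases h1 : ∃ i, 1 ≤ i ∧ i ≤ p ∧ 0 < y i
  · obtain ⟨i, hi1, hi2, hi⟩ := h1
    obtain ⟨c, hc, hyc⟩ := ext (eb i) (y i) hi (eb_Cinf n hi2) (by
      refine mem_Cinf.2 ⟨⟨fun j => ?_, fun j hj => ?_⟩, Or.inl ?_⟩
      · by_cases hji : j = i
        · subst hji; simp [eb]
        · simp [eb, hji, hO.1 j]
      · simp [eb, show j ≠ i by omega, hO.2 j hj]
      · simp [InT, eb, show p + 1 ≠ i by omega, show 0 ≠ i by omega]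
        exact hTT) (by
      intro h; have := congrFun h i; simp [eb] at this)
    exact ⟨c, hc, Or.inl ⟨i, hi2, hyc⟩⟩
  push Not at h1
  by_cases h2 : y (p + 1) = 0
  · have hy : y = y 0 • eb 0 := by
      funext j
      by_cases hj : j = 0
      · subst hj; simp [eb]
      · simp [eb, hj]
        by_cases hj1 : j = p + 1
        · rw [hj1, h2]
        by_cases hj2 : j ≤ p
        · exact le_antisymm (h1 j (by omega) hj2) (hO.1 j)
        · exact hO.2 j (by omega)
    refine ⟨y 0, lt_of_le_of_ne (hO.1 0) ?_, Or.inl ⟨0, by omega, hy⟩⟩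
    intro h0
    rw [← h0, zero_smul] at hy
    exact hy0 hy
  · have h3 : 0 < y (p + 1) := lt_of_le_of_ne (hO.1 _) (Ne.symm h2)
    obtain ⟨c, hc, hyc⟩ := ext (Am p (n 0) (eb p)) (y (p+1)) h3 (Cinf_Am (eb_Cinf _ le_rfl)) (by
      rw [Am_eb_p]
      refine mem_Cinf.2 ⟨⟨fun j => ?_, fun j hj => ?_⟩, Or.inl ?_⟩
      · by_cases hj : j = 0
        · subst hj; simp [eb]; linarith
        by_cases hj1 : j = p + 1
        · subst hj1; simp [eb]
        · simp [eb, hj, hj1, hO.1 j]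
      · simp [eb, show j ≠ 0 by omega, show j ≠ p + 1 by omega, hO.2 j hj]
      · simp [InT, eb]; linarith) (by
      intro h; have := congrFun h (p+1); simp [Am, eb] at this)
    exact ⟨c, hc, Or.inr hyc⟩

lemma CExt_class {p : ℕ} : ∀ (r : ℕ) (n : ℕ → ℕ) (y : ℕ → ℝ), y ≠ 0 → CExt p n y → y ∉ DD p r n →
    ∃ c : ℝ, 0 < c ∧ ((∃ i ≤ p, y = c • eb i) ∨ ∃ s, y = c • UA p s n (eb p)) := by
  intro r
  induction r with
  | zero => intro n y _ h hn; exact absurd (Cinf_Orth h.1) hn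
  | succ r ih =>
    intro n y hy0 h hn
    have hO := Cinf_Orth h.1
    rcases (mem_Cinf.1 h.1).2 with hT | hT
    · obtain ⟨c, hc, h1 | h1⟩ := CExt_T hy0 hT h
      · exact ⟨c, hc, Or.inl h1⟩
      · exact ⟨c, hc, Or.inr ⟨0, h1⟩⟩
    · have hAB := Am_Bm (n := n 0) hO.2
      have h' : CExt p (shift n) (Bm p (n 0) y) := CExt_desc hT (by rw [hAB]; exact h)
      have hne : Bm p (n 0) y ≠ 0 := by
        intro h0
        rw [h0] at hAB
        apply hy0; rw [← hAB]
        funext i; simp [Am]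
      obtain ⟨c, hc, ⟨i, hi, h1⟩ | ⟨s, h1⟩⟩ := ih (shift n) _ hne h' (fun h => hn ⟨hO, h⟩)
      · refine ⟨c, hc, ?_⟩
        rw [h1, Am_smul] at hAB
        rcases Nat.lt_or_ge i p with hip | hip
        · left; exact ⟨i + 1, hip, by rw [← hAB, Am_eb hip]⟩
        · right; refine ⟨0, ?_⟩
          rw [← hAB, show i = p by omega]; rfl
      · refine ⟨c, hc, Or.inr ⟨s + 1, ?_⟩⟩
        rw [← hAB, h1, Am_smul]; rfl

/-! ### Passing between `E k` and coordinates -/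

lemma proj_supp {p : ℕ} (x : E (p + 2)) : ∀ i, p + 2 ≤ i → proj x i = 0 := by
  intro i hi
  unfold proj
  rw [dif_neg (by omega)]

lemma proj_fin {k : ℕ} (x : E k) (i : Fin k) : proj x i = x i := by
  unfold proj
  rw [dif_pos i.2]

lemma proj_inj {k : ℕ} {x y : E k} (h : proj x = proj y) : x = y := by
  ext i
  rw [← proj_fin, ← proj_fin, h]

lemma mem_simplex {p : ℕ} {x : E (p + 2)} :
    x ∈ simplex (p + 2) ↔ proj x ∈ Orth p ∧ tot p (proj x) = 1 := by
  have hs : tot p (proj x) = ∑ i, x i := by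
    unfold tot
    rw [← Fin.sum_univ_eq_sum_range]
    exact Finset.sum_congr rfl fun i _ => proj_fin x i
  rw [hs]
  constructor
  · rintro ⟨h1, h2⟩
    refine ⟨⟨fun i => ?_, proj_supp x⟩, h2⟩
    unfold proj
    split_ifs with h
    · exact h1 _
    · exact le_rfl
  · rintro ⟨h1, h2⟩
    exact ⟨fun i => by rw [← proj_fin]; exact h1.1 _, h2⟩

lemma proj_add {k : ℕ} (x y : E k) : proj (x + y) = proj x + proj y := by
  funext i; unfold proj; simp only [Pi.add_apply]; split_ifs <;> simp

lemma proj_smul {k : ℕ} (c : ℝ) (x : E k) : proj (c • x) = c • proj x := by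
  funext i; unfold proj; simp only [Pi.smul_apply]; split_ifs <;> simp

noncomputable def ofv (k : ℕ) (y : ℕ → ℝ) : E k := (WithLp.equiv 2 (Fin k → ℝ)).symm fun i => y i

lemma proj_ofv {p : ℕ} {y : ℕ → ℝ} (hy : ∀ i, p + 2 ≤ i → y i = 0) : proj (ofv (p + 2) y) = y := by
  funext i
  unfold proj
  split_ifs with h
  · simp [ofv]
  · exact (hy i (by omega)).symm

lemma eq_of_prop {p : ℕ} {x y : E (p + 2)} (hx : x ∈ simplex (p + 2)) (hy : y ∈ simplex (p + 2))
    {c : ℝ} (h : proj x = c • proj y) : x = y := by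
  rw [mem_simplex] at hx hy
  have : tot p (proj x) = c * tot p (proj y) := by rw [h, tot_smul]
  rw [hx.2, hy.2, mul_one] at this
  apply proj_inj
  rw [h, ← this, one_smul]

lemma proj_evec {p i : ℕ} (hi : i < p + 2) : proj (evec (p + 2) i) = eb i := by
  funext j
  unfold proj
  split_ifs with h
  · simp [evec, eb]
  · simp [eb, show j ≠ i by omega]

lemma evec_simplex {p i : ℕ} (hi : i < p + 2) : evec (p + 2) i ∈ simplex (p + 2) := by
  rw [mem_simplex, proj_evec hi]
  exact ⟨eb_Orth hi, tot_eb hi⟩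

lemma proj_Kinv {p n : ℕ} (x : E (p + 2)) :
    proj (Kinv n x) = ((n + 1) * proj x p + n * proj x (p + 1) + 1)⁻¹ • Am p n (proj x) := by
  funext i
  conv_lhs => unfold proj
  simp only [Pi.smul_apply, smul_eq_mul]
  split_ifs with h
  · simp only [Kinv, WithLp.equiv_symm_apply, Am]
    rw [div_eq_inv_mul]
    have e1 : p + 2 - 2 = p := rfl
    have e2 : p + 2 - 1 = p + 1 := rfl
    rw [e1, e2]
    congr 1
    by_cases h0 : i = 0
    · simp [h0]
    by_cases h1 : i = p + 1
    · simp [h1]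
    have h2 : i ≤ p := by omega
    simp [h0, h1, h2]
  · have h0 : ¬ i = 0 := by omega
    have h1 : ¬ i = p + 1 := by omega
    have h2 : ¬ i ≤ p := by omega
    simp [Am, h0, h1, h2]

lemma Kinv_simplex {p n : ℕ} {x : E (p + 2)} (hx : x ∈ simplex (p + 2)) :
    Kinv n x ∈ simplex (p + 2) := by
  rw [mem_simplex] at *
  have h1 := hx.1.1 p
  have h2 := hx.1.1 (p + 1)
  have hD : 0 < (n + 1) * proj x p + n * proj x (p + 1) + 1 := by positivity
  rw [proj_Kinv]
  refine ⟨Orth_smul (by positivity) (Am_Orth hx.1), ?_⟩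
  rw [tot_smul, tot_Am, hx.2, inv_mul_cancel₀ hD.ne']

lemma Kinv_prop {p n : ℕ} {x : E (p + 2)} (hx : x ∈ simplex (p + 2)) :
    ∃ c : ℝ, 0 < c ∧ proj (Kinv n x) = c • Am p n (proj x) := by
  rw [mem_simplex] at hx
  have h1 := hx.1.1 p
  have h2 := hx.1.1 (p + 1)
  exact ⟨_, by positivity, proj_Kinv x⟩

lemma Ups_succ {k : ℕ} (r : ℕ) : ∀ (n : ℕ → ℕ) (x : E k),
    Ups n (r + 1) x = Kinv (n 0) (Ups (shift n) r x) := by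
  induction r with
  | zero => intro n x; rfl
  | succ r ih =>
    intro n x
    change Ups n (r + 1) (Kinv (n (r + 2)) x) = _
    rw [ih]; rfl

lemma Ups_prop {p : ℕ} : ∀ (s : ℕ) (n : ℕ → ℕ) (x : E (p + 2)), x ∈ simplex (p + 2) →
    Ups n s x ∈ simplex (p + 2) ∧ ∃ c : ℝ, 0 < c ∧ proj (Ups n s x) = c • UA p s n (proj x) := by
  intro s
  induction s with
  | zero => intro n x hx; exact ⟨Kinv_simplex hx, Kinv_prop hx⟩
  | succ s ih =>
    intro n x hx
    obtain ⟨h1, c, hc, h2⟩ := ih (shift n) x hx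
    rw [Ups_succ]
    refine ⟨Kinv_simplex h1, ?_⟩
    obtain ⟨d, hd, h3⟩ := Kinv_prop (n := n 0) h1
    refine ⟨d * c, by positivity, ?_⟩
    rw [h3, h2, Am_smul, smul_smul]; rfl

/-! ### The fibre -/

def Dinf (p : ℕ) (n : ℕ → ℕ) : Set (ℕ → ℝ) := {y | ∀ r, y ∈ DD p r n}

lemma mem_Dinf {p : ℕ} {n : ℕ → ℕ} {y : ℕ → ℝ} :
    y ∈ Dinf p n ↔ y ∈ Orth p ∧ Bm p (n 0) y ∈ Dinf p (shift n) := by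
  constructor
  · intro h
    exact ⟨h 0, fun r => (h (r + 1)).2⟩
  · rintro ⟨h0, h⟩ r
    cases r with
    | zero => exact h0
    | succ r => exact ⟨h0, h r⟩

lemma Dinf_zero {p : ℕ} : ∀ (j : ℕ) (n : ℕ → ℕ) (y : ℕ → ℝ), y ∈ Dinf p n → y (p + 1) = 0 →
    y j = 0 := by
  intro j
  induction j with
  | zero =>
    intro n y hy h
    have h1 := (mem_Dinf.1 hy)
    have h2 := (h1.2 0).1 (p + 1)
    rw [Bm_last, h] at h2
    have := h1.1.1 0
    linarith
  | succ j ih =>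
    intro n y hy h
    have h1 := (mem_Dinf.1 hy)
    have h2 := (h1.2 0).1 (p + 1)
    have h00 := h1.1.1 0
    have h3 : Bm p (n 0) y (p + 1) = 0 := by
      rw [Bm_last, h] at *; linarith
    rcases lt_trichotomy j p with hj | hj | hj
    · have := ih _ _ h1.2 h3
      simpa [Bm, hj] using this
    · rw [hj, h]
    · exact h1.1.2 _ (by omega)

lemma Dinf_pos {p : ℕ} {n : ℕ → ℕ} {y : ℕ → ℝ} (hy : y ∈ Dinf p n) (h0 : y ≠ 0) :
    0 < y (p + 1) := by
  refine lt_of_le_of_ne ((hy 0).1 _) fun h => h0 ?_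
  funext j
  exact Dinf_zero j n y hy h.symm

lemma Am_zero (p n : ℕ) : Am p n 0 = 0 := by
  funext i; simp [Am]

lemma Bm_ne_zero {p m : ℕ} {y : ℕ → ℝ} (hy : y ∈ Orth p) (h0 : y ≠ 0) : Bm p m y ≠ 0 := by
  intro h
  have := Am_Bm (n := m) hy.2
  rw [h, Am_zero] at this
  exact h0 this.symm

lemma Dinf_not_T {p : ℕ} {n : ℕ → ℕ} {y : ℕ → ℝ} (hy : y ∈ Dinf p n) (h0 : y ≠ 0) :
    ¬ InT p (n 0) y := by
  have h1 := mem_Dinf.1 hy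
  have h2 := Dinf_pos h1.2 (Bm_ne_zero h1.1 h0)
  rw [Bm_last] at h2
  unfold InT; linarith

lemma proj_Kmap {p n : ℕ} (x : E (p + 2)) :
    proj (Kmap n x) = (1 - proj x 0)⁻¹ • Bm p n (proj x) := by
  funext i
  conv_lhs => unfold proj
  simp only [Pi.smul_apply, smul_eq_mul]
  have e2 : p + 2 - 1 = p + 1 := rfl
  split_ifs with h
  · simp only [Kmap, WithLp.equiv_symm_apply, Bm]
    rw [e2]
    rcases lt_trichotomy i p with h1 | h1 | h1
    · simp [h1, div_eq_inv_mul]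
    · simp [h1, div_eq_inv_mul]
    · have h2 : i = p + 1 := by omega
      simp [h2, div_eq_inv_mul]
  · have h0 : ¬ i < p := by omega
    have h1 : ¬ i = p + 1 := by omega
    have h2 : ¬ i = p := by omega
    simp [Bm, h0, h1, h2]

lemma mem_simplex' {p : ℕ} {x : E (p + 2)} :
    x ∈ simplex' (p + 2) ↔ x ∈ simplex (p + 2) ∧ 0 < proj x (p + 1) := by
  constructor
  · rintro ⟨h1, h2⟩
    refine ⟨h1, lt_of_le_of_ne ((mem_simplex.1 h1).1.1 _) fun h => h2 ⟨h1, h.symm⟩⟩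
  · rintro ⟨h1, h2⟩
    exact ⟨h1, fun h => h2.ne' h.2⟩

lemma one_sub_pos {p : ℕ} {x : E (p + 2)} (hx : x ∈ simplex' (p + 2)) : 0 < 1 - proj x 0 := by
  rw [mem_simplex', mem_simplex] at hx
  obtain ⟨⟨h1, h2⟩, h3⟩ := hx
  have : tot p (proj x) = (∑ i ∈ Finset.range p, proj x (i + 1)) + proj x 0 + proj x (p + 1) := by
    unfold tot
    rw [Finset.sum_range_succ, Finset.sum_range_succ']
  have h4 : 0 ≤ ∑ i ∈ Finset.range p, proj x (i + 1) := Finset.sum_nonneg fun i _ => h1.1 _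
  linarith

lemma Jfun_spec {p : ℕ} {x : E (p + 2)} (hx : x ∈ simplex' (p + 2)) (m : ℕ) :
    Jfun x = m ↔ (m : ℝ) * proj x (p + 1) ≤ proj x 0 ∧ proj x 0 < (m + 1) * proj x (p + 1) := by
  rw [mem_simplex', mem_simplex] at hx
  obtain ⟨⟨h1, h2⟩, h3⟩ := hx
  have h4 : 0 ≤ proj x 0 / proj x (p + 1) := div_nonneg (h1.1 _) h3.le
  unfold Jfun
  rw [show p + 2 - 1 = p + 1 from rfl, Nat.floor_eq_iff h4, le_div_iff₀ h3, div_lt_iff₀ h3]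

lemma Kmap_simplex' {p m : ℕ} {x : E (p + 2)} (hx : x ∈ simplex' (p + 2))
    (hB : Bm p m (proj x) ∈ Orth p) (hl : 0 < Bm p m (proj x) (p + 1)) :
    Kmap m x ∈ simplex' (p + 2) := by
  have h0 := one_sub_pos hx
  rw [mem_simplex', mem_simplex] at *
  rw [proj_Kmap]
  refine ⟨⟨Orth_smul (by positivity) hB, ?_⟩, by simp only [Pi.smul_apply, smul_eq_mul]; positivity⟩
  rw [tot_smul, tot_Bm _ _ _ (proj_supp x), hx.1.2, inv_mul_cancel₀ h0.ne']

lemma Bm_Orth_of {p m : ℕ} {y : ℕ → ℝ} (hy : y ∈ Orth p) (h1 : (m : ℝ) * y (p + 1) ≤ y 0)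
    (h2 : y 0 ≤ (m + 1) * y (p + 1)) : Bm p m y ∈ Orth p := by
  refine ⟨fun i => ?_, fun i hi => ?_⟩
  · simp only [Bm]
    split_ifs
    · exact hy.1 _
    · linarith
    · linarith
    · exact le_rfl
  · simp only [Bm]
    rw [if_neg (by omega), if_neg (by omega), if_neg (by omega)]

lemma Dinf_smul {p : ℕ} {n : ℕ → ℕ} {y : ℕ → ℝ} {c : ℝ} (hc : 0 ≤ c) (hy : y ∈ Dinf p n) :
    c • y ∈ Dinf p n := fun r => DD_smul hc r n y (hy r)

lemma Jfun_of_Dinf {p : ℕ} {n : ℕ → ℕ} {x : E (p + 2)} (hx : x ∈ simplex' (p + 2))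
    (h : proj x ∈ Dinf p n) : Jfun x = n 0 := by
  have h0 : proj x ≠ 0 := by
    intro h0
    have := (mem_simplex'.1 hx).2
    rw [h0] at this; simp at this
  have h1 := mem_Dinf.1 h
  rw [Jfun_spec hx]
  have h2 := Dinf_not_T h h0
  unfold InT at h2
  have h3 := (h1.2 0).1 p
  simp [Bm] at h3
  constructor <;> linarith

lemma Phi_of_Dinf {p : ℕ} : ∀ (r : ℕ) (n : ℕ → ℕ) (x : E (p + 2)), x ∈ simplex' (p + 2) →
    proj x ∈ Dinf p n → Phi x r = n r := by
  intro r
  induction r with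
  | zero => intro n x hx h; exact Jfun_of_Dinf hx h
  | succ r ih =>
    intro n x hx h
    have h1 := mem_Dinf.1 h
    have h0 : proj x ≠ 0 := by
      intro h0
      have := (mem_simplex'.1 hx).2
      rw [h0] at this; simp at this
    have hK : Kstep x = Kmap (n 0) x := by unfold Kstep; rw [Jfun_of_Dinf hx h]
    have : Phi x (r + 1) = Phi (Kstep x) r := rfl
    rw [this, hK]
    apply ih (shift n)
    · exact Kmap_simplex' hx (h1.2 0) (Dinf_pos h1.2 (Bm_ne_zero h1.1 h0))
    · rw [proj_Kmap]
      exact Dinf_smul (inv_nonneg.2 (one_sub_pos hx).le) h1.2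

lemma fiber_of_Dinf {p : ℕ} {n : ℕ → ℕ} {x : E (p + 2)} (hx : x ∈ simplex (p + 2))
    (h : proj x ∈ Dinf p n) : x ∈ PhiFiber (p + 2) n := by
  have h0 : proj x ≠ 0 := by
    intro h0
    have := (mem_simplex.1 hx).2
    rw [h0] at this; simp [tot] at this
  have hx' : x ∈ simplex' (p + 2) := mem_simplex'.2 ⟨hx, Dinf_pos h h0⟩
  exact ⟨hx', funext fun r => Phi_of_Dinf r n x hx' h⟩

lemma DD_of_fiber {p : ℕ} : ∀ (r : ℕ) (n : ℕ → ℕ) (x : E (p + 2)), x ∈ PhiFiber (p + 2) n →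
    proj x ∈ DD p r n := by
  intro r
  induction r with
  | zero => intro n x hx; exact (mem_simplex.1 (mem_simplex'.1 hx.1).1).1
  | succ r ih =>
    rintro n x ⟨hx, hP⟩
    have hO := (mem_simplex.1 (mem_simplex'.1 hx).1).1
    have hJ : Jfun x = n 0 := congrFun hP 0
    have hJ' := (Jfun_spec hx _).1 hJ
    have hB := Bm_Orth_of hO hJ'.1 hJ'.2.le
    have hK : Kstep x = Kmap (n 0) x := by unfold Kstep; rw [hJ]
    have h1 : Kmap (n 0) x ∈ PhiFiber (p + 2) (shift n) := by
      refine ⟨Kmap_simplex' hx hB (by rw [Bm_last]; linarith), ?_⟩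
      funext s
      have := congrFun hP (s + 1)
      rw [← hK]; exact this
    have h2 := ih _ _ h1
    rw [proj_Kmap] at h2
    have h3 := DD_smul (one_sub_pos hx).le _ _ _ h2
    rw [smul_smul, mul_inv_cancel₀ (one_sub_pos hx).ne', one_smul] at h3
    exact ⟨hO, h3⟩

/-! ### `α` is extreme -/

lemma Dinf_aux {p : ℕ} : ∀ (r : ℕ) (n : ℕ → ℕ) (y x z : ℕ → ℝ), y ∈ Dinf p n → y ≠ 0 → x + z = y →
    x ∈ VV p → z ∈ Cinf p n → z ∈ DD p r n := by
  intro r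
  induction r with
  | zero => intro n y x z _ _ _ _ hz; exact Cinf_Orth hz
  | succ r ih =>
    intro n y x z hy h0 hxz hx hz
    refine ⟨Cinf_Orth hz, ?_⟩
    have h1 := mem_Dinf.1 hy
    have hnT := Dinf_not_T hy h0
    have hzB : Bm p (n 0) z ∈ Cinf p (shift n) := by
      refine ((mem_Cinf.1 hz).2).resolve_left fun hT => hnT ?_
      have h2 : InT p (n 0) x := VV_InT hx
      rw [← hxz]
      simp only [InT, Pi.add_apply] at *
      linarith
    exact ih (shift n) (Bm p (n 0) y) (Bm p (n 0) x) _ h1.2 (Bm_ne_zero h1.1 h0)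
      (by rw [← Bm_add, hxz]) (Bm_VV hx) hzB

lemma Dinf_split {p : ℕ} : ∀ (r : ℕ) (n : ℕ → ℕ) (y a b : ℕ → ℝ), y ∈ Dinf p n → y ≠ 0 → a + b = y →
    a ∈ Cinf p n → b ∈ Cinf p n →
    (a ∈ DD p r n ∧ b ∈ DD p r n) ∨ a ∈ Dinf p n ∨ b ∈ Dinf p n := by
  intro r
  induction r with
  | zero => intro n y a b _ _ _ ha hb; exact Or.inl ⟨Cinf_Orth ha, Cinf_Orth hb⟩
  | succ r ih =>
    have key : ∀ (n : ℕ → ℕ) (y a b : ℕ → ℝ), y ∈ Dinf p n → y ≠ 0 → a + b = y →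
      a ∈ Cinf p n → b ∈ Cinf p n → InT p (n 0) a → b ∈ Dinf p n := by
      intro n y a b hy h0 hab ha hb hT
      have h1 := mem_Dinf.1 hy
      have hnT := Dinf_not_T hy h0
      have hbB : Bm p (n 0) b ∈ Cinf p (shift n) := by
        refine ((mem_Cinf.1 hb).2).resolve_left fun hT' => hnT ?_
        rw [← hab]
        simp only [InT, Pi.add_apply] at *
        linarith
      exact mem_Dinf.2 ⟨Cinf_Orth hb, fun r => Dinf_aux r _ _ _ _ h1.2 (Bm_ne_zero h1.1 h0)
        (by rw [← Bm_add, hab]) (Bm_VV_of_T (Cinf_Orth ha) hT) hbB⟩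
    intro n y a b hy h0 hab ha hb
    rcases (mem_Cinf.1 ha).2 with hT | hT
    · exact Or.inr (Or.inr (key n y a b hy h0 hab ha hb hT))
    rcases (mem_Cinf.1 hb).2 with hT' | hT'
    · exact Or.inr (Or.inl (key n y b a hy h0 (by rw [add_comm]; exact hab) hb ha hT'))
    have h1 := mem_Dinf.1 hy
    rcases ih (shift n) (Bm p (n 0) y) _ _ h1.2 (Bm_ne_zero h1.1 h0) (by rw [← Bm_add, hab]) hT hT'
      with h | h | h
    · exact Or.inl ⟨⟨Cinf_Orth ha, h.1⟩, ⟨Cinf_Orth hb, h.2⟩⟩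
    · exact Or.inr (Or.inl (mem_Dinf.2 ⟨Cinf_Orth ha, h⟩))
    · exact Or.inr (Or.inr (mem_Dinf.2 ⟨Cinf_Orth hb, h⟩))

lemma Dinf_Cinf {p : ℕ} {n : ℕ → ℕ} {y : ℕ → ℝ} (hy : y ∈ Dinf p n) : y ∈ Cinf p n := by
  intro r
  have : ∀ (r : ℕ) (n : ℕ → ℕ), DD p r n ⊆ CC p r n := by
    intro r
    induction r with
    | zero => intro n y hy; exact hy
    | succ r ih => intro n y hy; exact ⟨hy.1, Or.inr (ih _ hy.2)⟩
  exact this r n (hy r)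

/-- Elements of the intersection are multiples of `α`. -/
lemma Dinf_unique {p : ℕ} {n : ℕ → ℕ} {α : E (p + 2)} (hreg : PhiFiber (p + 2) n = {α})
    {y : ℕ → ℝ} (hy : y ∈ Dinf p n) : ∃ c : ℝ, y = c • proj α := by
  by_cases h0 : y = 0
  · exact ⟨0, by rw [h0, zero_smul]⟩
  have hO := (hy 0 : y ∈ Orth p)
  have ht : 0 < tot p y := lt_of_le_of_ne (tot_nonneg hO) fun h => h0 (eq_zero_of_tot hO h.symm)
  have h1 : proj (ofv (p + 2) ((tot p y)⁻¹ • y)) = (tot p y)⁻¹ • y :=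
    proj_ofv (Orth_smul (by positivity) hO).2
  have h2 : ofv (p + 2) ((tot p y)⁻¹ • y) ∈ PhiFiber (p + 2) n := by
    apply fiber_of_Dinf
    · rw [mem_simplex, h1]
      exact ⟨Orth_smul (by positivity) hO, by rw [tot_smul, inv_mul_cancel₀ ht.ne']⟩
    · rw [h1]; exact Dinf_smul (by positivity) hy
  rw [hreg, Set.mem_singleton_iff] at h2
  refine ⟨tot p y, ?_⟩
  rw [← h2, h1, smul_smul, mul_inv_cancel₀ ht.ne', one_smul]

lemma alpha_fiber {p : ℕ} {n : ℕ → ℕ} {α : E (p + 2)} (hreg : PhiFiber (p + 2) n = {α}) :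
    α ∈ PhiFiber (p + 2) n := by rw [hreg]; rfl

lemma CExt_alpha {p : ℕ} {n : ℕ → ℕ} {α : E (p + 2)} (hreg : PhiFiber (p + 2) n = {α}) :
    CExt p n (proj α) := by
  have hD : proj α ∈ Dinf p n := fun r => DD_of_fiber r n α (alpha_fiber hreg)
  have h0 : proj α ≠ 0 := by
    intro h0
    have := (mem_simplex'.1 (alpha_fiber hreg).1).2
    rw [h0] at this; simp at this
  refine ⟨Dinf_Cinf hD, fun a b ha hb hab => ?_⟩
  have hcl : a ∈ Dinf p n ∨ b ∈ Dinf p n := by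
    by_contra hcon
    push Not at hcon
    apply hcon.1
    intro r
    rcases Dinf_split r n _ a b hD h0 hab ha hb with h | h | h
    · exact h.1
    · exact absurd h hcon.1
    · exact absurd h hcon.2
  rcases hcl with h | h
  · exact Dinf_unique hreg h
  · obtain ⟨c, hc⟩ := Dinf_unique hreg h
    refine ⟨1 - c, ?_⟩
    rw [sub_smul, one_smul, ← hc, ← hab]; abel

/-! ### Shrinking -/

lemma continuous_proj {k : ℕ} : Continuous (fun x : E k => proj x) := by
  apply continuous_pi
  intro i
  unfold proj
  split_ifs
  · fun_prop
  · fun_prop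

lemma isCompact_simplex (p : ℕ) : IsCompact (simplex (p + 2)) := by
  rw [Metric.isCompact_iff_isClosed_bounded]
  constructor
  · have : simplex (p + 2) = (⋂ i, {x : E (p + 2) | 0 ≤ x i}) ∩ {x | ∑ i, x i = 1} := by
      ext x; simp [simplex]
    rw [this]
    apply IsClosed.inter
    · exact isClosed_iInter fun i => isClosed_le continuous_const (by fun_prop)
    · exact isClosed_eq (by fun_prop) continuous_const
  · rw [isBounded_iff_forall_norm_le]
    refine ⟨1, fun x hx => ?_⟩
    rw [EuclideanSpace.norm_eq, Real.sqrt_le_one]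
    calc ∑ i, ‖x i‖ ^ 2 ≤ ∑ i, x i := by
          apply Finset.sum_le_sum
          intro i _
          have h1 := hx.1 i
          have h2 : x i ≤ 1 := by
            rw [← hx.2]; exact Finset.single_le_sum (fun i _ => hx.1 i) (Finset.mem_univ i)
          rw [Real.norm_of_nonneg h1]; nlinarith
      _ = 1 := hx.2

lemma DD_shrink {p : ℕ} {n : ℕ → ℕ} {α : E (p + 2)} (hreg : PhiFiber (p + 2) n = {α})
    {ε : ℝ} (hε : 0 < ε) : ∃ r, ∀ s ≥ r, ∀ x ∈ simplex (p + 2), proj x ∈ DD p s n → dist x α < ε := by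
  have hanti : Antitone fun r => simplex (p + 2) ∩ (fun x => proj x) ⁻¹' DD p r n := by
    apply antitone_nat_of_succ_le
    intro r x hx
    exact ⟨hx.1, DD_anti r n hx.2⟩
  have hdir : Directed (· ⊇ ·) fun r => simplex (p + 2) ∩ (fun x => proj x) ⁻¹' DD p r n :=
    hanti.directed_ge
  have hcomp : ∀ r, IsCompact (simplex (p + 2) ∩ (fun x => proj x) ⁻¹' DD p r n) := fun r =>
    (isCompact_simplex p).inter_right ((isClosed_DD p r n).preimage continuous_proj)
  obtain ⟨r, hr⟩ := exists_subset_nhds_of_isCompact hdir hcomp (U := Metric.ball α ε) (by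
    intro x hx
    rw [Set.mem_iInter] at hx
    have : x ∈ PhiFiber (p + 2) n := fiber_of_Dinf (hx 0).1 fun r => (hx r).2
    rw [hreg, Set.mem_singleton_iff] at this
    rw [this]
    exact Metric.ball_mem_nhds _ hε)
  exact ⟨r, fun s hs x hx hD => hr (hanti hs ⟨hx, hD⟩)⟩

/-! ### Extreme points from extreme rays -/

def US (p : ℕ) (n : ℕ → ℕ) : Set (E (p + 2)) := {x | x ∈ simplex (p + 2) ∧ proj x ∈ Cinf p n}

lemma extreme_iff {p : ℕ} {n : ℕ → ℕ} {x : E (p + 2)} :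
    x ∈ Set.extremePoints ℝ (US p n) ↔ x ∈ simplex (p + 2) ∧ CExt p n (proj x) := by
  rw [mem_extremePoints]
  constructor
  · rintro ⟨hx, h⟩
    refine ⟨hx.1, hx.2, fun a b ha hb hab => ?_⟩
    have hxt := (mem_simplex.1 hx.1).2
    have hta := tot_nonneg (Cinf_Orth ha)
    have htb := tot_nonneg (Cinf_Orth hb)
    have hab' : tot p a + tot p b = 1 := by rw [← tot_add, hab, hxt]
    rcases hta.eq_or_lt with h1 | h1
    · exact ⟨0, by rw [eq_zero_of_tot (Cinf_Orth ha) h1.symm, zero_smul]⟩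
    rcases htb.eq_or_lt with h2 | h2
    · refine ⟨1, ?_⟩
      rw [one_smul, ← hab, eq_zero_of_tot (Cinf_Orth hb) h2.symm, add_zero]
    have mk : ∀ a : ℕ → ℝ, a ∈ Cinf p n → 0 < tot p a →
        ∃ z ∈ US p n, proj z = (tot p a)⁻¹ • a := by
      intro a ha h1
      have hp : proj (ofv (p + 2) ((tot p a)⁻¹ • a)) = (tot p a)⁻¹ • a :=
        proj_ofv (Orth_smul (by positivity) (Cinf_Orth ha)).2
      refine ⟨ofv (p + 2) ((tot p a)⁻¹ • a), ⟨?_, ?_⟩, hp⟩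
      · rw [mem_simplex, hp]
        exact ⟨Orth_smul (by positivity) (Cinf_Orth ha), by rw [tot_smul, inv_mul_cancel₀ h1.ne']⟩
      · rw [hp]; exact Cinf_smul (by positivity) ha
    obtain ⟨z1, hz1, e1⟩ := mk a ha h1
    obtain ⟨z2, hz2, e2⟩ := mk b hb h2
    have := (h z1 hz1 z2 hz2 ⟨tot p a, tot p b, h1, h2, hab', by
      apply proj_inj
      rw [proj_add, proj_smul, proj_smul, e1, e2, smul_smul, smul_smul, mul_inv_cancel₀ h1.ne',
        mul_inv_cancel₀ h2.ne', one_smul, one_smul, hab]⟩).1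
    refine ⟨tot p a, ?_⟩
    rw [← this, e1, smul_smul, mul_inv_cancel₀ h1.ne', one_smul]
  · rintro ⟨hx, h⟩
    refine ⟨⟨hx, h.1⟩, fun x1 h1 x2 h2 hseg => ?_⟩
    obtain ⟨s, t, hs, ht, hst, hxx⟩ := hseg
    have hadd : s • proj x1 + t • proj x2 = proj x := by rw [← hxx, proj_add, proj_smul, proj_smul]
    have e1 := Cinf_smul hs.le h1.2
    have e2 := Cinf_smul ht.le h2.2
    obtain ⟨c, hc⟩ := h.2 _ _ e1 e2 hadd
    obtain ⟨d, hd⟩ := h.2 _ _ e2 e1 (by rw [add_comm]; exact hadd)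
    refine ⟨eq_of_prop (c := s⁻¹ * c) h1.1 hx ?_, eq_of_prop (c := t⁻¹ * d) h2.1 hx ?_⟩
    · rw [mul_smul, ← hc, smul_smul, inv_mul_cancel₀ hs.ne', one_smul]
    · rw [mul_smul, ← hd, smul_smul, inv_mul_cancel₀ ht.ne', one_smul]

/-- The theorem, given `DF(n) = US`. -/
lemma final {p : ℕ} {n : ℕ → ℕ} {α : E (p + 2)} (hreg : PhiFiber (p + 2) n = {α})
    (hDF : DFn (p + 2) n = US p n) :
    Eset (p + 2) n = FEset (p + 2) n ∪ {α} ∧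
    ((Eset (p + 2) n).Infinite → α ∈ closure (Eset (p + 2) n \ {α})) := by
  have hUps : ∀ s, Ups n s (evec (p + 2) p) ∈ simplex (p + 2) ∧
      ∃ c : ℝ, 0 < c ∧ proj (Ups n s (evec (p + 2) p)) = c • UA p s n (eb p) := by
    intro s
    have := Ups_prop s n (evec (p + 2) p) (evec_simplex (by omega))
    rwa [proj_evec (by omega)] at this
  have hαs := mem_simplex'.1 (alpha_fiber hreg).1
  have nontriv : ∀ x : E (p + 2), 0 < proj x (p + 1) →
      x ∉ {α : E (p + 2) | ∃ i, i ≤ p + 2 - 2 ∧ α = evec (p + 2) i} := by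
    rintro x hx ⟨i, hi, rfl⟩
    have hi' : i ≤ p := hi
    rw [proj_evec (by omega)] at hx
    simp [eb, show p + 1 ≠ i by omega] at hx
  have h1 : Eset (p + 2) n = FEset (p + 2) n ∪ {α} := by
    unfold Eset
    rw [hDF]
    apply Set.Subset.antisymm
    · rintro x ⟨hx, hxn⟩
      rw [extreme_iff] at hx
      obtain ⟨hxs, hxe⟩ := hx
      by_cases hD : proj x ∈ Dinf p n
      · right
        have := fiber_of_Dinf hxs hD
        rwa [hreg] at this
      left
      have : ∃ r, proj x ∉ DD p r n := by
        by_contra hcon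
        push Not at hcon
        exact hD hcon
      obtain ⟨r, hr⟩ := this
      have h0 : proj x ≠ 0 := by
        intro h0
        have := (mem_simplex.1 hxs).2
        rw [h0] at this; simp [tot] at this
      obtain ⟨c, hc, ⟨i, hi, h⟩ | ⟨s, h⟩⟩ := CExt_class r n _ h0 hxe hr
      · exfalso
        apply hxn
        refine ⟨i, hi, eq_of_prop hxs (evec_simplex (by omega)) (c := c) ?_⟩
        rw [proj_evec (by omega), h]
      · rw [h] at hxe
        obtain ⟨t, ht⟩ := FEc_of_CExt s n (CExt_smul hc hxe)
        refine ⟨s, ⟨t, ht⟩, ?_⟩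
        obtain ⟨hs, d, hd, hu⟩ := hUps s
        refine eq_of_prop hxs hs (c := c * d⁻¹) ?_
        change _ = _ • proj (Ups n s (evec (p + 2) p))
        rw [hu, h, smul_smul, mul_assoc, inv_mul_cancel₀ hd.ne', mul_one]
    · rintro x (⟨s, hF, rfl⟩ | hx)
      · change Ups n s (evec (p + 2) p) ∈ _
        obtain ⟨hs, d, hd, hu⟩ := hUps s
        refine ⟨extreme_iff.2 ⟨hs, ?_⟩, nontriv _ ?_⟩
        · rw [hu]
          apply CExt_smul (inv_pos.2 hd)
          rw [smul_smul, inv_mul_cancel₀ hd.ne', one_smul]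
          exact CExt_UA s n hF
        · rw [hu]
          exact mul_pos hd (UA_last_pos s n)
      · rw [Set.mem_singleton_iff] at hx
        rw [hx]
        exact ⟨extreme_iff.2 ⟨hαs.1, CExt_alpha hreg⟩, nontriv _ hαs.2⟩
  refine ⟨h1, fun hinf => ?_⟩
  rw [h1] at *
  rw [Metric.mem_closure_iff]
  intro ε hε
  obtain ⟨r, hr⟩ := DD_shrink hreg hε
  have hfin : (((fun s => Ups n s (evec (p + 2) p)) '' Set.Iio r) ∪ {α}).Finite :=
    ((Set.finite_Iio r).image _).union (Set.finite_singleton _)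
  obtain ⟨x, hx, hx'⟩ := (hinf.sdiff hfin).nonempty
  have hxα : x ≠ α := fun h => hx' (Or.inr h)
  refine ⟨x, ⟨hx, hxα⟩, ?_⟩
  obtain ⟨s, hF, he⟩ := hx.resolve_right hxα
  have he' : x = Ups n s (evec (p + 2) p) := he
  have hsr : r ≤ s := by
    by_contra hlt
    exact hx' (Or.inl ⟨s, not_le.1 hlt, he'.symm⟩)
  obtain ⟨hs, d, hd, hu⟩ := hUps s
  rw [dist_comm, he']
  apply hr (s + 1) (by omega) _ hs
  rw [hu]
  exact DD_smul hd.le _ _ _ (UA_DD s n (eb_Orth (by omega)))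

/-! ### Words and substitutions -/

def scons (a : ℕ) (v : Seq) : Seq
  | 0 => a
  | m + 1 => v m

def app : List ℕ → Seq → Seq
  | [], v => v
  | a :: t, v => scons a (app t v)

def pre (v : Seq) (m : ℕ) : List ℕ := (List.range m).map v

def subS (τ : ℕ → List ℕ) (w : Seq) : Seq := fun m => ((pre w (m + 1)).flatMap τ).getD m 0

lemma lamSub_eq (k n : ℕ) : lamSub k n = subS (lamWord k n) := by
  funext w m
  simp only [lamSub, subS, pre, List.flatMap, List.map_map]
  rfl

lemma shift_scons (a : ℕ) (v : Seq) : shift (scons a v) = v := rfl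

lemma scons_eta (v : Seq) : v = scons (v 0) (shift v) := by
  funext m; cases m <;> rfl

lemma app_append (x y : List ℕ) (v : Seq) : app (x ++ y) v = app x (app y v) := by
  induction x with
  | nil => rfl
  | cons a t ih => simp [app, ih]

lemma pre_zero (v : Seq) : pre v 0 = [] := rfl

lemma pre_succ (v : Seq) (m : ℕ) : pre v (m + 1) = pre v m ++ [v m] := by
  simp [pre, List.range_succ]

lemma pre_succ' (v : Seq) (m : ℕ) : pre v (m + 1) = v 0 :: pre (shift v) m := by
  simp only [pre, List.range_succ_eq_map, List.map_cons, List.map_map]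
  rfl

lemma pre_length (v : Seq) (m : ℕ) : (pre v m).length = m := by simp [pre]

lemma shift_iter (v : Seq) (r m : ℕ) : shift^[r] v m = v (r + m) := by
  induction r generalizing v with
  | zero => simp
  | succ r ih => rw [Function.iterate_succ_apply, ih]; simp only [shift]; congr 1; omega

lemma pre_add (v : Seq) (a b : ℕ) : pre v (a + b) = pre v a ++ pre (shift^[a] v) b := by
  induction b with
  | zero => simp [pre]
  | succ b ih => rw [← add_assoc, pre_succ, ih, pre_succ, shift_iter, List.append_assoc]

lemma pre_congr {u v : Seq} {m : ℕ} (h : ∀ s < m, u s = v s) : pre u m = pre v m := by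
  apply List.map_congr_left
  intro s hs
  exact h s (List.mem_range.1 hs)

lemma app_getD (x : List ℕ) (v : Seq) (m : ℕ) :
    app x v m = if m < x.length then x.getD m 0 else v (m - x.length) := by
  induction x generalizing m with
  | nil => simp [app]
  | cons a t ih =>
    cases m with
    | zero => simp [app, scons]
    | succ m => simp [app, scons, ih]

lemma length_flatMap_ge {τ : ℕ → List ℕ} (hτ : ∀ a, τ a ≠ []) (x : List ℕ) :
    x.length ≤ (x.flatMap τ).length := by
  induction x with
  | nil => simp
  | cons a t ih =>
    have := List.length_pos_iff.2 (hτ a)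
    simp only [List.flatMap_cons, List.length_append, List.length_cons]; omega

lemma subS_unroll {τ : ℕ → List ℕ} (hτ : ∀ a, τ a ≠ []) (w : Seq) :
    subS τ w = app (τ (w 0)) (subS τ (shift w)) := by
  funext m
  rw [app_getD]
  have h0 := List.length_pos_iff.2 (hτ (w 0))
  simp only [subS]
  rw [pre_succ', List.flatMap_cons]
  split_ifs with h
  · rw [List.getD_append _ _ _ _ h]
  · rw [List.getD_append_right _ _ _ _ (by omega)]
    obtain ⟨b, hb⟩ : ∃ b, m = (m - (τ (w 0)).length + 1) + b := ⟨(τ (w 0)).length - 1, by omega⟩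
    generalize hm' : m - (τ (w 0)).length = m' at *
    rw [hb, pre_add, List.flatMap_append, List.getD_append]
    have := length_flatMap_ge hτ (pre (shift w) (m' + 1))
    rw [pre_length] at this
    omega

lemma subS_unroll_pre {τ : ℕ → List ℕ} (hτ : ∀ a, τ a ≠ []) (w : Seq) (i : ℕ) :
    subS τ w = app ((pre w i).flatMap τ) (subS τ (shift^[i] w)) := by
  induction i with
  | zero => simp [pre, app]
  | succ i ih =>
    rw [ih, subS_unroll hτ (shift^[i] w), pre_succ, List.flatMap_append, app_append]
    rw [shift_iter, Function.iterate_succ_apply']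
    simp

lemma pre_app (x : List ℕ) (v : Seq) : pre (app x v) x.length = x := by
  induction x with
  | nil => rfl
  | cons a t ih =>
    rw [List.length_cons, pre_succ']
    simp only [app, shift_scons, ih, scons]

lemma subS_block {τ : ℕ → List ℕ} (hτ : ∀ a, τ a ≠ []) (w : Seq) (l : ℕ) :
    ∃ i j, j < (τ (w i)).length ∧
      pre (subS τ w) l = (pre w i).flatMap τ ++ (τ (w i)).take j ∧
      shift^[l] (subS τ w) = app ((τ (w i)).drop j) (subS τ (shift^[i+1] w)) := by
  induction l with
  | zero =>
    refine ⟨0, 0, List.length_pos_iff.2 (hτ _), by simp [pre], ?_⟩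
    simpa using subS_unroll hτ w
  | succ l ih =>
    obtain ⟨i, j, hj, h1, h2⟩ := ih
    have hd : (τ (w i)).drop j = (τ (w i))[j] :: (τ (w i)).drop (j + 1) :=
      List.drop_eq_getElem_cons hj
    rw [hd] at h2
    have hl : subS τ w l = (τ (w i))[j] := by
      have := congrFun h2 0
      rw [shift_iter] at this
      simpa [app, scons] using this
    have hpre : pre (subS τ w) (l + 1) = (pre w i).flatMap τ ++ (τ (w i)).take (j + 1) := by
      rw [pre_succ, h1, hl, List.append_assoc, List.take_add_one, List.getElem?_eq_getElem hj]
      rfl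
    have htail : shift^[l + 1] (subS τ w) = app ((τ (w i)).drop (j + 1)) (subS τ (shift^[i+1] w)) := by
      rw [Function.iterate_succ_apply', h2]
      rfl
    by_cases hj2 : j + 1 < (τ (w i)).length
    · exact ⟨i, j + 1, hj2, hpre, htail⟩
    · refine ⟨i + 1, 0, List.length_pos_iff.2 (hτ _), ?_, ?_⟩
      · rw [hpre, List.take_of_length_le (by omega), pre_succ, List.flatMap_append]; simp
      · rw [htail, List.drop_of_length_le (by omega)]
        show subS τ (shift^[i+1] w) = _
        rw [subS_unroll hτ (shift^[i+1] w), shift_iter, ← Function.iterate_succ_apply' shift]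
        rfl

/-! ### Order -/

lemma seqLt_scons {a : ℕ} {u v : Seq} (h : seqLt u v) : seqLt (scons a u) (scons a v) := by
  obtain ⟨r, h1, h2⟩ := h
  refine ⟨r + 1, ?_, h2⟩
  intro s hs
  cases s with
  | zero => rfl
  | succ s => exact h1 s (by omega)

lemma seqLt_scons_of_lt {a b : ℕ} {u v : Seq} (h : a < b) : seqLt (scons a u) (scons b v) :=
  ⟨0, by simp, h⟩

lemma seqLt_of_lt {u v : Seq} (h : u 0 < v 0) : seqLt u v := ⟨0, by simp, h⟩

lemma seqLt_app {x : List ℕ} {u v : Seq} (h : seqLt u v) : seqLt (app x u) (app x v) := by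
  induction x with
  | nil => exact h
  | cons a t ih => exact seqLt_scons ih

lemma seqLt_asymm {u v : Seq} (h : seqLt u v) (h' : seqLt v u) : False := by
  obtain ⟨r, h1, h2⟩ := h
  obtain ⟨s, h3, h4⟩ := h'
  rcases lt_trichotomy r s with h | h | h
  · have := h3 r h; omega
  · subst h; omega
  · have := h1 s h; omega

lemma seqLt_irrefl {u : Seq} (h : seqLt u u) : False := seqLt_asymm h h

lemma seqLe_or {u v : Seq} : seqLe u v ∨ seqLt v u := by
  by_cases h : u = v
  · exact Or.inl (Or.inr h)
  · have hex : ∃ r, u r ≠ v r := by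
      by_contra hc; push Not at hc; exact h (funext hc)
    have h1 := Nat.find_spec hex
    have h2 : ∀ s < Nat.find hex, u s = v s := fun s hs => by
      by_contra hc; exact Nat.find_min hex hs hc
    rcases lt_or_gt_of_ne h1 with h3 | h3
    · exact Or.inl (Or.inl ⟨_, h2, h3⟩)
    · exact Or.inr ⟨_, fun s hs => (h2 s hs).symm, h3⟩

lemma seqLe_not_lt {u v : Seq} (h : seqLe u v) (h' : seqLt v u) : False := by
  rcases h with h | h
  · exact seqLt_asymm h h'
  · subst h; exact seqLt_irrefl h'

/-! ### The words of Λ -/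

lemma lamWord_ne (p n a : ℕ) : lamWord (p + 2) n a ≠ [] := by
  unfold lamWord; split_ifs <;> simp

lemma lamWord_lt {p n a : ℕ} (h : a < p) : lamWord (p + 2) n a = [a + 1] := by
  unfold lamWord; rw [if_pos (by omega)]

lemma lamWord_p {p n : ℕ} : lamWord (p + 2) n p = (p + 1) :: List.replicate (n + 1) 0 := by
  unfold lamWord; simp

lemma lamWord_last {p n : ℕ} : lamWord (p + 2) n (p + 1) = (p + 1) :: List.replicate n 0 := by
  unfold lamWord; simp

lemma digit_cases {p a : ℕ} (h : a < p + 2) : a < p ∨ a = p ∨ a = p + 1 := by omega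

/-- structure of words of Λ: nonzero head, zero tail -/
lemma lamWord_form {p n a : ℕ} (h : a < p + 2) : ∃ c m, lamWord (p + 2) n a = c :: List.replicate m 0 ∧
    1 ≤ c ∧ c < p + 2 ∧ m ≤ n + 1 := by
  rcases digit_cases h with h | h | h
  · exact ⟨a + 1, 0, by rw [lamWord_lt h]; rfl, by omega, by omega, by omega⟩
  · subst h; exact ⟨a + 1, n + 1, lamWord_p, by omega, by omega, by omega⟩
  · subst h; exact ⟨p + 1, n, lamWord_last, by omega, by omega, by omega⟩

lemma lam_unroll (p n : ℕ) (w : Seq) :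
    lamSub (p + 2) n w = app (lamWord (p + 2) n (w 0)) (lamSub (p + 2) n (shift w)) := by
  rw [lamSub_eq]; exact subS_unroll (lamWord_ne p n) w

lemma lam_head {p n : ℕ} {w : Seq} (hw : InSigma (p + 2) w) : 1 ≤ lamSub (p + 2) n w 0 := by
  obtain ⟨c, m, h, h1, -⟩ := lamWord_form (n := n) (hw 0)
  rw [lam_unroll, h]
  exact h1

lemma lam_head_top {p n : ℕ} {w : Seq} (hw : w 0 = p + 1) : lamSub (p + 2) n w 0 = p + 1 := by
  rw [lam_unroll, hw, lamWord_last]; rfl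

lemma InSigma_shift {k : ℕ} {w : Seq} (h : InSigma k w) (r : ℕ) : InSigma k (shift^[r] w) := by
  intro m; rw [shift_iter]; exact h _

lemma app_replicate_head {m : ℕ} {u v : Seq} (hv : 1 ≤ v 0) :
    seqLt (app (List.replicate (m + 1) 0) u) (app (List.replicate m 0) v) := by
  rw [List.replicate_succ', app_append]
  exact seqLt_app (seqLt_of_lt hv)

lemma lam_lt0 {p n : ℕ} {u v : Seq} (hv : InSigma (p + 2) v) (h : u 0 < v 0) :
    seqLt (lamSub (p + 2) n u) (lamSub (p + 2) n v) := by
  have hv0 := hv 0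
  rw [lam_unroll p n u, lam_unroll p n v]
  by_cases h1 : u 0 < p
  · apply seqLt_of_lt
    rw [lamWord_lt h1]
    rcases digit_cases hv0 with h2 | h2 | h2
    · rw [lamWord_lt h2]; simp [app, scons, h]
    · rw [h2, lamWord_p]; simp [app, scons, h1]
    · rw [h2, lamWord_last]; simp [app, scons, h1]
  · have h2 : u 0 = p := by omega
    have h3 : v 0 = p + 1 := by omega
    rw [h2, h3, lamWord_p, lamWord_last]
    exact seqLt_scons (app_replicate_head (lam_head (InSigma_shift hv 1)))

lemma lam_lt {p n : ℕ} {u v : Seq} (hv : InSigma (p + 2) v) (h : seqLt u v) :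
    seqLt (lamSub (p + 2) n u) (lamSub (p + 2) n v) := by
  obtain ⟨r, h1, h2⟩ := h
  have e := pre_congr h1
  rw [lamSub_eq, subS_unroll_pre (lamWord_ne p n) u r, subS_unroll_pre (lamWord_ne p n) v r, e]
  apply seqLt_app
  rw [← lamSub_eq]
  apply lam_lt0 (InSigma_shift hv r)
  rw [shift_iter, shift_iter]; exact h2

lemma lam_le {p n : ℕ} {u v : Seq} (hv : InSigma (p + 2) v) (h : seqLe u v) :
    seqLe (lamSub (p + 2) n u) (lamSub (p + 2) n v) := by
  rcases h with h | h
  · exact Or.inl (lam_lt hv h)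
  · subst h; exact Or.inr rfl

/-- tails of a Λ image: either block start, or start with 0 -/
lemma lam_tail {p n : ℕ} {v : Seq} (hv : InSigma (p + 2) v) (l : ℕ) :
    (∃ i, pre (lamSub (p + 2) n v) l = (pre v i).flatMap (lamWord (p + 2) n) ∧
      shift^[l] (lamSub (p + 2) n v) = lamSub (p + 2) n (shift^[i] v)) ∨
    lamSub (p + 2) n v l = 0 := by
  rw [lamSub_eq]
  obtain ⟨i, j, hj, h1, h2⟩ := subS_block (lamWord_ne p n) v l
  rcases Nat.eq_zero_or_pos j with h0 | h0
  · left
    subst h0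
    refine ⟨i, by simpa using h1, ?_⟩
    rw [h2, subS_unroll (lamWord_ne p n) (shift^[i] v), shift_iter, Function.iterate_succ_apply']
    simp
  · right
    have h3 := congrFun h2 0
    rw [shift_iter, add_zero] at h3
    rw [h3, List.drop_eq_getElem_cons hj]
    show (lamWord (p + 2) n (v i))[j] = 0
    obtain ⟨c, m, h, -⟩ := lamWord_form (n := n) (hv i)
    obtain ⟨j', rfl⟩ : ∃ j', j = j' + 1 := ⟨j - 1, by omega⟩
    simp [h]

lemma lam_InSigma {p n : ℕ} {v : Seq} (hv : InSigma (p + 2) v) : InSigma (p + 2) (lamSub (p + 2) n v) := by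
  intro l
  rcases lam_tail (n := n) hv l with ⟨i, h1, h2⟩ | h
  · have := congrFun h2 0
    rw [shift_iter, add_zero] at this
    obtain ⟨c, m, h, _, h4, _⟩ := lamWord_form (n := n) (hv i)
    rw [this, lam_unroll, shift_iter, add_zero, h]
    exact h4
  · omega

lemma lam_Xset {p n : ℕ} {v w : Seq} (hw : InSigma (p + 2) w) (hw0 : w 0 = p + 1)
    (hv : v ∈ Xset (p + 2) w) : lamSub (p + 2) n v ∈ Xset (p + 2) (lamSub (p + 2) n w) := by
  refine ⟨lam_InSigma hv.1, fun l => ?_⟩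
  rcases lam_tail (n := n) hv.1 l with ⟨i, h1, h2⟩ | h
  · rw [h2]
    exact lam_le hw (hv.2 i)
  · left
    apply seqLt_of_lt
    rw [shift_iter, add_zero, h, lam_head_top hw0]
    omega

/-! ### The sequence S(n) -/

def Good (p : ℕ) (w : Seq) : Prop := w ∈ Xset (p + 2) w ∧ w 0 = p + 1

lemma Good.lam {p n : ℕ} {w : Seq} (h : Good p w) : Good p (lamSub (p + 2) n w) :=
  ⟨lam_Xset h.1.1 h.2 h.1, lam_head_top h.2⟩

lemma le_top {p : ℕ} {v : Seq} (hv : InSigma (p + 2) v) : seqLe v (topSeq (p + 2)) := by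
  rcases @seqLe_or v (topSeq (p + 2)) with h | ⟨r, h1, h2⟩
  · exact h
  · have := hv r
    simp [topSeq] at h2
    omega

lemma Good_top (p : ℕ) : Good p (topSeq (p + 2)) := by
  refine ⟨⟨fun r => by simp [topSeq], fun r => Or.inr ?_⟩, by simp [topSeq]⟩
  funext m; rw [shift_iter]; rfl

lemma lamChain_succ (k : ℕ) : ∀ (r : ℕ) (n : ℕ → ℕ) (w : Seq),
    lamChain k n (r + 1) w = lamSub k (n 0) (lamChain k (shift n) r w) := by
  intro r
  induction r with
  | zero => intro n w; rfl
  | succ r ih =>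
    intro n w
    show lamChain k n (r + 1) (lamSub k (n (r + 2)) w) = _
    rw [ih]; rfl

lemma Good_chain {p : ℕ} : ∀ (r : ℕ) (n : ℕ → ℕ), Good p (lamChain (p + 2) n r (topSeq (p + 2))) := by
  intro r
  induction r with
  | zero => intro n; exact (Good_top p).lam
  | succ r ih => intro n; rw [lamChain_succ]; exact (ih _).lam

lemma chain_anti {p : ℕ} : ∀ (r : ℕ) (n : ℕ → ℕ), seqLe (lamChain (p + 2) n (r + 1) (topSeq (p + 2)))
    (lamChain (p + 2) n r (topSeq (p + 2))) := by
  intro r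
  induction r with
  | zero => intro n; exact lam_le (Good_top p).1.1 (le_top (Good_top p).lam.1.1)
  | succ r ih =>
    intro n; rw [lamChain_succ _ (r + 1) n, lamChain_succ _ r n]
    exact lam_le (Good_chain r _).1.1 (ih _)

lemma exists_limit {a : ℕ → Seq} (h : ∀ r, seqLe (a (r + 1)) (a r)) :
    ∃ L : Seq, ∀ m, ∀ᶠ r in atTop, a r m = L m := by
  have key : ∀ m, ∃ c, ∀ᶠ r in atTop, a r m = c := by
    intro m
    induction m using Nat.strong_induction_on with
    | _ m ih =>
      have h1 : ∀ᶠ r in atTop, ∀ s < m, a (r + 1) s = a r s := by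
        have : ∀ s ∈ Finset.range m, ∀ᶠ r in atTop, a (r + 1) s = a r s := by
          intro s hs
          obtain ⟨c, hc⟩ := ih s (Finset.mem_range.1 hs)
          have hc' : ∀ᶠ r in atTop, a (r + 1) s = c := (tendsto_add_atTop_nat 1).eventually hc
          filter_upwards [hc, hc'] with r h1 h2
          rw [h1, h2]
        have := (Finset.eventually_all (Finset.range m)).2 this
        filter_upwards [this] with r hr s hs
        exact hr s (Finset.mem_range.2 hs)
      obtain ⟨R, hR⟩ := eventually_atTop.1 h1
      have h2 : ∀ r ≥ R, a (r + 1) m ≤ a r m := by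
        intro r hr
        by_contra hc
        push Not at hc
        exact seqLe_not_lt (h r) ⟨m, fun s hs => (hR r hr s hs).symm, hc⟩
      have h3 : Antitone fun i => a (R + i) m := antitone_nat_of_succ_le fun i => h2 (R + i) (by omega)
      obtain ⟨i0, hi0⟩ : ∃ i0, ∀ i, a (R + i0) m ≤ a (R + i) m := by
        have hex : ∃ c, ∃ i, a (R + i) m = c := ⟨_, 0, rfl⟩
        obtain ⟨i0, h0⟩ := Nat.find_spec hex
        exact ⟨i0, fun i => by rw [h0]; exact Nat.find_min' hex ⟨i, rfl⟩⟩
      refine ⟨a (R + i0) m, ?_⟩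
      filter_upwards [eventually_ge_atTop (R + i0)] with r hr
      obtain ⟨i, rfl⟩ : ∃ i, r = R + i := ⟨r - R, by omega⟩
      exact le_antisymm (h3 (by omega : i0 ≤ i)) (hi0 i)
  choose L hL using key
  exact ⟨L, hL⟩

lemma Sseq_tendsto (p : ℕ) (n : ℕ → ℕ) :
    ∀ m, ∀ᶠ r in atTop, lamChain (p + 2) n r (topSeq (p + 2)) m = Sseq (p + 2) n m := by
  obtain ⟨L, hL⟩ := exists_limit (a := fun r => lamChain (p + 2) n r (topSeq (p + 2)))
    (fun r => chain_anti r n)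
  have : Tendsto (fun r => lamChain (p + 2) n r (topSeq (p + 2))) atTop (𝓝 L) := by
    rw [tendsto_pi_nhds]
    intro m
    exact tendsto_const_nhds.congr' ((hL m).mono fun r hr => hr.symm)
  have e : Sseq (p + 2) n = L := this.limUnder_eq
  rw [e]; exact hL

lemma eventually_pre {a : ℕ → Seq} {L : Seq} (h : ∀ m, ∀ᶠ r in atTop, a r m = L m) (m : ℕ) :
    ∀ᶠ r in atTop, ∀ s < m, a r s = L s := by
  have := (Finset.eventually_all (Finset.range m) (l := atTop) (p := fun s r => a r s = L s)).2
    fun s _ => h s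
  filter_upwards [this] with r hr s hs
  exact hr s (Finset.mem_range.2 hs)

lemma seqLe_lim {a b : ℕ → Seq} {L M : Seq} (ha : ∀ m, ∀ᶠ r in atTop, a r m = L m)
    (hb : ∀ m, ∀ᶠ r in atTop, b r m = M m) (h : ∀ r, seqLe (a r) (b r)) : seqLe L M := by
  rcases @seqLe_or L M with h' | ⟨r, h1, h2⟩
  · exact h'
  · exfalso
    obtain ⟨t, h3, h4⟩ := ((eventually_pre ha (r + 1)).and (eventually_pre hb (r + 1))).exists
    apply seqLe_not_lt (h t)
    refine ⟨r, fun s hs => ?_, ?_⟩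
    · rw [h3 s (by omega), h4 s (by omega), h1 s hs]
    · rw [h3 r (by omega), h4 r (by omega)]; exact h2

lemma Sseq_good (p : ℕ) (n : ℕ → ℕ) : Good p (Sseq (p + 2) n) := by
  have h := Sseq_tendsto p n
  refine ⟨⟨fun m => ?_, fun l => ?_⟩, ?_⟩
  · obtain ⟨r, hr⟩ := (h m).exists
    rw [← hr]; exact (Good_chain r n).1.1 m
  · apply seqLe_lim (a := fun r => shift^[l] (lamChain (p + 2) n r (topSeq (p + 2)))) _ h
    · intro r; exact (Good_chain r n).1.2 l
    · intro m
      filter_upwards [h (l + m)] with r hr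
      rw [shift_iter, shift_iter, hr]
  · obtain ⟨r, hr⟩ := (h 0).exists
    rw [← hr]; exact (Good_chain r n).2

lemma Sseq_lam (p : ℕ) (n : ℕ → ℕ) :
    Sseq (p + 2) n = lamSub (p + 2) (n 0) (Sseq (p + 2) (shift n)) := by
  funext m
  have h1 : ∀ᶠ r in atTop, lamChain (p + 2) n (r + 1) (topSeq (p + 2)) m = Sseq (p + 2) n m :=
    (tendsto_add_atTop_nat 1).eventually (Sseq_tendsto p n m)
  obtain ⟨r, h3, h4⟩ := (h1.and (eventually_pre (Sseq_tendsto p (shift n)) (m + 1))).exists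
  rw [← h3, lamChain_succ, lamSub_eq]
  simp only [subS]
  rw [pre_congr h4]

/-! ### Counting vectors -/

def cnt (x : List ℕ) : ℕ → ℝ := fun i => (x.count i : ℝ)

lemma cnt_nil : cnt [] = 0 := by funext i; simp [cnt]

lemma cnt_append (x y : List ℕ) : cnt (x ++ y) = cnt x + cnt y := by
  funext i; simp [cnt, List.count_append]

lemma cnt_single (a : ℕ) : cnt [a] = eb a := by
  funext i
  by_cases h : i = a
  · subst h; simp [cnt, eb]
  · have : a ≠ i := fun h' => h h'.symm
    simp [cnt, eb, h, this]

lemma cnt_cons (a : ℕ) (t : List ℕ) : cnt (a :: t) = eb a + cnt t := by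
  rw [← List.singleton_append, cnt_append, cnt_single]

lemma cnt_replicate (m : ℕ) : cnt (List.replicate m 0) = (m : ℝ) • eb 0 := by
  induction m with
  | zero => simp [cnt_nil]
  | succ m ih => rw [List.replicate_succ, cnt_cons, ih]; push_cast; rw [add_smul, one_smul, add_comm]

lemma cnt_nonneg (x : List ℕ) (i : ℕ) : 0 ≤ cnt x i := by simp [cnt]

lemma cnt_le_length (x : List ℕ) (i : ℕ) : cnt x i ≤ x.length := by
  simp only [cnt]; exact_mod_cast List.count_le_length

lemma cnt_lamWord {p n a : ℕ} (h : a < p + 2) : cnt (lamWord (p + 2) n a) = Am p n (eb a) := by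
  rcases digit_cases h with h | h | h
  · rw [lamWord_lt h, Am_eb h, cnt_single]
  · subst h; rw [lamWord_p, Am_eb_p, cnt_cons, cnt_replicate, add_comm]; push_cast; rfl
  · subst h; rw [lamWord_last, Am_eb_last, cnt_cons, cnt_replicate, add_comm]

lemma cnt_flatMap {p : ℕ} {τ : ℕ → List ℕ} {A : (ℕ → ℝ) → (ℕ → ℝ)} (hA0 : A 0 = 0)
    (hA : ∀ y z, A (y + z) = A y + A z) (hτA : ∀ a < p + 2, cnt (τ a) = A (eb a))
    (x : List ℕ) (hx : ∀ a ∈ x, a < p + 2) : cnt (x.flatMap τ) = A (cnt x) := by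
  induction x with
  | nil => simp [cnt_nil, hA0]
  | cons a t ih =>
    rw [List.flatMap_cons, cnt_append, ih fun b hb => hx b (List.mem_cons_of_mem _ hb), cnt_cons, hA,
      hτA a (hx a List.mem_cons_self)]

lemma pre_mem {k : ℕ} {v : Seq} (hv : InSigma k v) {m : ℕ} : ∀ a ∈ pre v m, a < k := by
  intro a ha
  simp only [pre, List.mem_map] at ha
  obtain ⟨s, -, rfl⟩ := ha
  exact hv s

lemma cnt_lam {p n : ℕ} (x : List ℕ) (hx : ∀ a ∈ x, a < p + 2) :
    cnt (x.flatMap (lamWord (p + 2) n)) = Am p n (cnt x) :=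
  cnt_flatMap (Am_zero p n) (Am_add p n) (fun _ => cnt_lamWord) x hx

lemma cnt_supp {p : ℕ} (x : List ℕ) (hx : ∀ a ∈ x, a < p + 2) : cnt x ∈ Orth p := by
  refine ⟨cnt_nonneg x, fun i hi => ?_⟩
  simp only [cnt, Nat.cast_eq_zero]
  apply List.count_eq_zero_of_not_mem
  intro h
  have := hx i h
  omega

lemma cnt_pre_Orth {p : ℕ} {v : Seq} (hv : InSigma (p + 2) v) (m : ℕ) : cnt (pre v m) ∈ Orth p :=
  cnt_supp _ (pre_mem hv)

lemma tot_cnt {p : ℕ} (x : List ℕ) (hx : ∀ a ∈ x, a < p + 2) : tot p (cnt x) = x.length := by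
  induction x with
  | nil => simp [cnt_nil, tot]
  | cons a t ih =>
    rw [cnt_cons, tot_add, ih fun b hb => hx b (List.mem_cons_of_mem _ hb), tot_eb (hx a List.mem_cons_self)]
    push_cast [List.length_cons]; ring

lemma tot_cnt_pre {p : ℕ} {v : Seq} (hv : InSigma (p + 2) v) (m : ℕ) : tot p (cnt (pre v m)) = m := by
  rw [tot_cnt _ (pre_mem hv), pre_length]

lemma digitCount_eq (v : Seq) (i m : ℕ) : (digitCount v i m : ℝ) = cnt (pre v m) i := by
  induction m with
  | zero => simp [digitCount, cnt, pre]
  | succ m ih =>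
    rw [pre_succ, cnt_append, cnt_single, Pi.add_apply, ← ih]
    unfold digitCount
    rw [Finset.range_add_one, Finset.filter_insert]
    by_cases h : v m = i
    · rw [if_pos h, Finset.card_insert_of_notMem (by simp)]
      subst h; simp [eb]
    · have h' : i ≠ v m := fun h' => h h'.symm
      rw [if_neg h]; simp [eb, h']

def Freq (v : Seq) (y : ℕ → ℝ) : Prop :=
  Tendsto (fun m : ℕ => (m : ℝ)⁻¹ • cnt (pre v m)) atTop (𝓝 y)

lemma freq_iff {p : ℕ} {v : Seq} (hv : InSigma (p + 2) v) (x : E (p + 2)) :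
    HasDigitFreq (p + 2) v x ↔ Freq v (proj x) := by
  unfold HasDigitFreq Freq
  rw [tendsto_pi_nhds]
  have e : ∀ i m : ℕ, ((m : ℝ)⁻¹ • cnt (pre v m)) i = (digitCount v i m : ℝ) / (m : ℝ) := by
    intro i m; rw [digitCount_eq]; simp [div_eq_inv_mul]
  constructor
  · intro h i
    by_cases hi : i < p + 2
    · simp only [e]; exact h i hi
    · rw [proj_supp x i (by omega)]
      have : ∀ m : ℕ, ((m : ℝ)⁻¹ • cnt (pre v m)) i = 0 := fun m => by
        simp [(cnt_pre_Orth hv m).2 i (by omega)]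
      simp only [this]; exact tendsto_const_nhds
  · intro h i _
    have := h i
    simp only [e] at this; exact this

/-! ### `DF(n) ⊆ US` -/

lemma zero_CC {p r : ℕ} {n : ℕ → ℕ} : (0 : ℕ → ℝ) ∈ CC p r n := by
  have := CC_smul (p := p) le_rfl r n _ (eb_Cinf n (Nat.zero_le p) r)
  simpa using this

lemma rep_CC {p r : ℕ} {n : ℕ → ℕ} {w : Seq} (hw : Good p w)
    (hc : ∀ l d, d < w l → cnt (pre w l ++ [d]) ∈ CC p r n) (i : ℕ) :
    cnt (pre w (i + 1)) + (eb p - eb (p + 1)) ∈ CC p r n := by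
  have hlast : ∀ i, w i = p + 1 → cnt (pre w (i + 1)) + (eb p - eb (p + 1)) ∈ CC p r n := by
    intro i h
    have := hc i p (by omega)
    rw [cnt_append, cnt_single] at this
    rw [pre_succ, cnt_append, h, cnt_single]
    convert this using 1
    abel
  induction i with
  | zero => exact hlast 0 hw.2
  | succ i ih =>
    by_cases h : w (i + 1) = p + 1
    · exact hlast _ h
    · have h1 : w (i + 1) ≤ p := by have := hw.1.1 (i + 1); omega
      have := CC_add r n _ _ ih (eb_Cinf n h1 r)
      rw [pre_succ, cnt_append, cnt_single]
      convert this using 1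
      abel

lemma code_CC {p : ℕ} : ∀ (r : ℕ) (n : ℕ → ℕ) (l d : ℕ), d < Sseq (p + 2) n l →
    cnt (pre (Sseq (p + 2) n) l ++ [d]) ∈ CC p r n := by
  intro r
  induction r with
  | zero =>
    intro n l d hd
    have hg := Sseq_good p n
    apply cnt_supp
    intro a ha
    rcases List.mem_append.1 ha with h | h
    · exact pre_mem hg.1.1 a h
    · simp at h; have := hg.1.1 l; omega
  | succ r ih =>
    intro n l d hd
    have hg' := Sseq_good p (shift n)
    have hS := Sseq_lam p n
    generalize hw : Sseq (p + 2) n = w at *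
    have ih' := ih (shift n)
    generalize hw' : Sseq (p + 2) (shift n) = w' at *
    rcases lam_tail (n := n 0) hg'.1.1 l with ⟨i, h1, h2⟩ | h
    swap
    · rw [← hS] at h; omega
    rw [← hS] at h1 h2
    have hwl : w l = lamSub (p + 2) (n 0) (shift^[i] w') 0 := by
      have := congrFun h2 0
      rwa [shift_iter, add_zero] at this
    have hi := hg'.1.1 i
    rw [h1]
    rcases Nat.eq_zero_or_pos d with hd0 | hd0
    · subst hd0
      cases i with
      | zero =>
        simp only [pre_zero, List.flatMap_nil, List.nil_append]
        rw [cnt_single]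
        exact eb_Cinf n (Nat.zero_le p) _
      | succ i =>
        have h3 := CC_Am (n := n) (rep_CC hg' ih' i)
        rw [cnt_append, cnt_lam _ (pre_mem hg'.1.1), cnt_single]
        convert h3 using 1
        rw [Am_add]
        congr 1
        have : eb p - eb (p + 1) = eb p + (-1 : ℝ) • eb (p + 1) := by
          rw [neg_one_smul, sub_eq_add_neg]
        rw [this, Am_add, Am_smul, Am_eb_p, Am_eb_last, add_smul]
        simp only [neg_smul, one_smul]
        abel
    · have hd1 : d - 1 < w' i ∧ d - 1 < p := by
        rw [hwl, lam_unroll, shift_iter, add_zero] at hd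
        rcases digit_cases hi with h | h | h
        · rw [lamWord_lt h] at hd
          simp [app, scons] at hd; omega
        · rw [h, lamWord_p] at hd
          simp [app, scons] at hd; omega
        · rw [h, lamWord_last] at hd
          simp [app, scons] at hd; omega
      have h3 := CC_Am (n := n) (ih' i (d - 1) hd1.1)
      rw [← cnt_lam] at h3
      · rw [List.flatMap_append] at h3
        simp only [List.flatMap_cons, List.flatMap_nil, List.append_nil] at h3
        rw [lamWord_lt hd1.2, Nat.sub_add_cancel hd0] at h3
        exact h3
      · intro a ha
        rcases List.mem_append.1 ha with h | h
        · exact pre_mem hg'.1.1 a h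
        · simp at h; omega

lemma pre_CC {p r : ℕ} {n : ℕ → ℕ} : ∀ (m : ℕ) (v : Seq), v ∈ Xset (p + 2) (Sseq (p + 2) n) →
    cnt (pre v m) ∈ CC p r n ∨ cnt (pre v m) + (eb p - eb (p + 1)) ∈ CC p r n := by
  intro m
  induction m using Nat.strong_induction_on with
  | _ m ih =>
    intro v hv
    have hpre : (∀ s < m, v s = Sseq (p + 2) n s) →
        cnt (pre v m) ∈ CC p r n ∨ cnt (pre v m) + (eb p - eb (p + 1)) ∈ CC p r n := by
      intro h
      rw [pre_congr h]
      cases m with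
      | zero => left; rw [pre_zero, cnt_nil]; exact zero_CC
      | succ m => right; exact rep_CC (Sseq_good p n) (code_CC r n) m
    rcases hv.2 0 with ⟨l, h1, h2⟩ | h
    · simp only [Function.iterate_zero, id] at h1 h2
      by_cases hl : l < m
      · obtain ⟨b, rfl⟩ : ∃ b, m = l + 1 + b := ⟨m - l - 1, by omega⟩
        have h3 := code_CC r n l (v l) h2
        rw [← pre_congr h1, ← pre_succ] at h3
        have hv' : shift^[l + 1] v ∈ Xset (p + 2) (Sseq (p + 2) n) := by
          refine ⟨InSigma_shift hv.1 _, fun s => ?_⟩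
          rw [← Function.iterate_add_apply]
          exact hv.2 _
        rw [pre_add, cnt_append, add_assoc]
        rcases ih b (by omega) _ hv' with h4 | h4
        · left; exact CC_add r n _ _ h3 h4
        · right; exact CC_add r n _ _ h3 h4
      · exact hpre fun s hs => h1 s (by omega)
    · exact hpre fun s _ => congrFun h s

lemma DFn_sub {p : ℕ} {n : ℕ → ℕ} : DFn (p + 2) n ⊆ US p n := by
  rintro x ⟨hx, v, hv, hf⟩
  refine ⟨hx, fun r => ?_⟩
  rw [freq_iff hv.1] at hf
  have key : ∀ m, ∃ e : ℕ → ℝ, (∀ i, |e i| ≤ 1) ∧ cnt (pre v m) + e ∈ CC p r n := by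
    intro m
    rcases pre_CC (r := r) m v hv with h | h
    · exact ⟨0, by simp, by simpa using h⟩
    · refine ⟨_, fun i => ?_, h⟩
      simp only [Pi.sub_apply, eb]
      split_ifs <;> simp
  choose e he hC using key
  have hinv : Tendsto (fun m : ℕ => (m : ℝ)⁻¹) atTop (𝓝 0) := tendsto_inv_atTop_nhds_zero_nat
  have he0 : Tendsto (fun m : ℕ => (m : ℝ)⁻¹ • e m) atTop (𝓝 0) := by
    rw [tendsto_pi_nhds]
    intro i
    apply squeeze_zero_norm _ hinv
    intro m
    have hm : (0 : ℝ) ≤ (m : ℝ)⁻¹ := by positivity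
    rw [Pi.smul_apply, smul_eq_mul, Real.norm_eq_abs, abs_mul, abs_of_nonneg hm]
    exact mul_le_of_le_one_right hm (he m i)
  have hlim := hf.add he0
  rw [add_zero] at hlim
  apply (isClosed_CC p r n).mem_of_tendsto hlim
  filter_upwards with m
  rw [← smul_add]
  exact CC_smul (by positivity) r n _ (hC m)

/-! ### Frequencies under substitution -/

lemma continuous_Am (p n : ℕ) : Continuous (Am p n) := by
  apply continuous_pi
  intro i
  unfold Am
  split_ifs <;> fun_prop

lemma continuous_tot (p : ℕ) : Continuous (tot p) :=
  continuous_finsetSum _ fun i _ => continuous_apply i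

lemma subS_InSigma {p : ℕ} {τ : ℕ → List ℕ} (hτ : ∀ a, τ a ≠ [])
    (hdig : ∀ a < p + 2, ∀ b ∈ τ a, b < p + 2) {v : Seq} (hv : InSigma (p + 2) v) :
    InSigma (p + 2) (subS τ v) := by
  intro l
  obtain ⟨i, j, hj, h1, h2⟩ := subS_block hτ v l
  have h3 := congrFun h2 0
  rw [shift_iter, add_zero, List.drop_eq_getElem_cons hj] at h3
  rw [h3]
  exact hdig _ (hv i) _ (List.getElem_mem hj)

lemma length_flatMap_le {p N : ℕ} {τ : ℕ → List ℕ} (hlen : ∀ a < p + 2, (τ a).length ≤ N)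
    (x : List ℕ) (hx : ∀ a ∈ x, a < p + 2) : (x.flatMap τ).length ≤ N * x.length := by
  induction x with
  | nil => simp
  | cons a t ih =>
    have h1 := ih fun b hb => hx b (List.mem_cons_of_mem _ hb)
    have h2 := hlen a (hx a List.mem_cons_self)
    simp only [List.flatMap_cons, List.length_append, List.length_cons]
    nlinarith

lemma freq_sub {p N : ℕ} {τ : ℕ → List ℕ} {A : (ℕ → ℝ) → (ℕ → ℝ)} (hτ : ∀ a, τ a ≠ [])
    (hlen : ∀ a < p + 2, (τ a).length ≤ N) (hdig : ∀ a < p + 2, ∀ b ∈ τ a, b < p + 2)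
    (hA0 : A 0 = 0) (hA : ∀ y z, A (y + z) = A y + A z) (hsm : ∀ (c : ℝ) y, A (c • y) = c • A y)
    (hcont : Continuous A) (hτA : ∀ a < p + 2, cnt (τ a) = A (eb a))
    {v : Seq} (hv : InSigma (p + 2) v) {y : ℕ → ℝ} (hf : Freq v y) (hpos : 0 < tot p (A y)) :
    Freq (subS τ v) ((tot p (A y))⁻¹ • A y) := by
  have hu := subS_InSigma hτ hdig hv
  choose i j hj h1 h2 using subS_block hτ v
  have hcnt : ∀ m, cnt (pre (subS τ v) m) = A (cnt (pre v (i m))) + cnt ((τ (v (i m))).take (j m)) := by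
    intro m
    rw [h1, cnt_append, cnt_flatMap hA0 hA hτA _ (pre_mem hv)]
  have hjN : ∀ m, ((τ (v (i m))).take (j m)).length ≤ N := by
    intro m
    exact (List.length_take_le' _ _).trans (hlen _ (hv _))
  have hm : ∀ m, m ≤ N * i m + N := by
    intro m
    have h3 := congrArg List.length (h1 m)
    rw [pre_length, List.length_append] at h3
    have h4 := length_flatMap_le hlen (pre v (i m)) (pre_mem hv)
    rw [pre_length] at h4
    have := hjN m
    omega
  have hi : Tendsto i atTop atTop := by
    rw [tendsto_atTop]
    intro b
    filter_upwards [eventually_ge_atTop (N * b + N + 1)] with m hmb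
    by_contra hc
    push Not at hc
    have h3 : N * i m ≤ N * b := Nat.mul_le_mul_left _ hc.le
    have := hm m
    omega
  have hinv : Tendsto (fun m : ℕ => ((i m : ℕ) : ℝ)⁻¹) atTop (𝓝 0) :=
    tendsto_inv_atTop_nhds_zero_nat.comp hi
  have hg1 : Tendsto (fun m : ℕ => A (((i m : ℕ) : ℝ)⁻¹ • cnt (pre v (i m)))) atTop (𝓝 (A y)) :=
    (hcont.tendsto y).comp (hf.comp hi)
  have hg2 : Tendsto (fun m : ℕ => ((i m : ℕ) : ℝ)⁻¹ • cnt ((τ (v (i m))).take (j m))) atTop (𝓝 0) := by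
    rw [tendsto_pi_nhds]
    intro a
    have hz : Tendsto (fun m : ℕ => ((i m : ℕ) : ℝ)⁻¹ * N) atTop (𝓝 0) := by
      simpa using hinv.mul_const (N : ℝ)
    apply squeeze_zero _ _ hz
    · intro m
      exact mul_nonneg (by positivity) (cnt_nonneg _ _)
    · intro m
      apply mul_le_mul_of_nonneg_left _ (by positivity)
      exact (cnt_le_length _ _).trans (by exact_mod_cast hjN m)
  have hg : Tendsto (fun m : ℕ => ((i m : ℕ) : ℝ)⁻¹ • cnt (pre (subS τ v) m)) atTop (𝓝 (A y)) := by
    have := hg1.add hg2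
    rw [add_zero] at this
    refine this.congr fun m => ?_
    rw [hcnt, smul_add, hsm]
  have ht : Tendsto (fun m : ℕ => (tot p (((i m : ℕ) : ℝ)⁻¹ • cnt (pre (subS τ v) m)))⁻¹) atTop
      (𝓝 (tot p (A y))⁻¹) :=
    (((continuous_tot p).tendsto _).comp hg).inv₀ hpos.ne'
  have hfin := ht.smul hg
  unfold Freq
  refine hfin.congr' ?_
  filter_upwards [hi.eventually_ge_atTop 1] with m him
  have h0 : ((i m : ℕ) : ℝ) ≠ 0 := by
    have : i m ≠ 0 := by omega
    exact_mod_cast this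
  rw [tot_smul, tot_cnt_pre hu, smul_smul, mul_inv, inv_inv, mul_comm ((i m : ℕ) : ℝ), mul_assoc,
    mul_inv_cancel₀ h0, mul_one]

lemma lamWord_len {p n a : ℕ} (h : a < p + 2) : (lamWord (p + 2) n a).length ≤ n + 2 := by
  obtain ⟨c, m, h1, _, _, h2⟩ := lamWord_form (n := n) h
  rw [h1]; simp; omega

lemma Kinv_DFn {p : ℕ} {n : ℕ → ℕ} {x : E (p + 2)} (hx : x ∈ DFn (p + 2) (shift n)) :
    Kinv (n 0) x ∈ DFn (p + 2) n := by
  obtain ⟨hs, v, hv, hf⟩ := hx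
  refine ⟨Kinv_simplex hs, lamSub (p + 2) (n 0) v, ?_, ?_⟩
  · rw [Sseq_lam]
    exact lam_Xset (Sseq_good p _).1.1 (Sseq_good p _).2 hv
  · rw [freq_iff hv.1] at hf
    rw [freq_iff (lam_InSigma hv.1)]
    have hK := mem_simplex.1 (Kinv_simplex (n := n 0) hs)
    obtain ⟨c, hc, hp⟩ := Kinv_prop (n := n 0) hs
    have ht : c * tot p (Am p (n 0) (proj x)) = 1 := by rw [← tot_smul, ← hp]; exact hK.2
    have hpos : 0 < tot p (Am p (n 0) (proj x)) := by
      by_contra hcon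
      push Not at hcon
      nlinarith
    have := freq_sub (lamWord_ne p (n 0)) (fun a ha => lamWord_len ha) (fun a ha b hb => by
      obtain ⟨c, m, h1, _, h3, _⟩ := lamWord_form (n := n 0) ha
      rw [h1] at hb
      rcases List.mem_cons.1 hb with h | h
      · omega
      · rw [List.eq_of_mem_replicate h]; omega) (Am_zero p _) (Am_add p _) (Am_smul p _)
      (continuous_Am p _) (fun a ha => cnt_lamWord ha) hv.1 hf hpos
    rw [lamSub_eq, hp]
    rwa [show c = (tot p (Am p (n 0) (proj x)))⁻¹ from eq_inv_of_mul_eq_one_left ht]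

/-! ### Greedy sequences -/

noncomputable def gpick (p : ℕ) (y : ℕ → ℝ) : ℕ :=
  if h : ∃ i, i < p + 2 ∧ 0 < y i then Classical.choose h else 0

noncomputable def gst (p : ℕ) (γ : ℕ → ℝ) : ℕ → ℕ → ℝ
  | 0 => 0
  | r + 1 => gst p γ r + γ - eb (gpick p (gst p γ r + γ))

noncomputable def gseq (p : ℕ) (γ : ℕ → ℝ) : Seq := fun r => gpick p (gst p γ r + γ)

lemma gpick_lt (p : ℕ) (y : ℕ → ℝ) : gpick p y < p + 2 := by
  unfold gpick
  split_ifs with h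
  · exact (Classical.choose_spec h).1
  · omega

lemma gpick_pos {p : ℕ} {y : ℕ → ℝ} (h : tot p y = 1) : 0 < y (gpick p y) := by
  have hex : ∃ i, i < p + 2 ∧ 0 < y i := by
    by_contra hc
    push Not at hc
    have : tot p y ≤ 0 := Finset.sum_nonpos fun i hi => hc i (Finset.mem_range.1 hi)
    linarith
  unfold gpick
  rw [dif_pos hex]
  exact (Classical.choose_spec hex).2

lemma gst_inv {p : ℕ} {γ : ℕ → ℝ} (hγ : γ ∈ Orth p) (h1 : tot p γ = 1) (r : ℕ) :
    tot p (gst p γ r) = 0 ∧ (∀ i, -1 ≤ gst p γ r i) ∧ (∀ i, p + 2 ≤ i → gst p γ r i = 0) ∧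
      gst p γ r = (r : ℝ) • γ - cnt (pre (gseq p γ) r) := by
  induction r with
  | zero =>
    refine ⟨by simp [gst, tot], by simp [gst], by simp [gst], by simp [gst, pre, cnt_nil]⟩
  | succ r ih =>
    obtain ⟨a1, a2, a3, a4⟩ := ih
    have ht : tot p (gst p γ r + γ) = 1 := by rw [tot_add, a1, h1, zero_add]
    have hp := gpick_pos ht
    have hl := gpick_lt p (gst p γ r + γ)
    have hsub : ∀ y z : ℕ → ℝ, y - z = y + (-1 : ℝ) • z := fun y z => by
      rw [neg_one_smul, sub_eq_add_neg]
    refine ⟨?_, ?_, ?_, ?_⟩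
    · show tot p (gst p γ r + γ - eb _) = 0
      rw [hsub, tot_add, ht, tot_smul, tot_eb hl]; ring
    · intro i
      show -1 ≤ (gst p γ r + γ) i - eb _ i
      unfold eb
      split_ifs with h
      · rw [h]; linarith
      · have := a2 i; have := hγ.1 i; rw [Pi.add_apply]; linarith
    · intro i hi
      show (gst p γ r + γ) i - eb _ i = 0
      unfold eb
      rw [if_neg (by omega), Pi.add_apply, a3 i hi, hγ.2 i hi]; ring
    · show gst p γ r + γ - eb (gseq p γ r) = _
      rw [pre_succ, cnt_append, cnt_single, a4]
      push_cast
      rw [add_smul, one_smul]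
      abel

lemma gseq_freq {p : ℕ} {γ : ℕ → ℝ} (hγ : γ ∈ Orth p) (h1 : tot p γ = 1) :
    InSigma (p + 2) (gseq p γ) ∧ Freq (gseq p γ) γ := by
  refine ⟨fun r => gpick_lt _ _, ?_⟩
  have hb : ∀ r i, |gst p γ r i| ≤ p + 2 := by
    intro r i
    obtain ⟨a1, a2, a3, a4⟩ := gst_inv hγ h1 r
    by_cases hi : i < p + 2
    · have h2 : tot p (gst p γ r) + (p + 2) = ∑ j ∈ Finset.range (p + 2), (gst p γ r j + 1) := by
        rw [Finset.sum_add_distrib]; simp [tot]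
      have h3 : gst p γ r i + 1 ≤ ∑ j ∈ Finset.range (p + 2), (gst p γ r j + 1) :=
        Finset.single_le_sum (f := fun j => gst p γ r j + 1)
          (fun j _ => by have := a2 j; linarith) (Finset.mem_range.2 hi)
      have := a2 i
      rw [abs_le]
      constructor <;> linarith
    · rw [a3 i (by omega)]; simp; positivity
  unfold Freq
  rw [tendsto_pi_nhds]
  intro i
  have hz : Tendsto (fun r : ℕ => (r : ℝ)⁻¹ * gst p γ r i) atTop (𝓝 0) := by
    have hz' : Tendsto (fun r : ℕ => (r : ℝ)⁻¹ * ((p : ℝ) + 2)) atTop (𝓝 0) := by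
      simpa using tendsto_inv_atTop_nhds_zero_nat.mul_const ((p : ℝ) + 2)
    apply squeeze_zero_norm _ hz'
    intro r
    have hr : (0 : ℝ) ≤ (r : ℝ)⁻¹ := by positivity
    rw [Real.norm_eq_abs, abs_mul, abs_of_nonneg hr]
    exact mul_le_mul_of_nonneg_left (hb r i) hr
  have : Tendsto (fun r : ℕ => γ i - (r : ℝ)⁻¹ * gst p γ r i) atTop (𝓝 (γ i)) := by
    simpa using hz.const_sub (γ i)
  refine this.congr' ?_
  filter_upwards [eventually_ge_atTop 1] with r hr
  have h0 : (r : ℝ) ≠ 0 := by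
    have : r ≠ 0 := by omega
    exact_mod_cast this
  rw [(gst_inv hγ h1 r).2.2.2]
  simp only [Pi.sub_apply, Pi.smul_apply, smul_eq_mul]
  field_simp
  ring

/-! ### The simplex T -/

def tauT (p m a : ℕ) : List ℕ := if a = p + 1 then (p + 1) :: List.replicate (m + 1) 0 else [a]

def AT (p m : ℕ) (y : ℕ → ℝ) : ℕ → ℝ := y + (((m : ℝ) + 1) * y (p + 1)) • eb 0

lemma tauT_ne (p m a : ℕ) : tauT p m a ≠ [] := by unfold tauT; split_ifs <;> simp

lemma AT_add (p m : ℕ) (y z : ℕ → ℝ) : AT p m (y + z) = AT p m y + AT p m z := by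
  funext i; simp [AT]; ring

lemma AT_smul (p m : ℕ) (c : ℝ) (y : ℕ → ℝ) : AT p m (c • y) = c • AT p m y := by
  funext i; simp [AT]; ring

lemma tauT_cnt (p m a : ℕ) : cnt (tauT p m a) = AT p m (eb a) := by
  unfold tauT AT
  split_ifs with h
  · subst h
    rw [cnt_cons, cnt_replicate]; simp [eb]
  · have : p + 1 ≠ a := fun h' => h h'.symm
    rw [cnt_single]; simp [eb, this]

lemma tauT_Xset {p m : ℕ} {u w : Seq} (hu : InSigma (p + 2) u) (hw : Good p w)
    : subS (tauT p m) u ∈ Xset (p + 2) (lamSub (p + 2) m w) := by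
  have htop := lam_head_top (n := m) hw.2
  refine ⟨subS_InSigma (tauT_ne p m) ?_ hu, fun l => Or.inl ?_⟩
  · intro a ha b hb
    unfold tauT at hb
    split_ifs at hb with h
    · rcases List.mem_cons.1 hb with h | h
      · omega
      · rw [List.eq_of_mem_replicate h]; omega
    · simp at hb; omega
  · obtain ⟨i, j, hj, -, h2⟩ := subS_block (tauT_ne p m) u l
    rw [h2]
    unfold tauT at hj ⊢
    split_ifs at hj ⊢ with h
    · cases j with
      | zero =>
        rw [lam_unroll, hw.2, lamWord_last, List.drop_zero]
        exact seqLt_scons (app_replicate_head (lam_head (InSigma_shift hw.1.1 1)))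
      | succ j =>
        apply seqLt_of_lt
        rw [htop, List.drop_eq_getElem_cons hj]
        simp [app, scons]
    · have hj0 : j = 0 := by simpa using hj
      subst hj0
      apply seqLt_of_lt
      have := hu i
      rw [htop]
      simp [app, scons]; omega

lemma T_DFn {p : ℕ} {n : ℕ → ℕ} {x : E (p + 2)} (hx : x ∈ simplex (p + 2))
    (hT : InT p (n 0) (proj x)) : x ∈ DFn (p + 2) n := by
  obtain ⟨hO, h1⟩ := mem_simplex.1 hx
  generalize hX : proj x = X at *
  unfold InT at hT
  set γ0 : ℕ → ℝ := X - (((n 0 : ℕ) : ℝ) + 1) • X (p + 1) • eb 0 with hγ0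
  have hO0 : γ0 ∈ Orth p := by
    constructor
    · intro i
      simp only [hγ0, Pi.sub_apply, Pi.smul_apply, smul_eq_mul, eb]
      split_ifs with h
      · subst h; linarith
      · have := hO.1 i; linarith
    · intro i hi
      have h0 : i ≠ 0 := by omega
      simp [hγ0, eb, h0, hO.2 i hi]
  have hlast : γ0 (p + 1) = X (p + 1) := by simp [hγ0, eb]
  have hAT : AT p (n 0) γ0 = X := by
    unfold AT
    rw [hlast, hγ0, smul_smul]; abel
  have hpos : 0 < tot p γ0 := by
    rcases (tot_nonneg hO0).lt_or_eq with h | h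
    · exact h
    · exfalso
      have h0 := eq_zero_of_tot hO0 h.symm
      rw [h0] at hAT
      have : X = 0 := by rw [← hAT]; simp [AT]
      rw [this] at h1
      simp [tot] at h1
  have hg := gseq_freq (γ := (tot p γ0)⁻¹ • γ0) (Orth_smul (by positivity) hO0)
    (by rw [tot_smul, inv_mul_cancel₀ hpos.ne'])
  have hXs := tauT_Xset (m := n 0) hg.1 (Sseq_good p (shift n))
  rw [← Sseq_lam] at hXs
  refine ⟨hx, _, hXs, ?_⟩
  rw [freq_iff hXs.1, hX]
  have hAγ : AT p (n 0) ((tot p γ0)⁻¹ • γ0) = (tot p γ0)⁻¹ • X := by rw [AT_smul, hAT]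
  have := freq_sub (p := p) (N := n 0 + 2) (tauT_ne p (n 0)) (fun a ha => by
      unfold tauT; split_ifs <;> simp) (fun a ha b hb => by
      unfold tauT at hb
      split_ifs at hb with h
      · rcases List.mem_cons.1 hb with h | h
        · omega
        · rw [List.eq_of_mem_replicate h]; omega
      · simp at hb; omega) (A := AT p (n 0)) (by simp [AT]) (AT_add p _) (AT_smul p _)
      (by unfold AT; fun_prop) (fun a _ => tauT_cnt p _ a) hg.1 hg.2
      (by rw [hAγ, tot_smul, h1, mul_one]; positivity)
  rw [hAγ, tot_smul, h1, mul_one, inv_inv, smul_smul, mul_inv_cancel₀ hpos.ne', one_smul] at this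
  exact this

/-! ### The frequency of S(n) -/

lemma Am_close {p n : ℕ} {a b : ℕ → ℝ} {L : ℝ} (hL : ∀ i, |a i - b i| ≤ L) (i : ℕ) :
    |Am p n a i - Am p n b i| ≤ (2 * n + 2) * L := by
  have hL0 : 0 ≤ L := (abs_nonneg _).trans (hL 0)
  have hn : (0 : ℝ) ≤ n := by positivity
  have hp := abs_le.1 (hL p)
  have hp1 := abs_le.1 (hL (p + 1))
  have hi := abs_le.1 (hL (i - 1))
  have hnL := mul_nonneg hn hL0
  have q1 := mul_le_mul_of_nonneg_left hp.1 hn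
  have q2 := mul_le_mul_of_nonneg_left hp.2 hn
  have q3 := mul_le_mul_of_nonneg_left hp1.1 hn
  have q4 := mul_le_mul_of_nonneg_left hp1.2 hn
  unfold Am
  rw [abs_le]
  split_ifs
  · constructor <;> nlinarith
  · constructor <;> nlinarith
  · constructor <;> nlinarith
  · constructor <;> nlinarith

lemma S_approx {p : ℕ} : ∀ (r : ℕ) (n : ℕ → ℕ), ∃ L : ℝ, ∀ m, ∃ y ∈ DD p r n, ∀ i,
    |cnt (pre (Sseq (p + 2) n) m) i - y i| ≤ L := by
  intro r
  induction r with
  | zero =>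
    intro n
    exact ⟨0, fun m => ⟨_, cnt_pre_Orth (Sseq_good p n).1.1 m, fun i => by simp⟩⟩
  | succ r ih =>
    intro n
    obtain ⟨L, hL⟩ := ih (shift n)
    have hg := Sseq_good p (shift n)
    refine ⟨(2 * (n 0 : ℕ) + 2) * L + ((n 0 : ℕ) + 2), fun m => ?_⟩
    obtain ⟨i, j, hj, h1, -⟩ := subS_block (lamWord_ne p (n 0)) (Sseq (p + 2) (shift n)) m
    obtain ⟨y, hy, hyL⟩ := hL i
    refine ⟨Am p (n 0) y, DD_Am hy, fun a => ?_⟩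
    rw [Sseq_lam p n, lamSub_eq, h1, cnt_append, cnt_lam _ (pre_mem hg.1.1)]
    have h2 := Am_close (p := p) (n := n 0) hyL a
    have h3 := cnt_nonneg ((lamWord (p + 2) (n 0) (Sseq (p + 2) (shift n) i)).take j) a
    have h4 := cnt_le_length ((lamWord (p + 2) (n 0) (Sseq (p + 2) (shift n) i)).take j) a
    have h5 : (((lamWord (p + 2) (n 0) (Sseq (p + 2) (shift n) i)).take j).length : ℝ) ≤ (n 0 : ℕ) + 2 := by
      exact_mod_cast (List.length_take_le' _ _).trans (lamWord_len (hg.1.1 i))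
    rw [Pi.add_apply]
    rw [abs_le] at h2 ⊢
    constructor <;> linarith

lemma abs_proj_le {k : ℕ} (x y : E k) (i : ℕ) : |proj x i - proj y i| ≤ dist x y := by
  unfold proj
  split_ifs with h
  · have := PiLp.norm_apply_le (x - y) (⟨i, h⟩ : Fin k)
    rw [dist_eq_norm]
    simpa using this
  · simp

lemma S_freq {p : ℕ} {n : ℕ → ℕ} {α : E (p + 2)} (hreg : PhiFiber (p + 2) n = {α}) :
    Freq (Sseq (p + 2) n) (proj α) := by
  unfold Freq
  rw [tendsto_pi_nhds]
  intro i
  rw [Metric.tendsto_atTop]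
  intro ε hε
  obtain ⟨r, hr⟩ := DD_shrink hreg (half_pos hε)
  obtain ⟨L, hL⟩ := S_approx (p := p) r n
  have hL0 : 0 ≤ L := by
    obtain ⟨y, _, h⟩ := hL 0
    exact (abs_nonneg _).trans (h 0)
  obtain ⟨M, hM⟩ := exists_nat_gt ((p + 3) * L / (ε / 2) + (p + 2) * L + 1)
  refine ⟨M, fun m hm => ?_⟩
  have hmM : (M : ℝ) ≤ m := by exact_mod_cast hm
  obtain ⟨y, hy, hyL⟩ := hL m
  have hg := Sseq_good p n
  have ht1 : |(m : ℝ) - tot p y| ≤ (p + 2) * L := by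
    rw [← tot_cnt_pre hg.1.1 m]
    unfold tot
    rw [← Finset.sum_sub_distrib]
    refine (Finset.abs_sum_le_sum_abs _ _).trans ?_
    refine (Finset.sum_le_sum fun j _ => hyL j).trans ?_
    simp
  have hq : 0 ≤ (p + 3) * L / (ε / 2) := by positivity
  have hq2 : 0 ≤ ((p : ℝ) + 2) * L := by positivity
  have hm0 : (0 : ℝ) < m := by linarith
  have ht0 : 0 < tot p y := by
    have := (abs_le.1 ht1).2
    linarith
  have hmε : (p + 3) * L / m < ε / 2 := by
    rw [div_lt_iff₀ hm0, mul_comm (ε / 2)]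
    rw [← div_lt_iff₀ (half_pos hε)]
    linarith
  have hO := DD_Orth hy
  have hpz : proj (ofv (p + 2) ((tot p y)⁻¹ • y)) = (tot p y)⁻¹ • y :=
    proj_ofv (Orth_smul (by positivity) hO).2
  have hz : ofv (p + 2) ((tot p y)⁻¹ • y) ∈ simplex (p + 2) := by
    rw [mem_simplex, hpz]
    exact ⟨Orth_smul (by positivity) hO, by rw [tot_smul, inv_mul_cancel₀ ht0.ne']⟩
  have hd := hr r le_rfl _ hz (by rw [hpz]; exact DD_smul (by positivity) r n _ hy)
  have hd' := (abs_proj_le _ α i).trans_lt hd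
  rw [hpz, Pi.smul_apply, smul_eq_mul] at hd'
  have hq3 : |(tot p y)⁻¹ * y i| ≤ 1 := by
    have h0 := hO.1 i
    rw [abs_of_nonneg (by positivity), inv_mul_le_iff₀ ht0, mul_one]
    exact le_tot hO i
  have key : (m : ℝ)⁻¹ * cnt (pre (Sseq (p + 2) n) m) i - (tot p y)⁻¹ * y i =
      (m : ℝ)⁻¹ * ((cnt (pre (Sseq (p + 2) n) m) i - y i) - ((tot p y)⁻¹ * y i) * ((m : ℝ) - tot p y)) := by
    field_simp
    ring
  have hb : |(m : ℝ)⁻¹ * cnt (pre (Sseq (p + 2) n) m) i - (tot p y)⁻¹ * y i| ≤ (p + 3) * L / m := by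
    rw [key, abs_mul, abs_of_pos (inv_pos.2 hm0), inv_mul_eq_div]
    apply div_le_div_of_nonneg_right _ hm0.le
    refine (abs_sub _ _).trans ?_
    rw [abs_mul]
    have h1 := mul_le_mul hq3 ht1 (abs_nonneg _) zero_le_one
    have := hyL i
    linarith
  rw [Real.dist_eq, Pi.smul_apply, smul_eq_mul]
  calc _ ≤ _ + _ := abs_sub_le _ ((tot p y)⁻¹ * y i) _
    _ < ε := by linarith

/-! ### `US ⊆ DF(n)` -/

lemma CC_cases {p : ℕ} : ∀ (r : ℕ) (n : ℕ → ℕ) (x : E (p + 2)), x ∈ simplex (p + 2) →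
    proj x ∈ CC p r n → x ∈ DFn (p + 2) n ∨ proj x ∈ DD p r n := by
  intro r
  induction r with
  | zero => intro n x _ h; exact Or.inr h
  | succ r ih =>
    rintro n x hx ⟨hO, hT | hC⟩
    · exact Or.inl (T_DFn hx hT)
    · have hBO := CC_Orth hC
      have hx1 := (mem_simplex.1 hx).2
      have hne : proj x ≠ 0 := by
        intro h; rw [h] at hx1; simp [tot] at hx1
      have hB0 := Bm_ne_zero (m := n 0) hO hne
      have ht : 0 < tot p (Bm p (n 0) (proj x)) :=
        (tot_nonneg hBO).lt_of_ne fun h => hB0 (eq_zero_of_tot hBO h.symm)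
      set z : E (p + 2) := ofv (p + 2) ((tot p (Bm p (n 0) (proj x)))⁻¹ • Bm p (n 0) (proj x)) with hz
      have hpz : proj z = (tot p (Bm p (n 0) (proj x)))⁻¹ • Bm p (n 0) (proj x) :=
        proj_ofv (Orth_smul (by positivity) hBO).2
      have hzs : z ∈ simplex (p + 2) := by
        rw [mem_simplex, hpz]
        exact ⟨Orth_smul (by positivity) hBO, by rw [tot_smul, inv_mul_cancel₀ ht.ne']⟩
      rcases ih (shift n) z hzs (by rw [hpz]; exact CC_smul (by positivity) r _ _ hC) with h | h
      · left
        have h1 := Kinv_DFn h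
        obtain ⟨c, hc, hp⟩ := Kinv_prop (n := n 0) hzs
        rw [hpz, Am_smul, Am_Bm hO.2, smul_smul] at hp
        rwa [eq_of_prop (Kinv_simplex hzs) hx hp] at h1
      · right
        refine ⟨hO, ?_⟩
        have := DD_smul ht.le r _ _ h
        rwa [hpz, smul_smul, mul_inv_cancel₀ ht.ne', one_smul] at this

lemma DFn_eq {p : ℕ} {n : ℕ → ℕ} {α : E (p + 2)} (hreg : PhiFiber (p + 2) n = {α}) :
    DFn (p + 2) n = US p n := by
  apply Set.Subset.antisymm DFn_sub
  rintro x ⟨hx, hC⟩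
  by_contra hn
  have hD : ∀ r, proj x ∈ DD p r n := fun r => (CC_cases r n x hx (hC r)).resolve_left hn
  have hf := fiber_of_Dinf hx hD
  rw [hreg, Set.mem_singleton_iff] at hf
  subst hf
  have hg := Sseq_good p n
  exact hn ⟨hx, _, hg.1, (freq_iff hg.1.1 x).2 (S_freq hreg)⟩

/-- if `n` is regular with `Φ^{-1}(n) = {α}` then `E(n) = FE(n) ∪ {α}`,
and `α` is an accumulation point of `E(n)` whenever `E(n)` is infinite. -/
theorem stmt8 (k : ℕ) (hk : 2 ≤ k) (n : ℕ → ℕ) (α : E k)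
    (hreg : PhiFiber k n = {α}) :
    Eset k n = FEset k n ∪ {α} ∧
    ((Eset k n).Infinite → α ∈ closure (Eset k n \ {α})) := by
  obtain ⟨p, rfl⟩ : ∃ p, k = p + 2 := ⟨k - 2, by omega⟩
  exact final hreg (DFn_eq hreg)

end BetaDF
end

section
/- Let k ≥ 3 be an integer, and extend DF to [k−1, k] by setting DF(k−1) = F and DF(k) = Δ. Then the map DF : [k−1, k] → C(Δ) is increasing (β ≤ γ implies DF(β) ⊆ DF(γ)) and continuous with respect to the Hausdorff metric on the space C(Δ) of nonempty compact subsets of Δ. -/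
open Filter Topology
open scoped Classical

namespace BetaDF

/-! ### Auxiliary material for the proof -/

/-- Finite `β`-value of `m` digits of `v` starting at index `r`. -/
noncomputable def fval (β : ℝ) (v : Seq) : ℕ → ℕ → ℝ
  | 0, _ => 0
  | m + 1, r => ((v r : ℝ) + fval β v m (r + 1)) / β

/-- Infinite `β`-value of `v` starting at index `r`. -/
noncomputable def ival (β : ℝ) (v : Seq) (r : ℕ) : ℝ :=
  ∑' s, (v (r + s) : ℝ) * (1 / β) ^ (s + 1)

lemma digit_le {k : ℕ} {v : Seq} (hv : InSigma k v) (r : ℕ) : (v r : ℝ) ≤ (k : ℝ) - 1 := by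
  have h := hv r
  have : ((v r + 1 : ℕ) : ℝ) ≤ (k : ℝ) := by exact_mod_cast h
  push_cast at this
  linarith

lemma summable_geo {β : ℝ} (hβ : 2 ≤ β) (C : ℝ) :
    Summable fun s : ℕ => C * (1 / β) ^ (s + 1) := by
  have h1 : (1 / β) < 1 := by rw [div_lt_one (by linarith)]; linarith
  have h0 : 0 ≤ 1 / β := by positivity
  have := ((summable_geometric_of_lt_one h0 h1).mul_right (1 / β)).mul_left C
  simpa [pow_succ] using this

lemma ival_summable {k : ℕ} {v : Seq} (hv : InSigma k v) {β : ℝ} (hβ : 2 ≤ β) (r : ℕ) :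
    Summable fun s => (v (r + s) : ℝ) * (1 / β) ^ (s + 1) := by
  refine Summable.of_nonneg_of_le (fun s => by positivity) (fun s => ?_)
    (summable_geo hβ ((k : ℝ) - 1))
  exact mul_le_mul_of_nonneg_right (digit_le hv _) (by positivity)

lemma ival_nonneg {v : Seq} {β : ℝ} (hβ : 2 ≤ β) (r : ℕ) : 0 ≤ ival β v r :=
  tsum_nonneg fun s => by positivity

lemma ival_rec {k : ℕ} {v : Seq} (hv : InSigma k v) {β : ℝ} (hβ : 2 ≤ β) (r : ℕ) :
    β * ival β v r = v r + ival β v (r + 1) := by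
  have hb : β ≠ 0 := by linarith
  have h := (ival_summable hv hβ r).tsum_eq_zero_add
  unfold ival
  rw [h, mul_add, ← tsum_mul_left]
  congr 1
  · simp; field_simp
  · refine tsum_congr fun s => ?_
    rw [show r + (s + 1) = r + 1 + s by ring, pow_succ _ (s + 1)]
    field_simp

lemma ival_le {k : ℕ} {v : Seq} (hv : InSigma k v) {β : ℝ} (hβ : 2 ≤ β) (r : ℕ) :
    (β - 1) * ival β v r ≤ (k : ℝ) - 1 := by
  have h1 : (1 / β) < 1 := by rw [div_lt_one (by linarith)]; linarith
  have h0 : 0 ≤ 1 / β := by positivity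
  have hle : ival β v r ≤ ∑' s : ℕ, ((k : ℝ) - 1) * (1 / β) ^ (s + 1) := by
    refine (ival_summable hv hβ r).tsum_le_tsum (fun s => ?_) (summable_geo hβ _)
    exact mul_le_mul_of_nonneg_right (digit_le hv _) (by positivity)
  have he : ∑' s : ℕ, ((k : ℝ) - 1) * (1 / β) ^ (s + 1) = ((k : ℝ) - 1) / (β - 1) := by
    simp_rw [pow_succ]
    rw [tsum_mul_left, tsum_mul_right, tsum_geometric_of_lt_one h0 h1]
    have : β - 1 ≠ 0 := by linarith
    have : β ≠ 0 := by linarith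
    field_simp
  rw [he, le_div_iff₀ (by linarith)] at hle
  linarith

/-- value after a zero digit -/
lemma ival_zero_le {k : ℕ} (hk : 3 ≤ k) {v : Seq} (hv : InSigma k v) {β : ℝ}
    (hβ : (k : ℝ) - 1 ≤ β) (r : ℕ) (h0 : v r = 0) : ival β v r ≤ 1 := by
  have hk' : (3 : ℝ) ≤ k := by exact_mod_cast hk
  have h2 : 2 ≤ β := by linarith
  have h := ival_rec hv h2 r
  have h' := ival_le hv h2 (r + 1)
  rw [h0] at h
  push_cast at h
  by_contra hc
  push Not at hc
  have : ival β v (r + 1) > β := by nlinarith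
  nlinarith

lemma ival_zero_lt {k : ℕ} (hk : 3 ≤ k) {v : Seq} (hv : InSigma k v) {β : ℝ}
    (hβ : (k : ℝ) - 1 < β) (r : ℕ) (h0 : v r = 0) : ival β v r < 1 := by
  have hk' : (3 : ℝ) ≤ k := by exact_mod_cast hk
  have h2 : 2 ≤ β := by linarith
  have h := ival_rec hv h2 r
  have h' := ival_le hv h2 (r + 1)
  rw [h0] at h
  push_cast at h
  by_contra hc
  push Not at hc
  have : ival β v (r + 1) ≥ β := by nlinarith
  nlinarith

lemma ival_zero_zero {k : ℕ} (hk : 3 ≤ k) {v : Seq} (hv : InSigma k v) {β : ℝ}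
    (hβ : (k : ℝ) - 1 ≤ β) (r : ℕ) (h0 : v r = 0) (h1 : v (r + 1) = 0) :
    ival β v r ≤ 1 / 2 := by
  have hk' : (3 : ℝ) ≤ k := by exact_mod_cast hk
  have h2 : 2 ≤ β := by linarith
  have h := ival_rec hv h2 r
  have h' := ival_zero_le hk hv hβ (r + 1) h1
  rw [h0] at h
  push_cast at h
  have := ival_nonneg (v := v) h2 r
  nlinarith

lemma ival_eq_fval {k : ℕ} {v : Seq} (hv : InSigma k v) {β : ℝ} (hβ : 2 ≤ β) (m : ℕ) :
    ∀ r, ival β v r = fval β v m r + (1 / β) ^ m * ival β v (r + m) := by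
  induction m with
  | zero => intro r; simp [fval]
  | succ m ih =>
    intro r
    have hb : β ≠ 0 := by linarith
    have h := ival_rec hv hβ r
    rw [ih (r + 1)] at h
    have : ival β v r = (v r + (fval β v m (r + 1) + (1 / β) ^ m * ival β v (r + 1 + m))) / β := by
      field_simp; linarith
    rw [this, fval, show r + 1 + m = r + (m + 1) by ring, pow_succ]
    field_simp
    ring

lemma ival_le_of_fval {k : ℕ} {v : Seq} (hv : InSigma k v) {β : ℝ} (hβ : 2 ≤ β)
    (r : ℕ) (h : ∀ m, fval β v m r ≤ 1) : ival β v r ≤ 1 := by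
  have h1 : (1 / β) < 1 := by rw [div_lt_one (by linarith)]; linarith
  have h0 : 0 ≤ 1 / β := by positivity
  have ht : Tendsto (fun m : ℕ => 1 + (1 / β) ^ m * ((k : ℝ) - 1)) atTop (𝓝 (1 + 0 * ((k : ℝ) - 1))) :=
    ((tendsto_pow_atTop_nhds_zero_of_lt_one h0 h1).mul_const _).const_add 1
  simp only [zero_mul, add_zero] at ht
  refine ge_of_tendsto' ht fun m => ?_
  rw [ival_eq_fval hv hβ m r]
  have h3 := ival_le hv hβ (r + m)
  have h4 := ival_nonneg (v := v) hβ (r + m)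
  have : ival β v (r + m) ≤ (k : ℝ) - 1 := by nlinarith
  have := mul_le_mul_of_nonneg_left this (pow_nonneg h0 m)
  linarith [h m]

lemma fval_drop {β : ℝ} (hβ : 2 ≤ β) (w v : Seq) (m : ℕ) :
    ∀ r r0, (∀ s < m, w (r + s) ≤ v (r0 + s)) → fval β w m r ≤ fval β v m r0 := by
  induction m with
  | zero => intro r r0 _; simp [fval]
  | succ m ih =>
    intro r r0 h
    have h1 := ih (r + 1) (r0 + 1) (fun s hs => by
      have := h (s + 1) (by omega)
      rwa [← add_assoc, add_right_comm, ← add_assoc r0, add_right_comm r0] at this)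
    have h2 : (w r : ℝ) ≤ v r0 := by exact_mod_cast h 0 (by omega)
    simp only [fval]
    gcongr

lemma fval_drop_strict {β : ℝ} (hβ : 2 ≤ β) (w v : Seq) (m : ℕ) :
    ∀ r r0, (∀ s < m, w (r + s) ≤ v (r0 + s)) → (∃ t < m, w (r + t) < v (r0 + t)) →
      fval β w m r ≤ fval β v m r0 - (1 / β) ^ m := by
  induction m with
  | zero => rintro r r0 _ ⟨t, ht, _⟩; omega
  | succ m ih =>
    rintro r r0 h ⟨t, ht, hlt⟩
    have h' : ∀ s < m, w (r + 1 + s) ≤ v (r0 + 1 + s) := fun s hs => by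
      have := h (s + 1) (by omega)
      rwa [← add_assoc, add_right_comm, ← add_assoc r0, add_right_comm r0] at this
    have hb : 0 < β := by linarith
    simp only [fval]
    have key : (w r : ℝ) + fval β w m (r + 1) ≤ v r0 + fval β v m (r0 + 1) - (1 / β) ^ m := by
      rcases Nat.eq_zero_or_pos t with rfl | htp
      · have h1 := fval_drop hβ w v m (r + 1) (r0 + 1) h'
        have h2 : ((w r + 1 : ℕ) : ℝ) ≤ v r0 := by exact_mod_cast hlt
        push_cast at h2
        have : (1 / β) ^ m ≤ 1 := pow_le_one₀ (by positivity) (by rw [div_le_one hb]; linarith)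
        linarith
      · have h1 := ih (r + 1) (r0 + 1) h' ⟨t - 1, by omega, by
          rwa [show r + 1 + (t - 1) = r + t by omega, show r0 + 1 + (t - 1) = r0 + t by omega]⟩
        have h2 : (w r : ℝ) ≤ v r0 := by exact_mod_cast h 0 (by omega)
        linarith
    calc _ ≤ (v r0 + fval β v m (r0 + 1) - (1 / β) ^ m) / β := by gcongr
      _ = _ := by rw [pow_succ]; ring

lemma fval_bound {k : ℕ} {v : Seq} (hv : InSigma k v) {β : ℝ} (hβ : 2 ≤ β) (hk1 : 1 ≤ k)
    (m : ℕ) : ∀ r, fval β v m r ≤ (k : ℝ) - 1 := by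
  have hk' : (1 : ℝ) ≤ k := by exact_mod_cast hk1
  induction m with
  | zero => intro r; simp [fval]; exact_mod_cast hk1
  | succ m ih =>
    intro r
    simp only [fval]
    rw [div_le_iff₀ (by linarith)]
    nlinarith [ih (r + 1), digit_le hv r]

lemma fval_compare {k : ℕ} {v : Seq} (hv : InSigma k v) {β γ : ℝ} (hβ : 2 ≤ β) (hβγ : β ≤ γ)
    (hk1 : 1 ≤ k) (m : ℕ) :
    ∀ r, fval β v m r ≤ fval γ v m r + ((k : ℝ) - 1) * (γ - β) := by
  have hk' : (1 : ℝ) ≤ k := by exact_mod_cast hk1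
  have hK : 0 ≤ ((k : ℝ) - 1) * (γ - β) := mul_nonneg (by linarith) (by linarith)
  induction m with
  | zero => intro r; simpa [fval] using hK
  | succ m ih =>
    intro r
    simp only [fval]
    have hb : 0 < β := by linarith
    have hg : 0 < γ := by linarith
    set A : ℝ := (v r : ℝ) + fval β v m (r + 1) with hA
    set B : ℝ := (v r : ℝ) + fval γ v m (r + 1) with hB
    have h1 : A ≤ B + ((k : ℝ) - 1) * (γ - β) := by
      have := ih (r + 1); simp only [hA, hB]; linarith
    have h2 : A ≤ 2 * ((k : ℝ) - 1) := by
      have := fval_bound hv hβ hk1 m (r + 1); have := digit_le hv r; simp only [hA]; linarith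
    have h3 : A / β = A / γ + A * (γ - β) / (β * γ) := by field_simp; ring
    have h4 : A / γ ≤ B / γ + ((k : ℝ) - 1) * (γ - β) / 2 := by
      calc A / γ ≤ (B + ((k : ℝ) - 1) * (γ - β)) / γ := by gcongr
        _ = B / γ + ((k : ℝ) - 1) * (γ - β) / γ := by ring
        _ ≤ _ := by gcongr; linarith
    have h5 : A * (γ - β) / (β * γ) ≤ ((k : ℝ) - 1) * (γ - β) / 2 := by
      rw [div_le_div_iff₀ (by positivity) (by norm_num)]
      have : A * (γ - β) ≤ 2 * (((k : ℝ) - 1) * (γ - β)) := by nlinarith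
      have : 4 ≤ β * γ := by nlinarith
      nlinarith
    linarith

lemma fval_small {v : Seq} {β : ℝ} (hβ : 2 ≤ β) (h : ∀ r, (v r : ℝ) + 1 ≤ β) (m : ℕ) :
    ∀ r, fval β v m r ≤ 1 := by
  induction m with
  | zero => intro r; simp [fval]
  | succ m ih =>
    intro r
    simp only [fval]
    rw [div_le_iff₀ (by linarith)]
    linarith [ih (r + 1), h r]

lemma freq_of_bdd {w : Seq} {i : ℕ} {a B : ℝ} (h : ∀ r : ℕ, |(digitCount w i r : ℝ) - r * a| ≤ B) :
    Tendsto (fun r => (digitCount w i r : ℝ) / (r : ℝ)) atTop (𝓝 a) := by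
  rw [tendsto_iff_dist_tendsto_zero]
  have hB : Tendsto (fun r : ℕ => B / (r : ℝ)) atTop (𝓝 0) :=
    tendsto_const_div_atTop_nhds_zero_nat B
  refine squeeze_zero' (Eventually.of_forall fun _ => dist_nonneg) ?_ hB
  filter_upwards [eventually_gt_atTop 0] with r hr
  have hr' : (0 : ℝ) < r := by exact_mod_cast hr
  rw [Real.dist_eq, show (digitCount w i r : ℝ) / r - a = ((digitCount w i r : ℝ) - r * a) / r by
    field_simp, abs_div, abs_of_pos hr']
  gcongr
  exact h r

lemma digitCount_succ (w : Seq) (i r : ℕ) :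
    digitCount w i (r + 1) = digitCount w i r + if w r = i then 1 else 0 := by
  unfold digitCount
  rw [Finset.range_add_one, Finset.filter_insert]
  split_ifs with h
  · rw [Finset.card_insert_of_notMem (by simp)]
  · simp

lemma digitCount_sum {k : ℕ} {w : Seq} (hw : InSigma k w) (r : ℕ) :
    ∑ i : Fin k, digitCount w i r = r := by
  induction r with
  | zero => simp [digitCount]
  | succ r ih =>
    simp_rw [digitCount_succ, Finset.sum_add_distrib]
    rw [ih]
    congr 1
    rw [Finset.sum_eq_single ⟨w r, hw r⟩]
    · simp
    · intro b _ hb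
      rw [if_neg]
      intro h
      exact hb (Fin.ext h.symm)
    · simp

/-- Greedy construction of a sequence with given frequencies. -/
noncomputable def greedyState {k : ℕ} (sel : (Fin k → ℝ) → Fin k) (α : E k) : ℕ → (Fin k → ℝ)
  | 0 => fun _ => 0
  | r + 1 => fun i => greedyState sel α r i + α i -
      if i = sel (fun j => greedyState sel α r j + α j) then 1 else 0

lemma exists_seq_freq {k : ℕ} (hk : 3 ≤ k) {α : E k} (hα : α ∈ simplex k) :
    ∃ v : Seq, InSigma k v ∧ HasDigitFreq k v α ∧ ∀ r, 0 < proj α (v r) := by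
  have : Nonempty (Fin k) := ⟨⟨0, by omega⟩⟩
  have hsel : ∀ f : Fin k → ℝ, ∃ i, ∀ j, f j ≤ f i := fun f => Finite.exists_max f
  choose sel hsel using hsel
  set e := greedyState sel α with he
  set d : ℕ → Fin k := fun r => sel (fun j => e r j + α j) with hd
  have hstep : ∀ r i, e (r + 1) i = e r i + α i - if i = d r then 1 else 0 := fun r i => rfl
  have hsum : ∀ r, ∑ i, e r i = 0 := by
    intro r
    induction r with
    | zero => simp [he, greedyState]
    | succ r ih =>
      simp_rw [hstep, Finset.sum_sub_distrib, Finset.sum_add_distrib]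
      rw [ih, hα.2]
      simp
  have hpos : ∀ r, 0 < e r (d r) + α (d r) := by
    intro r
    by_contra hc
    push Not at hc
    have h1 : ∑ i, (e r i + α i) ≤ ∑ i : Fin k, (0 : ℝ) :=
      Finset.sum_le_sum fun i _ => (hsel (fun j => e r j + α j) i).trans hc
    rw [Finset.sum_add_distrib, hsum, hα.2] at h1
    norm_num at h1
  have hlow : ∀ r i, -1 ≤ e r i := by
    intro r
    induction r with
    | zero => intro i; simp [he, greedyState]
    | succ r ih =>
      intro i
      rw [hstep]
      split_ifs with h
      · subst h; linarith [hpos r]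
      · linarith [ih i, hα.1 i]
  have hup : ∀ r i, e r i ≤ k := by
    intro r i
    have h1 : e r i + 1 ≤ ∑ j, (e r j + 1) :=
      Finset.single_le_sum (f := fun j => e r j + 1) (fun j _ => by linarith [hlow r j])
        (Finset.mem_univ i)
    rw [Finset.sum_add_distrib, hsum] at h1
    simp at h1
    linarith
  have hcnt : ∀ r (i : Fin k), (digitCount (fun r => (d r : ℕ)) i r : ℝ) = r * α i - e r i := by
    intro r i
    induction r with
    | zero => simp [digitCount, he, greedyState]
    | succ r ih =>
      rw [digitCount_succ, hstep]
      push_cast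
      rw [ih]
      by_cases h : i = d r
      · subst h; simp; ring
      · rw [if_neg h, if_neg (fun h' => h (Fin.ext h'.symm))]; push_cast; ring
  have hzero : ∀ r i, α i = 0 → e r i ≤ 0 := by
    intro r i hi
    induction r with
    | zero => simp [he, greedyState]
    | succ r ih =>
      rw [hstep, hi]
      split_ifs <;> linarith
  refine ⟨fun r => (d r : ℕ), fun r => (d r).2, ?_, ?_⟩
  · intro i hi
    apply freq_of_bdd (B := k + 1)
    intro r
    have := hcnt r ⟨i, hi⟩
    simp only [proj, hi, dif_pos]
    rw [this, abs_le]
    constructor <;> linarith [hlow r ⟨i, hi⟩, hup r ⟨i, hi⟩]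
  · intro r
    simp only [proj, (d r).2, dif_pos]
    refine lt_of_le_of_ne (hα.1 _) fun h => ?_
    have := hzero r (d r) h.symm
    have := hpos r
    simp only [Fin.eta] at h
    rw [← h] at this
    linarith

/-- (A) every point of `DFext` is realised by a sequence all of whose finite values are `≤ 1`. -/
lemma DFext_out {k : ℕ} (hk : 3 ≤ k) {β : ℝ} (hβ : β ∈ Set.Icc ((k : ℝ) - 1) k) {α : E k}
    (hα : α ∈ DFext k β) : α ∈ simplex k ∧ ∃ v : Seq, InSigma k v ∧ HasDigitFreq k v α ∧
      ∀ m r, fval β v m r ≤ 1 := by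
  have hk' : (3 : ℝ) ≤ k := by exact_mod_cast hk
  have h2 : 2 ≤ β := by linarith [hβ.1]
  unfold DFext at hα
  split_ifs at hα with h1 h3
  · refine ⟨hα.1, ?_⟩
    obtain ⟨v, hv, hf, hp⟩ := exists_seq_freq hk hα.1
    refine ⟨v, hv, hf, fun m r => fval_small h2 (fun r => ?_) m r⟩
    have hne : v r ≠ k - 1 := fun h => by
      have := hp r
      rw [h, hα.2] at this
      exact lt_irrefl _ this
    have := hv r
    have h4 : v r + 2 ≤ k := by omega
    have h5 : ((v r + 2 : ℕ) : ℝ) ≤ k := by exact_mod_cast h4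
    push_cast at h5
    linarith [hβ.1]
  · refine ⟨hα, ?_⟩
    obtain ⟨v, hv, hf, hp⟩ := exists_seq_freq hk hα
    refine ⟨v, hv, hf, fun m r => fval_small h2 (fun r => ?_) m r⟩
    linarith [digit_le hv r]
  · obtain ⟨hs, x, hx, hf⟩ := hα
    push Not at h1 h3
    have hy : ∀ r, 0 ≤ (fbeta β)^[r] x ∧ (fbeta β)^[r] x ≤ 1 := by
      intro r
      cases r with
      | zero => exact hx
      | succ r =>
        rw [Function.iterate_succ_apply']
        exact ⟨Int.fract_nonneg _, (Int.fract_lt_one _).le⟩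
    have hrec : ∀ r, β * (fbeta β)^[r] x = (dbeta β x r : ℝ) + (fbeta β)^[r + 1] x := by
      intro r
      rw [Function.iterate_succ_apply']
      have h0 : 0 ≤ β * (fbeta β)^[r] x := mul_nonneg (by linarith) (hy r).1
      simp only [dbeta, fbeta]
      rw [natCast_floor_eq_intCast_floor h0]
      exact (Int.floor_add_fract _).symm
    refine ⟨hs, dbeta β x, ?_, hf, ?_⟩
    · intro r
      have : (dbeta β x r : ℝ) < k := by
        have := hrec r
        nlinarith [hy r, hy (r + 1)]
      exact_mod_cast this
    · have : ∀ m r, fval β (dbeta β x) m r ≤ (fbeta β)^[r] x := by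
        intro m
        induction m with
        | zero => intro r; simpa [fval] using (hy r).1
        | succ m ih =>
          intro r
          simp only [fval]
          rw [div_le_iff₀ (by linarith)]
          linarith [ih (r + 1), hrec r]
      exact fun m r => (this m r).trans (hy r).2

/-- (B) a sufficient criterion for membership in `DFext`. -/
lemma DFext_in {k : ℕ} (hk : 3 ≤ k) {β : ℝ} (hβ : β ∈ Set.Icc ((k : ℝ) - 1) k) {α : E k}
    (hα : α ∈ simplex k) (v : Seq) (hv : InSigma k v) (hf : HasDigitFreq k v α)
    (h : ∀ r, v r ≠ 0 → ival β v r < 1) : α ∈ DFext k β := by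
  have hk' : (3 : ℝ) ≤ k := by exact_mod_cast hk
  have h2 : 2 ≤ β := by linarith [hβ.1]
  unfold DFext
  split_ifs with h1 h3
  · refine ⟨hα, ?_⟩
    have hne : ∀ r, v r ≠ k - 1 := by
      intro r hr
      have hlt := h r (by omega)
      have hrec := ival_rec hv h2 r
      have hn := ival_nonneg (v := v) h2 (r + 1)
      rw [hr, Nat.cast_sub (by omega)] at hrec
      push_cast at hrec
      nlinarith
    have ht := hf (k - 1) (by omega)
    have hz : (fun r => (digitCount v (k - 1) r : ℝ) / (r : ℝ)) = fun _ => 0 := by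
      funext r
      simp [digitCount, hne]
    rw [hz] at ht
    exact tendsto_nhds_unique ht tendsto_const_nhds
  · exact hα
  · push Not at h1 h3
    have hlt : ∀ r, ival β v r < 1 := fun r => by
      by_cases h0 : v r = 0
      · exact ival_zero_lt hk hv h1 r h0
      · exact h r h0
    have hit : ∀ r, (fbeta β)^[r] (ival β v 0) = ival β v r := by
      intro r
      induction r with
      | zero => rfl
      | succ r ih =>
        rw [Function.iterate_succ_apply', ih]
        unfold fbeta
        rw [ival_rec hv h2 r, Int.fract_natCast_add]
        exact Int.fract_eq_self.2 ⟨ival_nonneg h2 _, hlt _⟩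
    have hd : dbeta β (ival β v 0) = v := by
      funext r
      unfold dbeta
      rw [hit, ival_rec hv h2 r, Nat.floor_eq_iff (add_nonneg (by positivity) (ival_nonneg h2 _))]
      exact ⟨by linarith [ival_nonneg (v := v) h2 (r + 1)], by linarith [hlt (r + 1)]⟩
    exact ⟨hα, ival β v 0, ⟨ival_nonneg h2 _, (hlt 0).le⟩, by rwa [hd]⟩

lemma DFext_mono {k : ℕ} (hk : 3 ≤ k) {β γ : ℝ} (hβ : β ∈ Set.Icc ((k : ℝ) - 1) k)
    (hγ : γ ∈ Set.Icc ((k : ℝ) - 1) k) (hle : β ≤ γ) : DFext k β ⊆ DFext k γ := by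
  have hk' : (3 : ℝ) ≤ k := by exact_mod_cast hk
  have h2 : 2 ≤ β := by linarith [hβ.1]
  rcases hle.eq_or_lt with rfl | hlt
  · exact subset_rfl
  intro α hα
  obtain ⟨hs, v, hv, hf, hval⟩ := DFext_out hk hβ hα
  refine DFext_in hk hγ hs v hv hf fun r hr => ?_
  have hr' : (1 : ℝ) ≤ v r := by exact_mod_cast Nat.one_le_iff_ne_zero.2 hr
  have h1 := ival_le_of_fval hv h2 r (fun m => hval m r)
  have h3 : ival γ v (r + 1) ≤ ival β v (r + 1) := by
    refine (ival_summable hv (by linarith) _).tsum_le_tsum (fun s => ?_) (ival_summable hv h2 _)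
    have hg : 0 < γ := by linarith
    gcongr
  have h4 := ival_rec hv h2 r
  have h5 := ival_rec hv (h2.trans hle) r
  have h6 := ival_nonneg (v := v) h2 (r + 1)
  by_contra hc
  push Not at hc
  have : ival β v r > 0 := by nlinarith
  nlinarith

/-- The modification of `v` by blocks of length `N`: keep a digit only if it is not one of the
first two of its block and a later digit of its block is nonzero. -/
noncomputable def modSeq (N : ℕ) (v : Seq) : Seq := fun n =>
  if 2 ≤ n % N ∧ ∃ t, n < t ∧ t / N = n / N ∧ v t ≠ 0 then v n else 0

lemma modSeq_le (N : ℕ) (v : Seq) (n : ℕ) : modSeq N v n ≤ v n := by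
  unfold modSeq; split_ifs <;> omega

lemma modSeq_count {N L : ℕ} (v : Seq) (hN : 0 < N) (i : ℕ) :
    |(digitCount (modSeq N v) i (N * L) : ℝ) - digitCount v i (N * L)| ≤ 3 * L := by
  set C := (Finset.range (N * L)).filter fun n => modSeq N v n ≠ v n with hC
  have hcard : C.card ≤ 3 * L := by
    have : C.card ≤ (Finset.range L ×ˢ Finset.range 3).card := by
      refine Finset.card_le_card_of_injOn (fun n => (n / N, min (n % N) 2)) ?_ ?_
      · intro n hn
        simp only [hC, Finset.coe_filter, Finset.mem_range, Set.mem_setOf_eq] at hn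
        simp only [Finset.coe_product, Finset.coe_range, Set.mem_prod, Set.mem_Iio]
        exact ⟨Nat.div_lt_of_lt_mul hn.1, by omega⟩
      · intro a ha b hb hab
        simp only [hC, Finset.coe_filter, Finset.mem_range, Set.mem_setOf_eq] at ha hb
        simp only [Prod.mk.injEq] at hab
        obtain ⟨h1, h2⟩ := hab
        have ea := Nat.div_add_mod a N
        have eb := Nat.div_add_mod b N
        rw [h1] at ea
        by_cases h3 : a % N < 2
        · have : a % N = b % N := by omega
          omega
        · have hb2 : 2 ≤ b % N := by omega
          have aux : ∀ n, modSeq N v n ≠ v n → 2 ≤ n % N →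
              v n ≠ 0 ∧ ∀ t, n < t → t / N = n / N → v t = 0 := by
            intro n hn h2n
            unfold modSeq at hn
            split_ifs at hn with hc
            · exact absurd rfl hn
            · refine ⟨fun h => hn h.symm, fun t h1 h2 => ?_⟩
              by_contra h3
              exact hc ⟨h2n, t, h1, h2, h3⟩
          have pa := aux a ha.2 (by omega)
          have pb := aux b hb.2 hb2
          rcases lt_trichotomy a b with h | h | h
          · exact absurd (pa.2 b h h1.symm) pb.1
          · exact h
          · exact absurd (pb.2 a h h1) pa.1
    simp at this
    omega
  have gen : ∀ u w : Seq, (∀ n, n ∈ Finset.range (N * L) → u n ≠ w n → n ∈ C) →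
      digitCount u i (N * L) ≤ digitCount w i (N * L) + 3 * L := by
    intro u w h
    unfold digitCount
    calc _ ≤ (((Finset.range (N * L)).filter fun s => w s = i) ∪ C).card := by
          apply Finset.card_le_card
          intro n hn
          rw [Finset.mem_filter] at hn
          rw [Finset.mem_union, Finset.mem_filter]
          by_cases huw : u n = w n
          · exact Or.inl ⟨hn.1, huw ▸ hn.2⟩
          · exact Or.inr (h n hn.1 huw)
      _ ≤ _ := (Finset.card_union_le _ _).trans (by omega)
  have g1 := gen (modSeq N v) v fun n hn h => Finset.mem_filter.2 ⟨hn, h⟩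
  have g2 := gen v (modSeq N v) fun n hn h => Finset.mem_filter.2 ⟨hn, fun h' => h h'.symm⟩
  have g1' : (digitCount (modSeq N v) i (N * L) : ℝ) ≤ digitCount v i (N * L) + 3 * L := by
    exact_mod_cast g1
  have g2' : (digitCount v i (N * L) : ℝ) ≤ digitCount (modSeq N v) i (N * L) + 3 * L := by
    exact_mod_cast g2
  rw [abs_le]
  constructor <;> linarith

lemma digitCount_periodic (w : Seq) {M : ℕ} (hM : 0 < M) (i : ℕ) (r : ℕ) :
    digitCount (fun n => w (n % M)) i (r + M) =
      digitCount (fun n => w (n % M)) i r + digitCount w i M := by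
  induction r with
  | zero =>
    simp only [zero_add, digitCount, Finset.range_zero, Finset.filter_empty, Finset.card_empty]
    congr 1
    refine Finset.filter_congr fun n hn => ?_
    rw [Nat.mod_eq_of_lt (Finset.mem_range.1 hn)]
  | succ r ih =>
    rw [show r + 1 + M = r + M + 1 by ring, digitCount_succ, ih, digitCount_succ]
    simp only [Nat.add_mod_right]
    omega

lemma freq_periodic (w : Seq) {M : ℕ} (hM : 0 < M) (i : ℕ) :
    Tendsto (fun r => (digitCount (fun n => w (n % M)) i r : ℝ) / (r : ℝ)) atTop
      (𝓝 ((digitCount w i M : ℝ) / M)) := by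
  have hM' : (0 : ℝ) < M := by exact_mod_cast hM
  have hle : ∀ u : Seq, ∀ r, digitCount u i r ≤ r := fun u r => by
    unfold digitCount
    exact (Finset.card_filter_le _ _).trans (by simp)
  have ha1 : (digitCount w i M : ℝ) / M ≤ 1 := by
    rw [div_le_one hM']; exact_mod_cast hle w M
  have ha0 : 0 ≤ (digitCount w i M : ℝ) / M := by positivity
  apply freq_of_bdd (B := M)
  intro r
  induction r using Nat.strong_induction_on with
  | _ r ih =>
    by_cases hr : r < M
    · have h1 : (digitCount (fun n => w (n % M)) i r : ℝ) ≤ r := by exact_mod_cast hle _ r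
      have h2 : (r : ℝ) ≤ M := by exact_mod_cast hr.le
      have h0 : (0 : ℝ) ≤ r := by positivity
      have h3 : (0 : ℝ) ≤ digitCount (fun n => w (n % M)) i r := by positivity
      have h4 : (r : ℝ) * ((digitCount w i M : ℝ) / M) ≤ r := mul_le_of_le_one_right h0 ha1
      have h5 : 0 ≤ (r : ℝ) * ((digitCount w i M : ℝ) / M) := mul_nonneg h0 ha0
      rw [abs_le]
      constructor <;> linarith
    · obtain ⟨q, rfl⟩ : ∃ q, r = q + M := ⟨r - M, by omega⟩
      have := ih q (by omega)
      rw [digitCount_periodic w hM]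
      push_cast
      convert this using 2
      field_simp
      ring

lemma mod_mul_add {N L r s : ℕ} (hN : 0 < N) (hL : 0 < L) (h : r % N + s < N) :
    (r + s) % (N * L) = r % (N * L) + s := by
  have hM : 0 < N * L := Nat.mul_pos hN hL
  have h1 : r % (N * L) % N = r % N := Nat.mod_mul_right_mod r N L
  have h2 : r % (N * L) < N * L := Nat.mod_lt _ hM
  have h3 : r % (N * L) / N < L := Nat.div_lt_of_lt_mul h2
  have h4 := Nat.div_add_mod (r % (N * L)) N
  have h5 : r % (N * L) + s < N * L := by
    have : N * (r % (N * L) / N + 1) ≤ N * L := Nat.mul_le_mul_left N h3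
    rw [mul_add, mul_one] at this
    omega
  rw [Nat.add_mod, Nat.mod_eq_of_lt (a := s) (by omega), Nat.mod_eq_of_lt h5]

/-- The periodised modification is admissible for a slightly smaller base. -/
lemma mod_adm {k : ℕ} (hk : 3 ≤ k) {β γ : ℝ} (hβ : β ∈ Set.Icc ((k : ℝ) - 1) k)
    (hle : β ≤ γ) {N L : ℕ} (hN : 2 ≤ N) (hL : 0 < L)
    (hδ : (k : ℝ) * (γ - β) < (1 / (k : ℝ)) ^ N / 2) {v : Seq} (hv : InSigma k v)
    (hval : ∀ m r, fval γ v m r ≤ 1) (r : ℕ) (hr : modSeq N v (r % (N * L)) ≠ 0) :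
    ival β (fun n => modSeq N v (n % (N * L))) r < 1 := by
  have hk' : (3 : ℝ) ≤ k := by exact_mod_cast hk
  have h2 : 2 ≤ β := by linarith [hβ.1]
  set w : Seq := fun n => modSeq N v (n % (N * L)) with hw
  have hwS : InSigma k w := fun n => (modSeq_le N v _).trans_lt (hv _)
  set r0 := r % (N * L) with hr0
  have hr0N : r0 % N = r % N := Nat.mod_mul_right_mod r N L
  have hrN : r % N < N := Nat.mod_lt _ (by omega)
  set m := N - r % N with hm
  have hcong : ∀ s < m, (r + s) % (N * L) = r0 + s := fun s hs =>
    mod_mul_add (by omega) hL (by omega)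
  -- the last nonzero digit
  obtain ⟨t, ht, hwt, hvt⟩ : ∃ t < m, modSeq N v (r0 + t) = 0 ∧ v (r0 + t) ≠ 0 := by
    have hex : ∃ t < m, v (r0 + t) ≠ 0 := by
      unfold modSeq at hr
      split_ifs at hr with hc
      · obtain ⟨_, t, h1, h2, h3⟩ := hc
        refine ⟨t - r0, ?_, by rwa [show r0 + (t - r0) = t by omega]⟩
        have e1 := Nat.div_add_mod t N
        have e2 := Nat.div_add_mod r0 N
        have e3 : t % N < N := Nat.mod_lt _ (by omega)
        rw [h2] at e1
        omega
      · exact absurd rfl hr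
    have hP := Nat.findGreatest_spec (P := fun t => t < m ∧ v (r0 + t) ≠ 0) (n := m)
      hex.choose_spec.1.le hex.choose_spec
    set T := Nat.findGreatest (fun t => t < m ∧ v (r0 + t) ≠ 0) m with hT
    refine ⟨T, hP.1, ?_, hP.2⟩
    unfold modSeq
    rw [if_neg]
    rintro ⟨_, t, h1, h2, h3⟩
    have e1 := Nat.div_add_mod t N
    have e2 := Nat.div_add_mod (r0 + T) N
    have e3 : t % N < N := Nat.mod_lt _ (by omega)
    have e4 : (r0 + T) % N = r0 % N + T := by
      rw [Nat.add_mod, Nat.mod_eq_of_lt (a := T) (by omega), Nat.mod_eq_of_lt (by omega)]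
    rw [h2] at e1
    refine Nat.findGreatest_is_greatest (P := fun t => t < m ∧ v (r0 + t) ≠ 0) (n := m)
      (k := t - r0) (by omega) (by omega) ⟨by omega, ?_⟩
    rwa [show r0 + (t - r0) = t by omega]
  have hdrop := fval_drop_strict h2 w v m r r0
    (fun s hs => by simp only [hw]; rw [hcong s hs]; exact modSeq_le N v _)
    ⟨t, ht, by simp only [hw]; rw [hcong t ht, hwt]; omega⟩
  have hz : ∀ n, n % N < 2 → w n = 0 := by
    intro n hn
    simp only [hw, modSeq]
    rw [Nat.mod_mul_right_mod, if_neg (by omega)]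
  have hend : (r + m) % N = 0 := by
    have := Nat.div_add_mod r N
    have : r + m = N * (r / N + 1) := by rw [mul_add]; omega
    rw [this, Nat.mul_mod_right]
  have hhalf := ival_zero_zero hk hwS hβ.1 (r + m) (hz _ (by omega)) (hz _ (by
    rw [Nat.add_mod, hend, zero_add, Nat.mod_mod]
    have := Nat.mod_le 1 N
    omega))
  have hcmp := fval_compare hv h2 hle (by omega) m r0
  have hpow : (1 / (k : ℝ)) ^ N ≤ (1 / β) ^ m := by
    have hkpos : (0 : ℝ) < k := by linarith
    calc (1 / (k : ℝ)) ^ N ≤ (1 / (k : ℝ)) ^ m := by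
          apply pow_le_pow_of_le_one (by positivity)
          · rw [div_le_one hkpos]; linarith
          · omega
      _ ≤ _ := by
          have := hβ.2
          gcongr
  rw [ival_eq_fval hwS h2 m r]
  have hpp : 0 ≤ (1 / β) ^ m := by positivity
  have h7 : (1 / β) ^ m * ival β w (r + m) ≤ (1 / β) ^ m * (1 / 2) := by gcongr
  have h8 := hval m r0
  nlinarith

lemma DFext_approx {k : ℕ} (hk : 3 ≤ k) {ε : ℝ} (hε : 0 < ε) : ∃ δ > (0 : ℝ),
    ∀ β ∈ Set.Icc ((k : ℝ) - 1) k, ∀ γ ∈ Set.Icc ((k : ℝ) - 1) k, β ≤ γ → γ - β < δ →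
      ∀ α ∈ DFext k γ, ∃ α' ∈ DFext k β, dist α α' ≤ ε := by
  have hk' : (3 : ℝ) ≤ k := by exact_mod_cast hk
  have hkpos : (0 : ℝ) < k := by linarith
  set η := ε / k with hη
  have hηpos : 0 < η := by positivity
  obtain ⟨N, hN⟩ := exists_nat_gt (max 2 (6 / η))
  have hN2 : 2 ≤ N := by
    have : (2 : ℝ) < N := (le_max_left _ _).trans_lt hN
    have : 2 < N := by exact_mod_cast this
    omega
  have hNpos : (0 : ℝ) < N := by positivity
  have hN6 : 3 / (N : ℝ) ≤ η / 2 := by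
    have h := ((le_max_right _ _).trans_lt hN).le
    rw [div_le_iff₀ hηpos] at h
    rw [div_le_div_iff₀ hNpos (by norm_num)]
    linarith
  refine ⟨(1 / (k : ℝ)) ^ N / 2 / k, by positivity, ?_⟩
  intro β hβ γ hγ hle hδ α hα
  obtain ⟨hs, v, hv, hf, hval⟩ := DFext_out hk hγ hα
  have hev : ∀ᶠ r : ℕ in atTop, ∀ i : Fin k,
      dist ((digitCount v i r : ℝ) / (r : ℝ)) (proj α i) < η / 2 := by
    rw [eventually_all]
    intro i
    exact Metric.tendsto_nhds.1 (hf i i.2) (η / 2) (by positivity)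
  obtain ⟨R, hR⟩ := eventually_atTop.1 hev
  set L := R + 1 with hL
  have hLpos : 0 < L := by omega
  have hM : 0 < N * L := Nat.mul_pos (by omega) hLpos
  have hMR : R ≤ N * L := by nlinarith
  have hM' : (0 : ℝ) < ((N * L : ℕ) : ℝ) := by exact_mod_cast hM
  have hwS : InSigma k (fun n => modSeq N v (n % (N * L))) :=
    fun n => (modSeq_le N v _).trans_lt (hv _)
  have hmS : InSigma k (modSeq N v) := fun n => (modSeq_le N v _).trans_lt (hv _)
  refine ⟨freqVec k (modSeq N v) (N * L), ?_, ?_⟩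
  · refine DFext_in hk hβ ?_ _ hwS ?_ ?_
    · refine ⟨fun i => ?_, ?_⟩
      · simp only [freqVec, WithLp.equiv_symm_apply]
        positivity
      · simp only [freqVec, WithLp.equiv_symm_apply]
        rw [← Finset.sum_div, ← Nat.cast_sum, digitCount_sum hmS]
        exact div_self hM'.ne'
    · intro i hi
      simp only [proj, hi, dif_pos, freqVec, WithLp.equiv_symm_apply]
      exact freq_periodic _ hM i
    · intro r hr
      refine mod_adm hk hβ hle hN2 hLpos ?_ hv hval r hr
      rw [lt_div_iff₀ hkpos] at hδ
      linarith
  · have hc : ∀ i : Fin k, dist (α i) (freqVec k (modSeq N v) (N * L) i) ≤ η := by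
      intro i
      have h1 := hR (N * L) hMR i
      have h2 := modSeq_count (N := N) (L := L) v (by omega) i
      simp only [proj, i.2, dif_pos] at h1
      simp only [freqVec, WithLp.equiv_symm_apply]
      have h3 : dist ((digitCount v i (N * L) : ℝ) / ((N * L : ℕ) : ℝ))
          ((digitCount (modSeq N v) i (N * L) : ℝ) / ((N * L : ℕ) : ℝ)) ≤ η / 2 := by
        rw [dist_comm, Real.dist_eq, ← sub_div, abs_div, abs_of_pos hM']
        refine le_trans ?_ hN6
        rw [div_le_div_iff₀ hM' hNpos]
        push_cast
        nlinarith
      rw [dist_comm] at h1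
      have := dist_triangle (α i) _ _ |>.trans (add_le_add h1.le h3)
      linarith
    rw [EuclideanSpace.dist_eq]
    apply Real.sqrt_le_iff.2
    refine ⟨hε.le, ?_⟩
    calc _ ≤ ∑ _i : Fin k, η ^ 2 := Finset.sum_le_sum fun i _ => by
          gcongr
          exact hc i
      _ = k * η ^ 2 := by simp
      _ ≤ ε ^ 2 := by
          have : ε = k * η := by rw [hη]; field_simp
          rw [this]
          have : 0 ≤ η ^ 2 := by positivity
          nlinarith

/-- the extension of `DF` to `[k−1,k]` (with `DF(k−1) = F`, `DF(k) = Δ`) is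
increasing and continuous for the Hausdorff metric. -/
theorem stmt13 (k : ℕ) (hk : 3 ≤ k) :
    (∀ β γ : ℝ, β ∈ Set.Icc ((k : ℝ) - 1) (k : ℝ) → γ ∈ Set.Icc ((k : ℝ) - 1) (k : ℝ) →
      β ≤ γ → DFext k β ⊆ DFext k γ) ∧
    (∀ β ∈ Set.Icc ((k : ℝ) - 1) (k : ℝ), ∀ ε > (0 : ℝ), ∃ δ > (0 : ℝ),
      ∀ γ ∈ Set.Icc ((k : ℝ) - 1) (k : ℝ), |γ - β| < δ →
        Metric.hausdorffDist (DFext k γ) (DFext k β) < ε) := by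
  refine ⟨fun β γ hβ hγ hle => DFext_mono hk hβ hγ hle, fun β hβ ε hε => ?_⟩
  obtain ⟨δ, hδ, H⟩ := DFext_approx hk (half_pos hε)
  refine ⟨δ, hδ, fun γ hγ hd => ?_⟩
  rw [abs_lt] at hd
  refine lt_of_le_of_lt ?_ (half_lt_self hε)
  rcases le_total β γ with hle | hle
  · refine Metric.hausdorffDist_le_of_mem_dist (half_pos hε).le
      (H β hβ γ hγ hle (by linarith)) fun x hx => ?_
    exact ⟨x, DFext_mono hk hβ hγ hle hx, by simpa using (half_pos hε).le⟩
  · refine Metric.hausdorffDist_le_of_mem_dist (half_pos hε).le (fun x hx => ?_)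
      (H γ hγ β hβ hle (by linarith))
    exact ⟨x, DFext_mono hk hγ hβ hle hx, by simpa using (half_pos hε).le⟩

end BetaDF
end
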